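/- For every integer n ≥ 0: C(0,8;4n+3) + C(1,8;4n+3) = C(3,8;4n+3) + C(4,8;4n+3) = N(0,8;4n+3) + N(1,8;4n+3) = N(2,8;4n+3) + N(3,8;4n+3). -/

import Mathlib

/-- The rank of a partition: its largest part minus its number of parts. -/
def partitionRank {n : ℕ} (π : n.Partition) : ℤ :=
  (π.parts.sup : ℤ) - π.parts.card

/-- The crank of a partition: the largest part if there are no parts equal to 1,
otherwise the number of parts larger than the number of ones minus the number of ones. -/
def partitionCrank {n : ℕ} (π : n.Partition) : ℤ :=
  if π.parts.count 1 = 0 then (π.parts.sup : ℤ)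
  else ((π.parts.filter (fun x => π.parts.count 1 < x)).card : ℤ) - π.parts.count 1

/-- `N(a,M;n)`: the number of partitions of `n` whose rank is congruent to `a` modulo `M`. -/
def rankCount (a : ℤ) (M : ℕ) (n : ℕ) : ℕ :=
  (Finset.univ.filter (fun π : n.Partition => partitionRank π % M = a % M)).card

/-- `C(a,M;n)`: the number of partitions of `n` whose crank is congruent to `a` modulo `M`. -/
def crankCount (a : ℤ) (M : ℕ) (n : ℕ) : ℕ :=
  (Finset.univ.filter (fun π : n.Partition => partitionCrank π % M = a % M)).card


section
namespace RC

open PowerSeries Finset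

/-- The ring of formal power series we work in. -/
abbrev S := PowerSeries ℂ

/-- Convergence in the `X`-adic topology. -/
def Conv (a : ℕ → S) (L : S) : Prop :=
  ∀ M : ℕ, ∃ N0 : ℕ, ∀ N, N0 ≤ N → (X : S) ^ M ∣ a N - L

theorem eq_of_forall_dvd {a b : S} (h : ∀ M : ℕ, (X : S) ^ M ∣ a - b) : a = b := by
  ext n
  have := (X_pow_dvd_iff.mp (h (n + 1))) n (Nat.lt_succ_self n)
  rw [map_sub] at this
  exact sub_eq_zero.mp this

theorem Conv.unique {a : ℕ → S} {L L' : S} (h : Conv a L) (h' : Conv a L') : L = L' := by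
  apply eq_of_forall_dvd
  intro M
  obtain ⟨N1, h1⟩ := h M
  obtain ⟨N2, h2⟩ := h' M
  have e1 := h1 (max N1 N2) (le_max_left _ _)
  have e2 := h2 (max N1 N2) (le_max_right _ _)
  have := dvd_sub e2 e1
  convert this using 1
  ring

theorem Conv.const (L : S) : Conv (fun _ => L) L := fun M => ⟨0, fun N _ => by simp⟩

theorem Conv.add {a b : ℕ → S} {A B : S} (ha : Conv a A) (hb : Conv b B) :
    Conv (fun N => a N + b N) (A + B) := by
  intro M
  obtain ⟨N1, h1⟩ := ha M
  obtain ⟨N2, h2⟩ := hb M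
  refine ⟨max N1 N2, fun N hN => ?_⟩
  have := dvd_add (h1 N (le_of_max_le_left hN)) (h2 N (le_of_max_le_right hN))
  convert this using 1
  ring

theorem Conv.mul {a b : ℕ → S} {A B : S} (ha : Conv a A) (hb : Conv b B) :
    Conv (fun N => a N * b N) (A * B) := by
  intro M
  obtain ⟨N1, h1⟩ := ha M
  obtain ⟨N2, h2⟩ := hb M
  refine ⟨max N1 N2, fun N hN => ?_⟩
  have := dvd_add ((h1 N (le_of_max_le_left hN)).mul_right B)
    ((h2 N (le_of_max_le_right hN)).mul_left (a N))
  convert this using 1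
  ring

theorem Conv.sub {a b : ℕ → S} {A B : S} (ha : Conv a A) (hb : Conv b B) :
    Conv (fun N => a N - b N) (A - B) := by
  have := ha.add ((Conv.const (-1)).mul hb)
  convert this using 1
  · ext N : 1
    ring
  · ring

theorem Conv.inv {a : ℕ → S} {A : S} (ha : Conv a A) (h0 : ∀ N, constantCoeff (a N) ≠ 0)
    (hA : constantCoeff A ≠ 0) : Conv (fun N => (a N)⁻¹) A⁻¹ := by
  intro M
  obtain ⟨N1, h1⟩ := ha M
  refine ⟨N1, fun N hN => ?_⟩
  have e : (a N)⁻¹ - A⁻¹ = (a N - A) * (-((a N)⁻¹ * A⁻¹)) := by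
    have e1 := PowerSeries.mul_inv_cancel (a N) (h0 N)
    have e2 := PowerSeries.mul_inv_cancel A hA
    linear_combination (-(a N)⁻¹) * e2 + A⁻¹ * e1
  rw [e]
  exact (h1 N hN).mul_right _

theorem Conv.comp {a : ℕ → S} {A : S} (ha : Conv a A) {f : ℕ → ℕ}
    (hf : ∀ M, ∃ N0, ∀ N, N0 ≤ N → M ≤ f N) : Conv (fun N => a (f N)) A := by
  intro M
  obtain ⟨N1, h1⟩ := ha M
  obtain ⟨N0, h0⟩ := hf N1
  exact ⟨N0, fun N hN => h1 _ (h0 N hN)⟩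

theorem Conv.congr {a b : ℕ → S} {A : S} (ha : Conv a A) (N1 : ℕ)
    (h : ∀ N, N1 ≤ N → a N = b N) : Conv b A := by
  intro M
  obtain ⟨N0, h0⟩ := ha M
  refine ⟨max N0 N1, fun N hN => ?_⟩
  rw [← h N (le_of_max_le_right hN)]
  exact h0 N (le_of_max_le_left hN)

theorem Conv.coeff {a : ℕ → S} {A : S} (ha : Conv a A) (n : ℕ) :
    ∃ N0, ∀ N, N0 ≤ N → PowerSeries.coeff n (a N) = PowerSeries.coeff n A := by
  obtain ⟨N0, h0⟩ := ha (n + 1)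
  refine ⟨N0, fun N hN => ?_⟩
  have := (X_pow_dvd_iff.mp (h0 N hN)) n (Nat.lt_succ_self n)
  rw [map_sub] at this
  exact sub_eq_zero.mp this

/-- the limit of a sequence whose differences are divisible by growing powers of `X`. -/
noncomputable def lim (a : ℕ → S) : S := PowerSeries.mk fun n => PowerSeries.coeff n (a (n + 1))

theorem lim_dvd {a : ℕ → S} (h : ∀ N, (X : S) ^ N ∣ a (N + 1) - a N) (N : ℕ) :
    (X : S) ^ N ∣ a N - lim a := by
  have key : ∀ j N : ℕ, (X : S) ^ N ∣ a (N + j) - a N := by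
    intro j
    induction j with
    | zero => intro N; simp
    | succ j ih =>
      intro N
      have h1 := ih N
      have h2 := (pow_dvd_pow (X : S) (Nat.le_add_right N j)).trans (h (N + j))
      have := dvd_add h1 h2
      convert this using 1
      rw [← add_assoc]
      ring
  rw [X_pow_dvd_iff]
  intro m hm
  rw [map_sub, lim, coeff_mk]
  obtain ⟨j, rfl⟩ : ∃ j, N = m + 1 + j := ⟨N - (m + 1), by omega⟩
  have := (X_pow_dvd_iff.mp (key j (m + 1))) m (Nat.lt_succ_self m)
  rwa [map_sub] at this

theorem lim_conv {a : ℕ → S} (h : ∀ N, (X : S) ^ N ∣ a (N + 1) - a N) : Conv a (lim a) :=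
  fun M => ⟨M, fun N hN => (pow_dvd_pow _ hN).trans (lim_dvd h N)⟩

/-! ### infinite sums -/

/-- infinite sum -/
noncomputable def psum (g : ℕ → S) : S := lim fun N => ∑ k ∈ range N, g k

/-- summability -/
def Sm (g : ℕ → S) : Prop := ∀ k, (X : S) ^ k ∣ g k

theorem psum_dvd {g : ℕ → S} (h : Sm g) (N : ℕ) :
    (X : S) ^ N ∣ ∑ k ∈ range N, g k - psum g := by
  apply lim_dvd (a := fun N => ∑ k ∈ range N, g k)
  intro N
  simp only [sum_range_succ, add_sub_cancel_left]
  exact h N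

theorem psum_conv {g : ℕ → S} (h : Sm g) : Conv (fun N => ∑ k ∈ range N, g k) (psum g) :=
  fun M => ⟨M, fun N hN => (pow_dvd_pow _ hN).trans (psum_dvd h N)⟩

theorem coeff_psum {g : ℕ → S} (h : Sm g) {n N : ℕ} (hN : n < N) :
    coeff n (psum g) = ∑ k ∈ range N, coeff n (g k) := by
  have := (X_pow_dvd_iff.mp (psum_dvd h N)) n hN
  rw [map_sub, map_sum] at this
  exact (sub_eq_zero.mp this).symm

theorem psum_eq {g : ℕ → S} (h : Sm g) {L : S} (hL : Conv (fun N => ∑ k ∈ range N, g k) L) :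
    psum g = L := (psum_conv h).unique hL

theorem Sm.add {f g : ℕ → S} (hf : Sm f) (hg : Sm g) : Sm (fun k => f k + g k) :=
  fun k => dvd_add (hf k) (hg k)

theorem Sm.sub {f g : ℕ → S} (hf : Sm f) (hg : Sm g) : Sm (fun k => f k - g k) :=
  fun k => dvd_sub (hf k) (hg k)

theorem Sm.mul_left {g : ℕ → S} (hg : Sm g) (f : ℕ → S) : Sm (fun k => f k * g k) :=
  fun k => (hg k).mul_left _

theorem Sm.mul_right {g : ℕ → S} (hg : Sm g) (f : ℕ → S) : Sm (fun k => g k * f k) :=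
  fun k => (hg k).mul_right _

theorem Sm.shift {g : ℕ → S} (hg : Sm g) (j : ℕ) : Sm (fun k => g (k + j)) :=
  fun k => (pow_dvd_pow _ (Nat.le_add_right k j)).trans (hg (k + j))

theorem sm_pow {e : ℕ → ℕ} (he : ∀ k, k ≤ e k) : Sm (fun k => (X : S) ^ e k) :=
  fun k => pow_dvd_pow _ (he k)

theorem psum_add {f g : ℕ → S} (hf : Sm f) (hg : Sm g) :
    psum (fun k => f k + g k) = psum f + psum g := by
  apply psum_eq (hf.add hg)
  simpa only [sum_add_distrib] using (psum_conv hf).add (psum_conv hg)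

theorem psum_sub {f g : ℕ → S} (hf : Sm f) (hg : Sm g) :
    psum (fun k => f k - g k) = psum f - psum g := by
  apply psum_eq (hf.sub hg)
  simpa only [sum_sub_distrib] using (psum_conv hf).sub (psum_conv hg)

theorem psum_mul_left {g : ℕ → S} (hg : Sm g) (c : S) :
    psum (fun k => c * g k) = c * psum g := by
  apply psum_eq (hg.mul_left _)
  simpa only [mul_sum] using (Conv.const c).mul (psum_conv hg)

theorem psum_shift {g : ℕ → S} (hg : Sm g) (j : ℕ) :
    psum g = ∑ k ∈ range j, g k + psum (fun k => g (k + j)) := by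
  ext n
  rw [map_add, coeff_psum hg (n := n) (N := j + (n + 1)) (by omega),
    coeff_psum (hg.shift j) (Nat.lt_succ_self n), sum_range_add, map_sum]
  congr 1
  apply sum_congr rfl
  intro k _
  rw [add_comm]

theorem psum_comm {g : ℕ → ℕ → S} (h1 : ∀ k m, (X : S) ^ k ∣ g k m)
    (h2 : ∀ k m, (X : S) ^ m ∣ g k m) :
    psum (fun k => psum (fun m => g k m)) = psum (fun m => psum (fun k => g k m)) := by
  have a1 : ∀ k, Sm (fun m => g k m) := fun k m => h2 k m
  have a2 : ∀ m, Sm (fun k => g k m) := fun m k => h1 k m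
  have b : ∀ f : ℕ → S, ∀ j, Sm f → (∀ m, (X : S) ^ j ∣ f m) → (X : S) ^ j ∣ psum f := by
    intro f j hf hj
    rw [X_pow_dvd_iff]
    intro m hm
    rw [coeff_psum hf (Nat.lt_succ_self m)]
    exact sum_eq_zero fun k _ => (X_pow_dvd_iff.mp (hj k)) m hm
  have b1 : Sm (fun k => psum (fun m => g k m)) := fun k => b _ k (a1 k) (fun m => h1 k m)
  have b2 : Sm (fun m => psum (fun k => g k m)) := fun m => b _ m (a2 m) (fun k => h2 k m)
  ext n
  rw [coeff_psum b1 (Nat.lt_succ_self n), coeff_psum b2 (Nat.lt_succ_self n)]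
  simp only [fun k => coeff_psum (a1 k) (Nat.lt_succ_self n),
    fun k => coeff_psum (a2 k) (Nat.lt_succ_self n)]
  exact sum_comm

/-- Tannery's theorem. -/
theorem tannery {c : ℕ → ℕ → S} {g : ℕ → S} {L : S} (hg : Sm g)
    (hc : ∀ k, Conv (fun N => c N k) L) {f : ℕ → ℕ} (hf : ∀ M, ∃ N0, ∀ N, N0 ≤ N → M ≤ f N) :
    Conv (fun N => ∑ k ∈ range (f N), c N k * g k) (L * psum g) := by
  rw [← psum_mul_left hg]
  intro M
  choose N1 h1 using fun k => hc k M
  obtain ⟨N0, h0⟩ := hf M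
  refine ⟨N0 + ∑ k ∈ range M, N1 k, fun N hN => ?_⟩
  have hM := h0 N (by omega)
  have e1 := (pow_dvd_pow _ hM).trans (psum_dvd (hg.mul_left (fun _ => L)) (f N))
  have e2 : (X : S) ^ M ∣ ∑ k ∈ range (f N), (c N k * g k - L * g k) := by
    apply dvd_sum
    intro k _
    rw [← sub_mul]
    by_cases hk : k < M
    · have : N1 k ≤ ∑ k ∈ range M, N1 k :=
        single_le_sum (f := N1) (fun _ _ => Nat.zero_le _) (mem_range.mpr hk)
      exact (h1 k N (by omega)).mul_right _
    · exact ((pow_dvd_pow _ (by omega)).trans (hg k)).mul_left _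
  have := dvd_add e2 e1
  convert this using 1
  rw [sum_sub_distrib]
  ring

/-! ### infinite products -/

/-- finite product `∏ (1 - c X^(e+sk))` -/
noncomputable def Pn (c : ℂ) (e s N : ℕ) : S := ∏ k ∈ range N, (1 - C c * X ^ (e + s * k))

/-- infinite product -/
noncomputable def Pinf (c : ℂ) (e s : ℕ) : S := lim (Pn c e s)

theorem Pn_conv (c : ℂ) (e s : ℕ) (hs : 0 < s) : Conv (Pn c e s) (Pinf c e s) := by
  apply lim_conv
  intro N
  rw [Pn, Pn, prod_range_succ, mul_sub, mul_one, sub_sub_cancel_left, dvd_neg]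
  refine Dvd.dvd.mul_left (Dvd.dvd.mul_left (pow_dvd_pow _ ?_) _) _
  nlinarith

theorem Pinf_eq {c : ℂ} {e s : ℕ} (hs : 0 < s) {L : S} (h : Conv (Pn c e s) L) : Pinf c e s = L :=
  (Pn_conv c e s hs).unique h

theorem const_Pn (c : ℂ) (e s N : ℕ) (he : 0 < e) : constantCoeff (Pn c e s N) = 1 := by
  rw [Pn, map_prod]
  apply prod_eq_one
  intro k _
  have : e + s * k ≠ 0 := by omega
  rw [map_sub, map_mul, map_pow, constantCoeff_X, zero_pow this]
  simp

theorem Conv.constCoeff {a : ℕ → S} {A : S} (ha : Conv a A) {z : ℂ}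
    (h : ∀ N, constantCoeff (a N) = z) : constantCoeff A = z := by
  obtain ⟨N0, h0⟩ := ha.coeff 0
  have := h0 N0 le_rfl
  simp only [coeff_zero_eq_constantCoeff] at this
  rw [← this]
  exact h _

theorem const_Pinf (c : ℂ) (e s : ℕ) (he : 0 < e) (hs : 0 < s) : constantCoeff (Pinf c e s) = 1 :=
  (Pn_conv c e s hs).constCoeff fun N => const_Pn c e s N he

theorem const_Pinf_ne (c : ℂ) (e s : ℕ) (he : 0 < e) (hs : 0 < s) :
    constantCoeff (Pinf c e s) ≠ 0 := by
  rw [const_Pinf c e s he hs]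
  exact one_ne_zero

theorem Pinf_ne (c : ℂ) (e s : ℕ) (he : 0 < e) (hs : 0 < s) : Pinf c e s ≠ 0 := by
  intro h
  have := const_Pinf_ne c e s he hs
  rw [h] at this
  simp at this

theorem Pinf_split (c : ℂ) (e s : ℕ) (hs : 0 < s) :
    Pinf c e s = Pinf c e (2 * s) * Pinf c (e + s) (2 * s) := by
  have h1 := (Pn_conv c e (2 * s) (by omega)).mul (Pn_conv c (e + s) (2 * s) (by omega))
  have h2 := (Pn_conv c e s hs).comp (f := fun N => 2 * N) (fun M => ⟨M, fun N h => by omega⟩)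
  refine h2.unique (h1.congr 0 fun N _ => ?_)
  induction N with
  | zero => simp [Pn]
  | succ N ih =>
    replace ih := ih (Nat.zero_le _)
    simp only [Pn] at ih ⊢
    rw [show 2 * (N + 1) = 2 * N + 1 + 1 by ring, prod_range_succ, prod_range_succ,
      prod_range_succ, prod_range_succ, ← ih]
    ring_nf

theorem Pinf_step (c : ℂ) (e s : ℕ) (hs : 0 < s) :
    Pinf c e s = (1 - C c * X ^ e) * Pinf c (e + s) s := by
  have h1 := (Conv.const (1 - C c * X ^ e)).mul (Pn_conv c (e + s) s (by omega))
  have h2 := (Pn_conv c e s hs).comp (f := fun N => N + 1) (fun M => ⟨M, fun N h => by omega⟩)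
  refine h2.unique (h1.congr 0 fun N _ => ?_)
  simp only [Pn]
  rw [prod_range_succ', mul_comm]
  congr 1
  apply prod_congr rfl
  intro k _
  ring_nf

theorem Pinf_sq (c : ℂ) (e s : ℕ) (hs : 0 < s) :
    Pinf c e s * Pinf (-c) e s = Pinf (c ^ 2) (2 * e) (2 * s) := by
  have h1 := (Pn_conv c e s hs).mul (Pn_conv (-c) e s hs)
  refine h1.unique ((Pn_conv (c ^ 2) (2 * e) (2 * s) (by omega)).congr 0 fun N _ => ?_)
  simp only [Pn, ← prod_mul_distrib]
  apply prod_congr rfl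
  intro k _
  rw [map_neg, map_pow, show 2 * e + 2 * s * k = (e + s * k) * 2 by ring, pow_mul]
  ring

theorem Conv.rescale {a : ℕ → S} {A : S} (ha : Conv a A) (c : ℂ) :
    Conv (fun N => PowerSeries.rescale c (a N)) (PowerSeries.rescale c A) := by
  intro M
  obtain ⟨N0, h0⟩ := ha M
  refine ⟨N0, fun N hN => ?_⟩
  rw [← map_sub, X_pow_dvd_iff]
  intro m hm
  rw [coeff_rescale, (X_pow_dvd_iff.mp (h0 N hN)) m hm, mul_zero]

theorem rescale_CX (a c : ℂ) (e : ℕ) :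
    rescale a (C c * X ^ e : S) = C (c * a ^ e) * X ^ e := by
  ext n
  rw [coeff_rescale, coeff_C_mul, coeff_C_mul, coeff_X_pow]
  split_ifs with h
  · subst h; ring
  · simp

theorem rescale_Pinf (a c : ℂ) (e s : ℕ) (hs : 0 < s) (h : a ^ s = 1) :
    rescale a (Pinf c e s) = Pinf (c * a ^ e) e s := by
  refine ((Pn_conv c e s hs).rescale a).unique ((Pn_conv _ e s hs).congr 0 fun N _ => ?_)
  simp only [Pn, map_prod, map_sub, map_one, rescale_CX]
  apply prod_congr rfl
  intro k _
  rw [pow_add a, pow_mul a, h, one_pow, mul_one]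

end RC
end

section
namespace RC

open Finset

/-- triangular numbers -/
def tri : ℕ → ℕ
  | 0 => 0
  | n + 1 => tri n + (n + 1)

theorem two_tri (n : ℕ) : 2 * tri n = n * (n + 1) := by
  induction n with
  | zero => rfl
  | succ n ih => rw [tri]; linarith

section field

variable {K : Type*} [Field K]

/-- partial fractions for `w^d / ∏ (1 - u_i w)` -/
theorem partial_fractions {ι : Type*} [DecidableEq ι] (s : Finset ι) (u : ι → K)
    (hu : Set.InjOn u s) (h0 : ∀ i ∈ s, u i ≠ 0) (w : K) (hw : ∀ i ∈ s, 1 - u i * w ≠ 0)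
    (d : ℕ) (hd : d < s.card) :
    w ^ d / ∏ i ∈ s, (1 - u i * w) =
      ∑ i ∈ s, ((u i) ^ d * ∏ j ∈ s.erase i, (1 - u j / u i))⁻¹ * (1 - u i * w)⁻¹ := by
  have hinj : Set.InjOn (fun i => (u i)⁻¹) (s : Set ι) := by
    intro a ha b hb hab
    exact hu ha hb (inv_injective hab)
  have h1 := Lagrange.eq_interpolate (f := (Polynomial.X ^ d : Polynomial K)) (v := fun i => (u i)⁻¹)
    (s := s) hinj (by rw [Polynomial.degree_X_pow]; exact_mod_cast hd)
  have h2 := congrArg (Polynomial.eval w) h1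
  rw [Lagrange.interpolate_apply, Polynomial.eval_finsetSum] at h2
  simp only [Polynomial.eval_pow, Polynomial.eval_X, Polynomial.eval_mul, Polynomial.eval_C,
    Lagrange.basis, Polynomial.eval_prod, Lagrange.basisDivisor, Polynomial.eval_sub] at h2
  rw [h2, sum_div]
  apply sum_congr rfl
  intro i hi
  rw [← mul_prod_erase s _ hi]
  have hui := h0 i hi
  have e : ∀ j ∈ s.erase i, ((u i)⁻¹ - (u j)⁻¹)⁻¹ * (w - (u j)⁻¹) =
      (1 - u j * w) * (1 - u j / u i)⁻¹ := by
    intro j hj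
    have huj := h0 j (mem_of_mem_erase hj)
    have hne : u i ≠ u j := fun h => (ne_of_mem_erase hj) (hu hi (mem_of_mem_erase hj) h).symm
    have h3 : u j - u i ≠ 0 := fun h => hne (sub_eq_zero.mp h).symm
    have h4 : (u i)⁻¹ - (u j)⁻¹ = (u j - u i) / (u i * u j) := by field_simp
    have h5 : 1 - u j / u i = - (u j - u i) / u i := by field_simp; ring
    rw [h4, h5, inv_div, inv_div]
    field_simp
    ring
  rw [prod_congr rfl e, prod_mul_distrib, prod_inv_distrib]
  have h6 : ∏ j ∈ s.erase i, (1 - u j * w) ≠ 0 :=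
    prod_ne_zero_iff.mpr fun j hj => hw j (mem_of_mem_erase hj)
  have h7 := hw i hi
  rw [mul_inv, inv_pow, div_eq_mul_inv, mul_inv]
  generalize ∏ j ∈ s.erase i, (1 - u j * w) = A at *
  generalize (∏ j ∈ s.erase i, (1 - u j / u i))⁻¹ = B
  field_simp

theorem partial_fractions_two (s t : Finset ℕ) (u v : ℕ → K)
    (hu : Set.InjOn u s) (hv : Set.InjOn v t) (huv : ∀ i ∈ s, ∀ j ∈ t, u i ≠ v j)
    (hu0 : ∀ i ∈ s, u i ≠ 0) (hv0 : ∀ i ∈ t, v i ≠ 0) (w : K)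
    (huw : ∀ i ∈ s, 1 - u i * w ≠ 0) (hvw : ∀ i ∈ t, 1 - v i * w ≠ 0)
    (d : ℕ) (hd : d < s.card + t.card) :
    w ^ d / ((∏ i ∈ s, (1 - u i * w)) * ∏ i ∈ t, (1 - v i * w)) =
      ∑ i ∈ s, ((u i) ^ d * ((∏ j ∈ s.erase i, (1 - u j / u i)) *
        ∏ j ∈ t, (1 - v j / u i)))⁻¹ * (1 - u i * w)⁻¹ +
      ∑ i ∈ t, ((v i) ^ d * ((∏ j ∈ s, (1 - u j / v i)) *
        ∏ j ∈ t.erase i, (1 - v j / v i)))⁻¹ * (1 - v i * w)⁻¹ := by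
  have h := partial_fractions (s.disjSum t) (Sum.elim u v) ?_ ?_ w ?_ d ?_
  · rw [prod_disjSum, sum_disjSum] at h
    simp only [Sum.elim_inl, Sum.elim_inr] at h
    rw [h]
    congr 1
    · apply sum_congr rfl
      intro i hi
      have : (s.disjSum t).erase (Sum.inl i) = (s.erase i).disjSum t := by
        ext x; cases x <;> simp
      rw [this, prod_disjSum]
      simp only [Sum.elim_inl, Sum.elim_inr]
    · apply sum_congr rfl
      intro i hi
      have : (s.disjSum t).erase (Sum.inr i) = s.disjSum (t.erase i) := by
        ext x; cases x <;> simp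
      rw [this, prod_disjSum]
      simp only [Sum.elim_inl, Sum.elim_inr]
  · rintro (a | a) ha (b | b) hb hab
    · simp at ha hb hab
      rw [hu ha hb hab]
    · simp at ha hb hab
      exact absurd hab (huv a ha b hb)
    · simp at ha hb hab
      exact absurd hab.symm (huv b hb a ha)
    · simp at ha hb hab
      rw [hv ha hb hab]
  · rintro (a | a) ha
    · simp at ha; exact hu0 a ha
    · simp at ha; exact hv0 a ha
  · rintro (a | a) ha
    · simp at ha; exact huw a ha
    · simp at ha; exact hvw a ha
  · rwa [card_disjSum]

/-- q-Pochhammer symbol -/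
def poch (c Q : K) (n : ℕ) : K := ∏ j ∈ range n, (1 - c * Q ^ j)

theorem poch_low (c Q : K) (hc : c ≠ 0) (hQ : Q ≠ 0) (k : ℕ) :
    Q ^ tri k * ∏ j ∈ range k, (1 - c * Q ^ j / Q ^ k) = (-c) ^ k * poch (Q / c) Q k := by
  induction k with
  | zero => simp [tri, poch]
  | succ k ih =>
    rw [prod_range_succ']
    have e : ∏ j ∈ range k, (1 - c * Q ^ (j + 1) / Q ^ (k + 1)) =
        ∏ j ∈ range k, (1 - c * Q ^ j / Q ^ k) := by
      apply prod_congr rfl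
      intro j _
      rw [pow_succ, pow_succ]
      field_simp
    have e2 : Q ^ (k + 1) * (1 - c * Q ^ 0 / Q ^ (k + 1)) = -c * (1 - Q / c * Q ^ k) := by
      rw [pow_succ]
      field_simp
      ring
    rw [e, tri, pow_add, mul_mul_mul_comm, ih, e2, poch, poch, prod_range_succ]
    ring

theorem poch_shift (c Q : K) (hc : c ≠ 0) (hQ : Q ≠ 0) (k r : ℕ) :
    Q ^ tri k * ∏ j ∈ range (k + r), (1 - c * Q ^ j / Q ^ k) =
      (-c) ^ k * poch (Q / c) Q k * poch c Q r := by
  rw [prod_range_add, ← mul_assoc, poch_low c Q hc hQ]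
  congr 1
  apply prod_congr rfl
  intro j _
  rw [pow_add]
  field_simp

theorem poch_erase (Q : K) (hQ : Q ≠ 0) (k r : ℕ) :
    Q ^ tri k * ∏ j ∈ (range (k + 1 + r)).erase k, (1 - Q ^ j / Q ^ k) =
      (-1) ^ k * poch Q Q k * poch Q Q r := by
  have e : ∏ j ∈ (range (k + 1 + r)).erase k, (1 - Q ^ j / Q ^ k) =
      (∏ j ∈ range k, (1 - 1 * Q ^ j / Q ^ k)) * poch Q Q r := by
    have : (range (k + 1 + r)).erase k = range k ∪ (range r).image (fun j => k + 1 + j) := by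
      ext x
      simp only [mem_erase, mem_range, mem_union, mem_image]
      constructor
      · rintro ⟨h1, h2⟩
        by_cases h : x < k
        · left; exact h
        · right; exact ⟨x - (k + 1), by omega, by omega⟩
      · rintro (h | ⟨a, ha, rfl⟩) <;> omega
    rw [this, prod_union, prod_image]
    · simp only [one_mul]
      congr 1
      apply prod_congr rfl
      intro j _
      rw [pow_add, pow_succ]
      field_simp
    · intro a _ b _ h
      simpa using h
    · rw [disjoint_left]
      intro x hx hx'
      simp only [mem_image, mem_range] at hx hx'
      obtain ⟨a, _, rfl⟩ := hx'
      omega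
  rw [e, ← mul_assoc, poch_low 1 Q one_ne_zero hQ, div_one]

end field

end RC
end

section
namespace RC

open Finset

section fieldD

variable {K : Type*} [Field K]

/-- auxiliary product of the second family at a node of the first one -/
def E1 (q : K) (N κ : ℕ) : K :=
  if κ % 2 = 0 then poch (-q) (q ^ 4) (2 * N - κ / 2) * poch (-q ^ 3) (q ^ 4) (κ / 2)
  else poch (-q ^ 3) (q ^ 4) (2 * N - (κ + 1) / 2) * poch (-q) (q ^ 4) ((κ + 1) / 2)

theorem E1_eq (q : K) (hq : q ≠ 0) (N κ : ℕ) (hκ : κ < 4 * N) :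
    q ^ tri κ * ∏ j ∈ range (2 * N), (1 - (-q ^ (4 * j + 1)) / q ^ (2 * κ)) = E1 q N κ := by
  unfold E1
  split_ifs with h
  · obtain ⟨l, rfl⟩ : ∃ l, κ = 2 * l := ⟨κ / 2, by omega⟩
    obtain ⟨r, hr⟩ : ∃ r, 2 * N = l + r := ⟨2 * N - l, by omega⟩
    have e := poch_shift (-q) (q ^ 4) (neg_ne_zero.mpr hq) (pow_ne_zero _ hq) l r
    have ht : 4 * tri l = l + tri (2 * l) := by
      have := two_tri l
      have := two_tri (2 * l)
      nlinarith
    rw [← pow_mul, ht, pow_add, neg_neg, show q ^ 4 / -q = -q ^ 3 by field_simp, mul_assoc,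
      mul_assoc, mul_right_inj' (pow_ne_zero _ hq)] at e
    rw [show 2 * N - 2 * l / 2 = r by omega, show 2 * l / 2 = l by omega, hr,
      mul_comm (poch (-q) _ _), ← e]
    congr 1
    apply prod_congr rfl
    intro j _
    rw [← pow_mul, ← pow_mul]
    ring
  · obtain ⟨l, rfl⟩ : ∃ l, κ = 2 * l + 1 := ⟨κ / 2, by omega⟩
    obtain ⟨r, hr⟩ : ∃ r, 2 * N = (l + 1) + r := ⟨2 * N - (l + 1), by omega⟩
    have e := poch_shift (-q ^ 3) (q ^ 4) (neg_ne_zero.mpr (pow_ne_zero _ hq))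
      (pow_ne_zero _ hq) (l + 1) r
    have ht : 4 * tri (l + 1) = 3 * (l + 1) + tri (2 * l + 1) := by
      have := two_tri (l + 1)
      have := two_tri (2 * l + 1)
      nlinarith
    rw [← pow_mul, ht, pow_add, neg_neg, show q ^ 4 / -q ^ 3 = -q by field_simp, mul_assoc,
      mul_assoc, ← pow_mul q 3 (l + 1), mul_right_inj' (pow_ne_zero _ hq)] at e
    rw [show 2 * N - (2 * l + 1 + 1) / 2 = r by omega, show (2 * l + 1 + 1) / 2 = l + 1 by omega,
      hr, mul_comm (poch (-q ^ 3) _ _), ← e]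
    congr 1
    apply prod_congr rfl
    intro j _
    rw [← pow_mul, ← pow_mul]
    have : q ^ (4 * (l + 1)) = q ^ (2 * (2 * l + 1)) * q ^ 2 := by ring
    rw [this]
    have : q ^ (2 * (2 * l + 1)) ≠ 0 := pow_ne_zero _ hq
    field_simp
    ring

theorem E2_eq (q : K) (hq : q ≠ 0) (N ν : ℕ) (hν : ν < 2 * N) :
    q ^ ((2 * ν + 1) ^ 2) * ∏ j ∈ range (4 * N), (1 - q ^ (2 * j) / (-q ^ (4 * ν + 1))) =
      poch (-q) (q ^ 2) (2 * ν + 1) * poch (-q) (q ^ 2) (4 * N - 2 * ν - 1) := by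
  obtain ⟨r, hr⟩ : ∃ r, 4 * N = (2 * ν + 1) + r := ⟨4 * N - (2 * ν + 1), by omega⟩
  have e := poch_shift (-q) (q ^ 2) (neg_ne_zero.mpr hq) (pow_ne_zero _ hq) (2 * ν + 1) r
  have ht : 2 * tri (2 * ν + 1) = (2 * ν + 1) + (2 * ν + 1) ^ 2 := by
    rw [two_tri]; ring
  rw [← pow_mul, ht, pow_add, neg_neg, show q ^ 2 / -q = -q by field_simp, mul_assoc,
    mul_assoc, mul_right_inj' (pow_ne_zero _ hq)] at e
  rw [show 4 * N - 2 * ν - 1 = r by omega, hr, ← e]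
  congr 1
  apply prod_congr rfl
  intro j _
  rw [← pow_mul, ← pow_mul]
  have : q ^ (2 * (2 * ν + 1)) = q ^ (4 * ν + 1) * q := by ring
  rw [this]
  have : q ^ (4 * ν + 1) ≠ 0 := pow_ne_zero _ hq
  field_simp

/-- denominators for the first family -/
def D1 (q : K) (N κ : ℕ) : K :=
  poch (q ^ 2) (q ^ 2) κ * poch (q ^ 2) (q ^ 2) (4 * N - 1 - κ) * E1 q N κ

/-- denominators for the second family -/
def D2 (q : K) (N ν : ℕ) : K :=
  poch (q ^ 4) (q ^ 4) ν * poch (q ^ 4) (q ^ 4) (2 * N - 1 - ν) *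
    (poch (-q) (q ^ 2) (2 * ν + 1) * poch (-q) (q ^ 2) (4 * N - 2 * ν - 1))

/-- finite theta product -/
def TN (q w : K) (N : ℕ) : K :=
  poch w (q ^ 2) (2 * N) * poch (q ^ 2 / w) (q ^ 2) (2 * N) *
    (poch (-q * w) (q ^ 4) N * poch (-q ^ 3 / w) (q ^ 4) N)

theorem node1 (q : K) (hq : q ≠ 0) (N κ : ℕ) (hκ : κ < 4 * N) :
    q ^ (3 * tri κ) * ((∏ j ∈ (range (4 * N)).erase κ, (1 - q ^ (2 * j) / q ^ (2 * κ))) *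
        ∏ j ∈ range (2 * N), (1 - (-q ^ (4 * j + 1)) / q ^ (2 * κ))) = (-1) ^ κ * D1 q N κ := by
  obtain ⟨r, hr⟩ : ∃ r, 4 * N = κ + 1 + r := ⟨4 * N - (κ + 1), by omega⟩
  have e := poch_erase (q ^ 2) (pow_ne_zero _ hq) κ r
  rw [← hr] at e
  simp only [← pow_mul] at e
  rw [D1, ← E1_eq q hq N κ hκ, show 4 * N - 1 - κ = r by omega,
    show 3 * tri κ = 2 * tri κ + tri κ by ring, pow_add]
  linear_combination (q ^ tri κ * ∏ j ∈ range (2 * N), (1 - (-q ^ (4 * j + 1)) / q ^ (2 * κ))) * e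

theorem node2 (q : K) (hq : q ≠ 0) (N ν : ℕ) (hν : ν < 2 * N) :
    q ^ (4 * tri ν + (2 * ν + 1) ^ 2) *
      ((∏ j ∈ range (4 * N), (1 - q ^ (2 * j) / (-q ^ (4 * ν + 1)))) *
        ∏ j ∈ (range (2 * N)).erase ν, (1 - (-q ^ (4 * j + 1)) / (-q ^ (4 * ν + 1)))) =
      (-1) ^ ν * D2 q N ν := by
  obtain ⟨r, hr⟩ : ∃ r, 2 * N = ν + 1 + r := ⟨2 * N - (ν + 1), by omega⟩
  have e := poch_erase (q ^ 4) (pow_ne_zero _ hq) ν r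
  rw [← hr] at e
  simp only [← pow_mul] at e
  have e2 : ∏ j ∈ (range (2 * N)).erase ν, (1 - (-q ^ (4 * j + 1)) / (-q ^ (4 * ν + 1))) =
      ∏ j ∈ (range (2 * N)).erase ν, (1 - q ^ (4 * j) / q ^ (4 * ν)) := by
    apply prod_congr rfl
    intro j _
    rw [pow_succ, pow_succ]
    have : q ^ (4 * ν) ≠ 0 := pow_ne_zero _ hq
    field_simp
  rw [e2, D2, ← E2_eq q hq N ν hν, show 2 * N - 1 - ν = r by omega, pow_add]
  linear_combination (q ^ ((2 * ν + 1) ^ 2) *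
    ∏ j ∈ range (4 * N), (1 - q ^ (2 * j) / (-q ^ (4 * ν + 1)))) * e

theorem sum_fold (f : ℕ → K) (M : ℕ) :
    ∑ k ∈ range (2 * M), f k = ∑ k ∈ range M, (f (M + k) + f (M - 1 - k)) := by
  rw [two_mul, sum_range_add, sum_add_distrib, add_comm]
  congr 1
  rw [sum_range_reflect]

theorem finite_D (q w : K) (hq : q ≠ 0) (hq1 : ∀ n, 0 < n → q ^ n ≠ 1) (hw4 : w ^ 4 = 1)
    (hw1 : w ≠ 1) (N : ℕ) (hN : 0 < N) :
    (TN q w N)⁻¹ =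
      ∑ k ∈ range (2 * N), (-1) ^ k * q ^ (3 * tri k) * ((D1 q N (2 * N + k))⁻¹ *
          (1 - w * q ^ (2 * k))⁻¹ + (D1 q N (2 * N - 1 - k))⁻¹ * (w⁻¹ * q ^ (2 * k + 2) *
          (1 - w⁻¹ * q ^ (2 * k + 2))⁻¹)) +
      ∑ n ∈ range N, (-1) ^ n * q ^ (12 * tri n + 1) * ((D2 q N (N + n))⁻¹ *
          (1 + w * q ^ (4 * n + 1))⁻¹ - (D2 q N (N - 1 - n))⁻¹ * (w⁻¹ * q ^ (4 * n + 3) *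
          (1 + w⁻¹ * q ^ (4 * n + 3))⁻¹)) := by
  have hw0 : w ≠ 0 := by
    rintro rfl
    simp at hw4
  have hinj : ∀ a b : ℕ, q ^ a = q ^ b → a = b := by
    have : ∀ a b : ℕ, a < b → q ^ a ≠ q ^ b := by
      intro a b hab h
      obtain ⟨c, rfl⟩ := Nat.exists_eq_add_of_lt hab
      rw [add_assoc, pow_add] at h
      have := mul_left_cancel₀ (pow_ne_zero a hq) ((mul_one _).trans h)
      exact hq1 _ (by omega) this.symm
    intro a b h
    rcases lt_trichotomy a b with h1 | h1 | h1
    · exact absurd h (this a b h1)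
    · exact h1
    · exact absurd h.symm (this b a h1)
  have hQ : ∀ a : ℕ, q ^ a ≠ 0 := fun a => pow_ne_zero a hq
  have H := partial_fractions_two (range (4 * N)) (range (2 * N)) (fun k => q ^ (2 * k))
    (fun k => -q ^ (4 * k + 1)) ?_ ?_ ?_ ?_ ?_ (w / q ^ (4 * N)) ?_ ?_ (3 * N)
    (by simp only [card_range]; omega)
  · have hA := poch_shift w (q ^ 2) hw0 (hQ 2) (2 * N) (2 * N)
    have hB := poch_shift (-q * w) (q ^ 4) (mul_ne_zero (neg_ne_zero.mpr hq) hw0) (hQ 4) N N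
    have eA : ∏ j ∈ range (4 * N), (1 - q ^ (2 * j) * (w / q ^ (4 * N))) =
        ∏ j ∈ range (2 * N + 2 * N), (1 - w * (q ^ 2) ^ j / (q ^ 2) ^ (2 * N)) := by
      rw [show 2 * N + 2 * N = 4 * N by ring]
      apply prod_congr rfl
      intro j _
      rw [← pow_mul, ← pow_mul, show 2 * (2 * N) = 4 * N by ring]
      ring
    have eB : ∏ j ∈ range (2 * N), (1 - (-q ^ (4 * j + 1)) * (w / q ^ (4 * N))) =
        ∏ j ∈ range (N + N), (1 - (-q * w) * (q ^ 4) ^ j / (q ^ 4) ^ N) := by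
      rw [show N + N = 2 * N by ring]
      apply prod_congr rfl
      intro j _
      rw [← pow_mul, ← pow_mul]
      ring
    have hqB : q ^ 4 / (-q * w) = -q ^ 3 / w := by field_simp
    rw [← eA] at hA
    rw [← eB, hqB] at hB
    have e4 : (-w) ^ (2 * N) = w ^ (2 * N) := by rw [pow_mul, neg_sq, ← pow_mul]
    have hAB : q ^ (6 * N ^ 2 + 4 * N) * ((∏ j ∈ range (4 * N), (1 - q ^ (2 * j) * (w / q ^ (4 * N)))) *
        ∏ j ∈ range (2 * N), (1 - (-q ^ (4 * j + 1)) * (w / q ^ (4 * N)))) =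
        q ^ N * w ^ (3 * N) * TN q w N := by
      have e3 : q ^ (6 * N ^ 2 + 4 * N) = (q ^ 2) ^ tri (2 * N) * (q ^ 4) ^ tri N := by
        rw [← pow_mul, ← pow_mul, ← pow_add]
        congr 1
        have := two_tri N
        have := two_tri (2 * N)
        nlinarith
      rw [e3, mul_mul_mul_comm, hA, hB, e4, TN, show -(-q * w) = q * w by ring, mul_pow,
        show 3 * N = 2 * N + N by ring, pow_add w]
      ring
    have hL : (TN q w N)⁻¹ = q ^ (6 * N ^ 2) / q ^ (3 * N) * ((w / q ^ (4 * N)) ^ (3 * N) /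
        ((∏ j ∈ range (4 * N), (1 - q ^ (2 * j) * (w / q ^ (4 * N)))) *
        ∏ j ∈ range (2 * N), (1 - (-q ^ (4 * j + 1)) * (w / q ^ (4 * N))))) := by
      have h1 : ((∏ j ∈ range (4 * N), (1 - q ^ (2 * j) * (w / q ^ (4 * N)))) *
        ∏ j ∈ range (2 * N), (1 - (-q ^ (4 * j + 1)) * (w / q ^ (4 * N)))) =
        q ^ N * w ^ (3 * N) * TN q w N / q ^ (6 * N ^ 2 + 4 * N) := by
        rw [← hAB, mul_div_cancel_left₀ _ (hQ _)]
      have h2 : q ^ (6 * N ^ 2 + 4 * N) = q ^ (6 * N ^ 2) * (q ^ N * q ^ (3 * N)) := by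
        rw [← pow_add, ← pow_add]; congr 1; ring
      have h3 : (q ^ (4 * N)) ^ (3 * N) = q ^ (6 * N ^ 2) * q ^ (6 * N ^ 2) := by
        rw [← pow_add, ← pow_mul]; congr 1; ring
      rw [h1, h2, div_pow, h3]
      have := hQ (6 * N ^ 2)
      have := hQ N
      have := hQ (3 * N)
      have := pow_ne_zero (3 * N) hw0
      generalize q ^ (6 * N ^ 2) = a at *
      generalize q ^ N = b at *
      generalize q ^ (3 * N) = c at *
      generalize w ^ (3 * N) = d at *
      rw [← one_div]
      field_simp
    rw [hL, H, mul_add]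
    congr 1
    · have fold := fun f : ℕ → K => sum_fold f (2 * N)
      rw [show 2 * (2 * N) = 4 * N by ring] at fold
      rw [fold, mul_sum]
      apply sum_congr rfl
      intro k hk
      rw [mem_range] at hk
      refine (mul_add _ _ _).trans (Eq.trans ?_ (mul_add _ _ _).symm)
      have gen : ∀ κ, κ < 4 * N → ∀ x : K, q ^ (3 * tri κ + 6 * N ^ 2) =
          q ^ (3 * tri k) * (q ^ (6 * N * κ) * q ^ (3 * N)) → 
          q ^ (6 * N ^ 2) / q ^ (3 * N) * (((q ^ (2 * κ)) ^ (3 * N) *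
          ((∏ j ∈ (range (4 * N)).erase κ, (1 - q ^ (2 * j) / q ^ (2 * κ))) *
            ∏ j ∈ range (2 * N), (1 - (-q ^ (4 * j + 1)) / q ^ (2 * κ))))⁻¹ * x) =
          (-1) ^ κ * q ^ (3 * tri k) * ((D1 q N κ)⁻¹ * x) := by
        intro κ hκ x hx
        have h1 : ((∏ j ∈ (range (4 * N)).erase κ, (1 - q ^ (2 * j) / q ^ (2 * κ))) *
            ∏ j ∈ range (2 * N), (1 - (-q ^ (4 * j + 1)) / q ^ (2 * κ))) =
            (-1) ^ κ * D1 q N κ / q ^ (3 * tri κ) := by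
          rw [← node1 q hq N κ hκ, mul_div_cancel_left₀ _ (hQ _)]
        rw [h1, ← pow_mul, show 2 * κ * (3 * N) = 6 * N * κ by ring]
        rw [pow_add] at hx
        have e5 : ((-1 : K) ^ κ)⁻¹ = (-1) ^ κ := by
          rw [← inv_pow]; norm_num
        have := hQ (3 * N)
        have := hQ (6 * N * κ)
        have := hQ (3 * tri κ)
        rw [mul_inv, inv_div, div_eq_mul_inv, div_eq_mul_inv, mul_inv, e5]
        generalize (-1 : K) ^ κ = s
        generalize (D1 q N κ)⁻¹ = D
        field_simp
        linear_combination (s * D * x) * hx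
      congr 1
      · rw [gen (2 * N + k) (by omega)]
        · rw [pow_add, pow_mul (-1 : K), neg_one_sq, one_pow, one_mul]
          congr 3
          have := hQ (4 * N)
          rw [show q ^ (2 * (2 * N + k)) = q ^ (4 * N) * q ^ (2 * k) by ring]
          field_simp
        · rw [← pow_add, ← pow_add]
          congr 1
          have := two_tri (2 * N + k)
          have := two_tri k
          nlinarith
      · obtain ⟨r, hr⟩ : ∃ r, 2 * N = r + 1 + k := ⟨2 * N - 1 - k, by omega⟩
        have hr' : 2 * N - 1 - k = r := by omega
        rw [hr', gen r (by omega)]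
        · have e6 : (-1 : K) ^ r = - (-1) ^ k := by
            have : (-1 : K) ^ (r + 1 + k) = 1 := by rw [← hr, pow_mul]; simp
            have h2 : ((-1 : K) ^ k) * (-1) ^ k = 1 := by rw [← mul_pow]; simp
            rw [pow_add, pow_succ] at this
            linear_combination (-(-1) ^ k) * this + (-(-1) ^ r) * h2
          have e7 : (1 - q ^ (2 * r) * (w / q ^ (4 * N)))⁻¹ =
              -(w⁻¹ * q ^ (2 * k + 2) * (1 - w⁻¹ * q ^ (2 * k + 2))⁻¹) := by
            have h3 : q ^ (4 * N) = q ^ (2 * r) * q ^ (2 * k + 2) := by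
              rw [← pow_add]; congr 1; omega
            have h4 : 1 - q ^ (2 * r) * (w / q ^ (4 * N)) =
              -(w * (q ^ (2 * k + 2))⁻¹) * (1 - w⁻¹ * q ^ (2 * k + 2)) := by
              rw [h3]
              have := hQ (2 * r)
              have := hQ (2 * k + 2)
              field_simp
              ring
            rw [h4, mul_inv, inv_neg, mul_inv, inv_inv]
            ring
          rw [e6, e7]
          ring
        · rw [← pow_add, ← pow_add]
          congr 1
          have h1 := two_tri r
          have h2 := two_tri k
          have h3 : (2 * N) * (2 * N) = (r + 1 + k) * (r + 1 + k) := by rw [hr]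
          have h4 : (2 * N) * r = (r + 1 + k) * r := by rw [hr]
          nlinarith
    · rw [sum_fold, mul_sum]
      apply sum_congr rfl
      intro n hn
      rw [mem_range] at hn
      refine (mul_add _ _ _).trans (Eq.trans ?_ (mul_sub _ _ _).symm)
      have gen : ∀ ν, ν < 2 * N → ∀ x : K, q ^ (4 * tri ν + (2 * ν + 1) ^ 2 + 6 * N ^ 2) =
          q ^ (12 * tri n + 1) * (q ^ ((4 * ν + 1) * (3 * N)) * q ^ (3 * N)) → 
          q ^ (6 * N ^ 2) / q ^ (3 * N) * (((-q ^ (4 * ν + 1)) ^ (3 * N) *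
          ((∏ j ∈ range (4 * N), (1 - q ^ (2 * j) / (-q ^ (4 * ν + 1)))) *
            ∏ j ∈ (range (2 * N)).erase ν, (1 - (-q ^ (4 * j + 1)) / (-q ^ (4 * ν + 1)))))⁻¹ * x) =
          (-1) ^ (N + ν) * q ^ (12 * tri n + 1) * ((D2 q N ν)⁻¹ * x) := by
        intro ν hν x hx
        have h1 : ((∏ j ∈ range (4 * N), (1 - q ^ (2 * j) / (-q ^ (4 * ν + 1)))) *
            ∏ j ∈ (range (2 * N)).erase ν, (1 - (-q ^ (4 * j + 1)) / (-q ^ (4 * ν + 1)))) =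
            (-1) ^ ν * D2 q N ν / q ^ (4 * tri ν + (2 * ν + 1) ^ 2) := by
          rw [← node2 q hq N ν hν, mul_div_cancel_left₀ _ (hQ _)]
        rw [h1, neg_pow, ← pow_mul]
        rw [pow_add] at hx
        have e5 : ∀ m : ℕ, ((-1 : K) ^ m)⁻¹ = (-1) ^ m := by
          intro m
          rw [← inv_pow]; norm_num
        have e8 : (-1 : K) ^ (3 * N) = (-1) ^ N := by
          rw [pow_mul]; norm_num
        have := hQ (3 * N)
        have := hQ ((4 * ν + 1) * (3 * N))
        have := hQ (4 * tri ν + (2 * ν + 1) ^ 2)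
        rw [mul_inv, mul_inv, inv_div, div_eq_mul_inv, div_eq_mul_inv, mul_inv, e5, e5, e8,
          pow_add (-1 : K)]
        generalize (-1 : K) ^ N = s
        generalize (-1 : K) ^ ν = s'
        generalize (D2 q N ν)⁻¹ = D
        generalize q ^ (4 * tri ν + (2 * ν + 1) ^ 2) = y at *
        field_simp
        linear_combination (s * s' * D * x) * hx
      refine Eq.trans ?_ (sub_eq_add_neg _ _).symm
      congr 1
      · rw [gen (N + n) (by omega)]
        · rw [← add_assoc, ← two_mul, pow_add, pow_mul (-1 : K), neg_one_sq, one_pow, one_mul]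
          congr 3
          have := hQ (4 * N)
          rw [show q ^ (4 * (N + n) + 1) = q ^ (4 * N) * q ^ (4 * n + 1) by ring]
          field_simp
          ring
        · rw [← pow_add, ← pow_add]
          congr 1
          have := two_tri (N + n)
          have := two_tri n
          nlinarith
      · obtain ⟨r, hr⟩ : ∃ r, N = r + 1 + n := ⟨N - 1 - n, by omega⟩
        have hr' : N - 1 - n = r := by omega
        rw [hr', gen r (by omega)]
        · have e6 : (-1 : K) ^ (N + r) = - (-1) ^ n := by
            rw [hr, show r + 1 + n + r = 2 * r + (n + 1) by ring, pow_add, pow_mul, neg_one_sq, one_pow, one_mul]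
            ring
          have e7 : (1 - (-q ^ (4 * r + 1)) * (w / q ^ (4 * N)))⁻¹ =
              (w⁻¹ * q ^ (4 * n + 3) * (1 + w⁻¹ * q ^ (4 * n + 3))⁻¹) := by
            have h3 : q ^ (4 * N) = q ^ (4 * r + 1) * q ^ (4 * n + 3) := by
              rw [← pow_add]; congr 1; omega
            have h4 : 1 - (-q ^ (4 * r + 1)) * (w / q ^ (4 * N)) =
              (w * (q ^ (4 * n + 3))⁻¹) * (1 + w⁻¹ * q ^ (4 * n + 3)) := by
              rw [h3]
              have := hQ (4 * r + 1)
              have := hQ (4 * n + 3)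
              field_simp
              ring
            rw [h4, mul_inv, mul_inv, inv_inv]
          rw [e6, e7]
          ring
        · rw [← pow_add, ← pow_add]
          congr 1
          have h1 := two_tri r
          have h2 := two_tri n
          subst hr
          nlinarith
  · intro a _ b _ h
    have := hinj _ _ h
    omega
  · intro a _ b _ h
    have := hinj _ _ (neg_injective h)
    omega
  · intro a _ b _ h
    have h2 : q ^ (4 * a) = q ^ (8 * b + 2) := by
      have := congrArg (fun x => x ^ 2) h
      simp only [neg_sq, ← pow_mul] at this
      rw [show 4 * a = 2 * a * 2 by ring, this]
      congr 1
      ring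
    have := hinj _ _ h2
    omega
  · intro a _
    exact hQ _
  · intro a _
    exact neg_ne_zero.mpr (hQ _)
  · intro a _ h
    have h1 : w * q ^ (2 * a) = q ^ (4 * N) := by
      have := hQ (4 * N)
      field_simp at h
      linear_combination -h
    have h2 : q ^ (8 * a) = q ^ (16 * N) := by
      have := congrArg (fun x => x ^ 4) h1
      simp only [mul_pow, hw4, one_mul, ← pow_mul] at this
      rw [show 8 * a = 2 * a * 4 by ring, this]
      congr 1
      ring
    have h3 := hinj _ _ h2
    rw [show 2 * a = 4 * N by omega] at h1
    exact hw1 (mul_right_cancel₀ (hQ _) (h1.trans (one_mul _).symm))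
  · intro a _ h
    have h1 : -w * q ^ (4 * a + 1) = q ^ (4 * N) := by
      have := hQ (4 * N)
      field_simp at h
      linear_combination -h
    have h2 : q ^ (16 * a + 4) = q ^ (16 * N) := by
      have := congrArg (fun x => x ^ 4) h1
      simp only [mul_pow, (show (-w) ^ 4 = 1 by rw [← hw4]; ring), one_mul, ← pow_mul] at this
      rw [show 16 * a + 4 = (4 * a + 1) * 4 by ring, this]
      congr 1
      ring
    have h3 := hinj _ _ h2
    omega

end fieldD

end RC
end

section
namespace RC

open Finset

section fieldJ

variable {K : Type*} [Field K]

/-- coefficient in the q-binomial theorem -/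
def qbc (z Q : K) : ℕ → K
  | 0 => 1
  | i + 1 => -z * Q ^ i * qbc z Q i

theorem poch_succ (c Q : K) (n : ℕ) : poch c Q (n + 1) = poch c Q n * (1 - c * Q ^ n) := by
  rw [poch, poch, prod_range_succ]

theorem poch_QQ_ne (Q : K) (hQ1 : ∀ n, 0 < n → Q ^ n ≠ 1) (n : ℕ) : poch Q Q n ≠ 0 := by
  rw [poch, prod_ne_zero_iff]
  intro j _ h
  rw [← pow_succ'] at h
  exact hQ1 (j + 1) (Nat.succ_pos _) (sub_eq_zero.mp h).symm

theorem qbinom (z Q : K) (hQ1 : ∀ n, 0 < n → Q ^ n ≠ 1) (M : ℕ) :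
    poch z Q M / poch Q Q M =
      ∑ p ∈ antidiagonal M, qbc z Q p.1 * (poch Q Q p.1)⁻¹ * (poch Q Q p.2)⁻¹ := by
  induction M with
  | zero => simp [poch, qbc]
  | succ M ih =>
    have h1 : (1 - Q ^ (M + 1)) ≠ 0 := fun h => hQ1 (M + 1) (Nat.succ_pos _) (sub_eq_zero.mp h).symm
    have hrec : ∀ j, (1 - Q ^ (j + 1)) * (poch Q Q (j + 1))⁻¹ = (poch Q Q j)⁻¹ := by
      intro j
      have h2 : (1 - Q ^ (j + 1)) ≠ 0 := fun h => hQ1 (j + 1) (Nat.succ_pos _) (sub_eq_zero.mp h).symm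
      rw [poch_succ, ← pow_succ', mul_inv, mul_comm, mul_assoc, inv_mul_cancel₀ h2, mul_one]
    have key : (1 - Q ^ (M + 1)) * ∑ p ∈ antidiagonal (M + 1),
        qbc z Q p.1 * (poch Q Q p.1)⁻¹ * (poch Q Q p.2)⁻¹ = (1 - z * Q ^ M) *
        ∑ p ∈ antidiagonal M, qbc z Q p.1 * (poch Q Q p.1)⁻¹ * (poch Q Q p.2)⁻¹ := by
      have e1 : (1 - Q ^ (M + 1)) * ∑ p ∈ antidiagonal (M + 1),
          qbc z Q p.1 * (poch Q Q p.1)⁻¹ * (poch Q Q p.2)⁻¹ =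
          ∑ p ∈ antidiagonal (M + 1), qbc z Q p.1 * (poch Q Q p.1)⁻¹ *
            ((1 - Q ^ p.2) * (poch Q Q p.2)⁻¹) +
          ∑ p ∈ antidiagonal (M + 1), qbc z Q p.1 * ((1 - Q ^ p.1) * (poch Q Q p.1)⁻¹) *
            (Q ^ p.2 * (poch Q Q p.2)⁻¹) := by
        rw [mul_sum, ← sum_add_distrib]
        apply sum_congr rfl
        intro p hp
        rw [← mem_antidiagonal.mp hp, pow_add]
        ring
      rw [e1, Finset.Nat.sum_antidiagonal_succ', Finset.Nat.sum_antidiagonal_succ]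
      simp only [pow_zero, sub_self, zero_mul, mul_zero, zero_add, add_zero, hrec]
      rw [sub_mul, one_mul, sub_eq_add_neg, ← neg_mul, mul_sum]
      congr 1
      apply sum_congr rfl
      intro p hp
      rw [← mem_antidiagonal.mp hp, pow_add, qbc]
      ring
    rw [poch_succ, poch_succ, ← pow_succ']
    rw [← ih] at key
    have := poch_QQ_ne Q hQ1 M
    rw [div_eq_iff (mul_ne_zero this h1)]
    generalize ∑ p ∈ antidiagonal (M + 1),
      qbc z Q p.1 * (poch Q Q p.1)⁻¹ * (poch Q Q p.2)⁻¹ = A at *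
    field_simp at key
    linear_combination -key

theorem qbc_eq (z Q : K) (i : ℕ) : qbc z Q i * Q ^ i = (-z) ^ i * Q ^ tri i := by
  induction i with
  | zero => simp [qbc, tri]
  | succ i ih =>
    rw [qbc, tri, pow_add Q (tri i), pow_succ (-z)]
    linear_combination (-z * Q ^ (i + 1)) * ih

theorem finite_jtp (z Q : K) (hz : z ≠ 0) (hQ : Q ≠ 0) (hQ1 : ∀ n, 0 < n → Q ^ n ≠ 1) (N : ℕ) :
    poch z Q N * poch (Q / z) Q N =
      poch Q Q (2 * N) * (∑ k ∈ range (N + 1), (-1) ^ k * (Q ^ tri k * (z ^ k)⁻¹) *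
        (poch Q Q (N - k) * poch Q Q (N + k))⁻¹ -
        ∑ k ∈ range N, (-1) ^ k * (Q ^ tri k * z ^ (k + 1)) *
        (poch Q Q (N - 1 - k) * poch Q Q (N + k + 1))⁻¹) := by
  have hQn : ∀ n, Q ^ n ≠ 0 := fun n => pow_ne_zero n hQ
  have hA := poch_shift z Q hz hQ N N
  have hB := qbinom (z / Q ^ N) Q hQ1 (2 * N)
  rw [Finset.Nat.sum_antidiagonal_eq_sum_range_succ_mk] at hB
  have eA : poch (z / Q ^ N) Q (2 * N) = ∏ j ∈ range (N + N), (1 - z * Q ^ j / Q ^ N) := by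
    rw [poch, two_mul]
    apply prod_congr rfl
    intro j _
    ring
  rw [← eA] at hA
  rw [div_eq_iff (poch_QQ_ne Q hQ1 _)] at hB
  rw [hB] at hA
  have hzN : (-z) ^ N ≠ 0 := pow_ne_zero _ (neg_ne_zero.mpr hz)
  have hgoal : poch z Q N * poch (Q / z) Q N = poch Q Q (2 * N) * (Q ^ tri N / (-z) ^ N *
      ∑ k ∈ range (2 * N + 1), qbc (z / Q ^ N) Q k * (poch Q Q k)⁻¹ * (poch Q Q (2 * N - k))⁻¹) := by
    simp only [Nat.succ_eq_add_one] at hA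
    generalize ∑ k ∈ range (2 * N + 1),
      qbc (z / Q ^ N) Q k * (poch Q Q k)⁻¹ * (poch Q Q (2 * N - k))⁻¹ = A at *
    field_simp
    linear_combination -hA
  rw [hgoal]
  congr 1
  have hqb : ∀ i, qbc (z / Q ^ N) Q i = (-z) ^ i * Q ^ tri i / (Q ^ (N * i) * Q ^ i) := by
    intro i
    rw [eq_div_iff (mul_ne_zero (hQn _) (hQn _))]
    have := qbc_eq (z / Q ^ N) Q i
    have e : (-(z / Q ^ N)) ^ i * Q ^ (N * i) = (-z) ^ i := by
      rw [pow_mul, ← mul_pow]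
      congr 1
      have := hQn N
      field_simp
    linear_combination (Q ^ (N * i)) * this + (Q ^ tri i) * e
  rw [show 2 * N + 1 = (N + 1) + N by ring, sum_range_add, mul_add, sub_eq_add_neg]
  congr 1
  · rw [← sum_range_reflect, mul_sum]
    apply sum_congr rfl
    intro k hk
    rw [mem_range] at hk
    obtain ⟨r, hr⟩ : ∃ r, N = r + k := ⟨N - k, by omega⟩
    rw [show N + 1 - 1 - k = r by omega, show N - k = r by omega, show 2 * N - r = N + k by omega,
      hqb, mul_inv]
    have e1 : Q ^ tri N * Q ^ tri r = Q ^ tri k * (Q ^ (N * r) * Q ^ r) := by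
      rw [← pow_add, ← pow_add, ← pow_add]
      congr 1
      have h1 := two_tri r
      have h2 := two_tri k
      have h3 := two_tri N
      subst hr
      nlinarith
    have e2 : (-z) ^ N = (-z) ^ r * (-z) ^ k := by rw [hr, pow_add]
    have e3 : (-z) ^ k = (-1) ^ k * z ^ k := neg_pow z k
    have hm : (-1 : K) ^ k * (-1) ^ k = 1 := by rw [← mul_pow]; simp
    have hm0 : (-1 : K) ^ k ≠ 0 := pow_ne_zero _ (neg_ne_zero.mpr one_ne_zero)
    have hzr : (-z) ^ r ≠ 0 := pow_ne_zero _ (neg_ne_zero.mpr hz)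
    have hzk : z ^ k ≠ 0 := pow_ne_zero _ hz
    rw [e2, e3]
    generalize (poch Q Q r)⁻¹ = A
    generalize (poch Q Q (N + k))⁻¹ = B
    have q1 := hQn (N * r)
    have q2 := hQn r
    generalize (-z) ^ r = c at *
    generalize z ^ k = d at *
    generalize (-1 : K) ^ k = s at *
    field_simp
    rw [← sq] at hm
    linear_combination A * B * e1 - (Q ^ tri k * A * B * (Q ^ (N * r) * Q ^ r)) * hm
  · rw [mul_sum, ← sum_neg_distrib]
    apply sum_congr rfl
    intro k hk
    rw [mem_range] at hk
    rw [show N + 1 + k = N + k + 1 by ring, show 2 * N - (N + k + 1) = N - 1 - k by omega, hqb,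
      mul_inv]
    have e1 : Q ^ tri N * Q ^ tri (N + k + 1) =
        Q ^ tri k * (Q ^ (N * (N + k + 1)) * Q ^ (N + k + 1)) := by
      rw [← pow_add, ← pow_add, ← pow_add]
      congr 1
      have h1 := two_tri (N + k + 1)
      have h2 := two_tri k
      have h3 := two_tri N
      nlinarith
    have e2 : (-z) ^ (N + k + 1) = (-z) ^ N * (-((-1) ^ k * z ^ (k + 1))) := by
      rw [add_assoc, pow_add, neg_pow z (k + 1), pow_succ (-1 : K)]
      ring
    rw [e2]
    generalize (poch Q Q (N - 1 - k))⁻¹ = A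
    generalize (poch Q Q (N + k + 1))⁻¹ = B
    have q1 := hQn (N * (N + k + 1))
    have q2 := hQn (N + k + 1)
    generalize (-z) ^ N = c at *
    generalize z ^ (k + 1) = d at *
    generalize (-1 : K) ^ k = s at *
    generalize Q ^ (N * (N + k + 1)) = f at *
    generalize Q ^ (N + k + 1) = g at *
    field_simp
    linear_combination (-A * B * s * d) * e1

end fieldJ

end RC
end

section
namespace RC

open PowerSeries Finset

/-- the embedding in the fraction field -/
noncomputable abbrev ι : S →+* FractionRing S := algebraMap S (FractionRing S)

theorem ι_inj : Function.Injective ι := IsFractionRing.injective S (FractionRing S)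

theorem ι_X_ne : ι X ≠ 0 := by
  intro h
  have : (X : S) = 0 := ι_inj (by rw [h, map_zero])
  exact X_ne_zero this

theorem ι_X_pow (n : ℕ) (hn : 0 < n) : (ι X) ^ n ≠ 1 := by
  intro h
  have h1 : (X : S) ^ n = 1 := ι_inj (by rw [map_pow, h, map_one])
  have h2 := congrArg constantCoeff h1
  rw [map_pow, constantCoeff_X, zero_pow (by omega), map_one] at h2
  exact zero_ne_one h2

theorem ι_inv (a : S) (ha : constantCoeff a ≠ 0) : ι a⁻¹ = (ι a)⁻¹ := by
  apply eq_inv_of_mul_eq_one_left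
  rw [← map_mul, PowerSeries.inv_mul_cancel a ha, map_one]

theorem poch_ι (c : ℂ) (e s n : ℕ) (a Q : FractionRing S) (ha : a = ι (C c * X ^ e))
    (hQ : Q = (ι X) ^ s) : poch a Q n = ι (Pn c e s n) := by
  subst ha hQ
  rw [poch, Pn, map_prod]
  apply prod_congr rfl
  intro j _
  rw [map_sub, map_one, pow_add, ← mul_assoc, map_mul, map_pow ι, ← pow_mul]
  simp only [map_mul, map_pow]

/-- power series version of `E1` -/
noncomputable def E1S (N κ : ℕ) : S :=
  if κ % 2 = 0 then Pn (-1) 1 4 (2 * N - κ / 2) * Pn (-1) 3 4 (κ / 2)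
  else Pn (-1) 3 4 (2 * N - (κ + 1) / 2) * Pn (-1) 1 4 ((κ + 1) / 2)

/-- power series version of `D1` -/
noncomputable def D1S (N κ : ℕ) : S :=
  Pn 1 2 2 κ * Pn 1 2 2 (4 * N - 1 - κ) * E1S N κ

/-- power series version of `D2` -/
noncomputable def D2S (N ν : ℕ) : S :=
  Pn 1 4 4 ν * Pn 1 4 4 (2 * N - 1 - ν) *
    (Pn (-1) 1 2 (2 * ν + 1) * Pn (-1) 1 2 (4 * N - 2 * ν - 1))

/-- power series version of `TN` -/
noncomputable def TNS (w : ℂ) (N : ℕ) : S :=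
  Pn w 0 2 (2 * N) * Pn w⁻¹ 2 2 (2 * N) * (Pn (-w) 1 4 N * Pn (-w⁻¹) 3 4 N)

theorem E1_ι (N κ : ℕ) : E1 (ι X) N κ = ι (E1S N κ) := by
  have h1 := fun n => poch_ι (-1) 1 4 n (-ι X) (ι X ^ 4) (by simp) rfl
  have h3 := fun n => poch_ι (-1) 3 4 n (-ι X ^ 3) (ι X ^ 4) (by simp) rfl
  rw [E1, E1S]
  split_ifs <;> simp only [map_mul, h1, h3]

theorem D1_ι (N κ : ℕ) : D1 (ι X) N κ = ι (D1S N κ) := by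
  have h1 := fun n => poch_ι 1 2 2 n (ι X ^ 2) (ι X ^ 2) (by simp) rfl
  rw [D1, D1S, E1_ι]
  simp only [map_mul, h1]

theorem D2_ι (N κ : ℕ) : D2 (ι X) N κ = ι (D2S N κ) := by
  have h1 := fun n => poch_ι 1 4 4 n (ι X ^ 4) (ι X ^ 4) (by simp) rfl
  have h2 := fun n => poch_ι (-1) 1 2 n (-ι X) (ι X ^ 2) (by simp) rfl
  rw [D2, D2S]
  simp only [map_mul, h1, h2]

theorem ι_C_inv (w : ℂ) : ι (C w⁻¹) = (ι (C w))⁻¹ := by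
  by_cases h : w = 0
  · simp [h]
  · apply eq_inv_of_mul_eq_one_left
    rw [← map_mul, ← map_mul, inv_mul_cancel₀ h, map_one, map_one]

theorem TN_ι (w : ℂ) (N : ℕ) : TN (ι X) (ι (C w)) N = ι (TNS w N) := by
  have h1 := fun n => poch_ι w 0 2 n (ι (C w)) (ι X ^ 2) (by simp) rfl
  have h2 := fun n => poch_ι w⁻¹ 2 2 n (ι X ^ 2 / ι (C w)) (ι X ^ 2)
    (by rw [map_mul, ι_C_inv, map_pow]; ring) rfl
  have h3 := fun n => poch_ι (-w) 1 4 n (-ι X * ι (C w)) (ι X ^ 4) (by simp; ring) rfl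
  have h4 := fun n => poch_ι (-w⁻¹) 3 4 n (-ι X ^ 3 / ι (C w)) (ι X ^ 4)
    (by rw [map_neg, map_mul, map_neg, ι_C_inv, map_pow]; ring) rfl
  rw [TN, TNS]
  simp only [map_mul, h1, h2, h3, h4]

theorem const_E1S (N κ : ℕ) : constantCoeff (E1S N κ) = 1 := by
  rw [E1S]
  split_ifs <;> simp [const_Pn]

theorem const_D1S (N κ : ℕ) : constantCoeff (D1S N κ) ≠ 0 := by
  rw [D1S]
  simp [const_Pn, const_E1S]

theorem const_D2S (N κ : ℕ) : constantCoeff (D2S N κ) ≠ 0 := by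
  rw [D2S]
  simp [const_Pn]

theorem const_one_sub (w : ℂ) (e : ℕ) (he : 0 < e) : constantCoeff (1 - C w * X ^ e : S) ≠ 0 := by
  rw [map_sub, map_mul, map_pow, constantCoeff_X, zero_pow (by omega)]
  simp

theorem const_one_add (w : ℂ) (e : ℕ) (he : 0 < e) : constantCoeff (1 + C w * X ^ e : S) ≠ 0 := by
  rw [map_add, map_mul, map_pow, constantCoeff_X, zero_pow (by omega)]
  simp

theorem const_one_sub_w (w : ℂ) (hw : w ≠ 1) (e : ℕ) :
    constantCoeff (1 - C w * X ^ e : S) ≠ 0 := by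
  rcases Nat.eq_zero_or_pos e with rfl | h
  · simp
    exact fun h => hw (sub_eq_zero.mp h).symm
  · exact const_one_sub w e h

theorem const_Pn_w (w : ℂ) (hw : w ≠ 1) (N : ℕ) : constantCoeff (Pn w 0 2 N) ≠ 0 := by
  rw [Pn, map_prod, prod_ne_zero_iff]
  intro k _
  exact const_one_sub_w w hw _

theorem const_TNS (w : ℂ) (hw : w ≠ 1) (N : ℕ) : constantCoeff (TNS w N) ≠ 0 := by
  rw [TNS]
  simp [const_Pn, const_Pn_w w hw]

/-- first part of `S1` -/
noncomputable def S1a (w : ℂ) (k : ℕ) : S :=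
  (1 - C w * X ^ (2 * k))⁻¹ * ((-1) ^ k * X ^ (3 * tri k))

/-- second part of `S1` -/
noncomputable def S1b (w : ℂ) (k : ℕ) : S :=
  (C w⁻¹ * X ^ (2 * k + 2) * (1 - C w⁻¹ * X ^ (2 * k + 2))⁻¹) * ((-1) ^ k * X ^ (3 * tri k))

/-- first part of `S2` -/
noncomputable def S2a (w : ℂ) (n : ℕ) : S :=
  (1 + C w * X ^ (4 * n + 1))⁻¹ * ((-1) ^ n * X ^ (12 * tri n))

/-- second part of `S2` -/
noncomputable def S2b (w : ℂ) (n : ℕ) : S :=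
  (C w⁻¹ * X ^ (4 * n + 3) * (1 + C w⁻¹ * X ^ (4 * n + 3))⁻¹) * ((-1) ^ n * X ^ (12 * tri n))

theorem finite_D_S (w : ℂ) (hw4 : w ^ 4 = 1) (hw : w ≠ 1) (N : ℕ) (hN : 0 < N) :
    (TNS w N)⁻¹ =
      (∑ k ∈ range (2 * N), (D1S N (2 * N + k))⁻¹ * S1a w k +
       ∑ k ∈ range (2 * N), (D1S N (2 * N - 1 - k))⁻¹ * S1b w k) +
      X * (∑ n ∈ range N, (D2S N (N + n))⁻¹ * S2a w n -
       ∑ n ∈ range N, (D2S N (N - 1 - n))⁻¹ * S2b w n) := by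
  have H := finite_D (ι X) (ι (C w)) ι_X_ne ι_X_pow
    (by rw [← map_pow, ← map_pow, hw4, map_one, map_one])
    (by
      intro h
      have h1 : (C w : S) = 1 := ι_inj (by rw [h, map_one])
      have h2 := congrArg constantCoeff h1
      simp at h2
      exact hw h2) N hN
  apply ι_inj
  rw [ι_inv _ (const_TNS w hw N), ← TN_ι, H, ← sum_add_distrib, ← sum_sub_distrib, map_add,
    map_mul, map_sum, map_sum, mul_sum]
  congr 1
  · apply sum_congr rfl
    intro k _
    rw [S1a, S1b, D1_ι, D1_ι]
    simp only [map_add, map_mul, ι_inv _ (const_D1S _ _), ι_inv _ (const_one_sub_w w hw _),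
      ι_inv _ (const_one_sub w⁻¹ (2 * k + 2) (by omega)), ι_C_inv, map_sub, map_one, map_pow, map_neg]
    ring
  · apply sum_congr rfl
    intro k _
    rw [S2a, S2b, D2_ι, D2_ι]
    simp only [map_add, map_mul, ι_inv _ (const_D2S _ _),
      ι_inv _ (const_one_add w (4 * k + 1) (by omega)),
      ι_inv _ (const_one_add w⁻¹ (4 * k + 3) (by omega)), ι_C_inv, map_sub, map_one, map_pow, map_neg]
    ring

theorem le_tri (k : ℕ) : k ≤ tri k := by
  have := two_tri k
  nlinarith

theorem sm_S1a (w : ℂ) : Sm (S1a w) := fun k =>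
  (((pow_dvd_pow X (by have := le_tri k; omega)).mul_left _).mul_left _)

theorem sm_S1b (w : ℂ) : Sm (S1b w) := fun k =>
  (((pow_dvd_pow X (by have := le_tri k; omega)).mul_left _).mul_left _)

theorem sm_S2a (w : ℂ) : Sm (S2a w) := fun k =>
  (((pow_dvd_pow X (by have := le_tri k; omega)).mul_left _).mul_left _)

theorem sm_S2b (w : ℂ) : Sm (S2b w) := fun k =>
  (((pow_dvd_pow X (by have := le_tri k; omega)).mul_left _).mul_left _)

theorem E1S_conv_add (k : ℕ) :
    Conv (fun N => E1S N (2 * N + k)) (Pinf (-1) 1 2) := by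
  have P1 := Pn_conv (-1) 1 4 (by norm_num)
  have P3 := Pn_conv (-1) 3 4 (by norm_num)
  rw [Pinf_split (-1) 1 2 (by norm_num)]
  by_cases h : k % 2 = 0
  · have := (P1.comp (f := fun N => 2 * N - (2 * N + k) / 2)
      (fun M => ⟨M + k, fun N hN => by omega⟩)).mul (P3.comp (f := fun N => (2 * N + k) / 2)
      (fun M => ⟨M + k, fun N hN => by omega⟩))
    refine this.congr 0 fun N _ => ?_
    rw [E1S, if_pos (by omega)]
  · have := (P1.comp (f := fun N => (2 * N + k + 1) / 2)
      (fun M => ⟨M + k, fun N hN => by omega⟩)).mul (P3.comp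
      (f := fun N => 2 * N - (2 * N + k + 1) / 2)
      (fun M => ⟨M + k + 1, fun N hN => by omega⟩))
    refine this.congr 0 fun N _ => ?_
    rw [E1S, if_neg (by omega), mul_comm]

theorem E1S_conv_sub (k : ℕ) :
    Conv (fun N => E1S N (2 * N - 1 - k)) (Pinf (-1) 1 2) := by
  have P1 := Pn_conv (-1) 1 4 (by norm_num)
  have P3 := Pn_conv (-1) 3 4 (by norm_num)
  rw [Pinf_split (-1) 1 2 (by norm_num)]
  by_cases h : k % 2 = 1
  · have := (P1.comp (f := fun N => 2 * N - (2 * N - 1 - k) / 2)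
      (fun M => ⟨M + k, fun N hN => by omega⟩)).mul (P3.comp (f := fun N => (2 * N - 1 - k) / 2)
      (fun M => ⟨M + k + 1, fun N hN => by omega⟩))
    refine this.congr (k + 1) fun N _ => ?_
    rw [E1S, if_pos (by omega)]
  · have := (P1.comp (f := fun N => (2 * N - 1 - k + 1) / 2)
      (fun M => ⟨M + k + 1, fun N hN => by omega⟩)).mul (P3.comp
      (f := fun N => 2 * N - (2 * N - 1 - k + 1) / 2)
      (fun M => ⟨M + k + 1, fun N hN => by omega⟩))
    refine this.congr (k + 1) fun N _ => ?_
    rw [E1S, if_neg (by omega), mul_comm]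

/-- limit of the theta products -/
noncomputable def T (w : ℂ) : S :=
  Pinf w 0 2 * Pinf w⁻¹ 2 2 * (Pinf (-w) 1 4 * Pinf (-w⁻¹) 3 4)

/-- the universal series `S1` -/
noncomputable def S1 (w : ℂ) : S := psum (S1a w) + psum (S1b w)

/-- the universal series `S2` -/
noncomputable def S2 (w : ℂ) : S := psum (S2a w) - psum (S2b w)

theorem const_T (w : ℂ) (hw : w ≠ 1) : constantCoeff (T w) ≠ 0 := by
  rw [T, Pinf_step w 0 2 (by norm_num)]
  simp only [map_mul, const_Pinf, Nat.zero_add, Nat.ofNat_pos, Nat.one_pos, mul_one]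
  exact const_one_sub_w w hw 0

theorem ident_D (w : ℂ) (hw4 : w ^ 4 = 1) (hw : w ≠ 1) :
    (T w)⁻¹ = (Pinf 1 2 2 * Pinf 1 2 2 * Pinf (-1) 1 2)⁻¹ * S1 w +
      X * ((Pinf 1 4 4 * Pinf 1 4 4 * (Pinf (-1) 1 2 * Pinf (-1) 1 2))⁻¹ * S2 w) := by
  have c2 := Pn_conv 1 2 2 (by norm_num)
  have c4 := Pn_conv 1 4 4 (by norm_num)
  have ce := Pn_conv (-1) 1 2 (by norm_num)
  have k2 := const_Pinf 1 2 2 (by norm_num) (by norm_num)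
  have k4 := const_Pinf 1 4 4 (by norm_num) (by norm_num)
  have ke := const_Pinf (-1) 1 2 (by norm_num) (by norm_num)
  have hT : Conv (TNS w) (T w) :=
    (((Pn_conv w 0 2 (by norm_num)).comp (f := fun N => 2 * N) (fun M => ⟨M, fun N h => by omega⟩)).mul
      ((Pn_conv w⁻¹ 2 2 (by norm_num)).comp (f := fun N => 2 * N)
        (fun M => ⟨M, fun N h => by omega⟩))).mul
      ((Pn_conv (-w) 1 4 (by norm_num)).mul (Pn_conv (-w⁻¹) 3 4 (by norm_num)))
  refine (hT.inv (const_TNS w hw) (const_T w hw)).unique ?_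
  have q1 : ∀ k, Conv (fun N => (D1S N (2 * N + k))⁻¹)
      (Pinf 1 2 2 * Pinf 1 2 2 * Pinf (-1) 1 2)⁻¹ := fun k =>
    Conv.inv (((c2.comp (f := fun N => 2 * N + k) (fun M => ⟨M, fun N h => by omega⟩)).mul
      (c2.comp (f := fun N => 4 * N - 1 - (2 * N + k))
        (fun M => ⟨M + k + 1, fun N h => by omega⟩))).mul
      (E1S_conv_add k)) (fun N => const_D1S N _) (by simp [k2, ke])
  have q2 : ∀ k, Conv (fun N => (D1S N (2 * N - 1 - k))⁻¹)
      (Pinf 1 2 2 * Pinf 1 2 2 * Pinf (-1) 1 2)⁻¹ := fun k =>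
    Conv.inv (((c2.comp (f := fun N => 2 * N - 1 - k)
        (fun M => ⟨M + k + 1, fun N h => by omega⟩)).mul
      (c2.comp (f := fun N => 4 * N - 1 - (2 * N - 1 - k))
        (fun M => ⟨M + k + 1, fun N h => by omega⟩))).mul
      (E1S_conv_sub k)) (fun N => const_D1S N _) (by simp [k2, ke])
  have q3 : ∀ k, Conv (fun N => (D2S N (N + k))⁻¹)
      (Pinf 1 4 4 * Pinf 1 4 4 * (Pinf (-1) 1 2 * Pinf (-1) 1 2))⁻¹ := fun k =>
    Conv.inv (((c4.comp (f := fun N => N + k) (fun M => ⟨M, fun N h => by omega⟩)).mul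
      (c4.comp (f := fun N => 2 * N - 1 - (N + k))
        (fun M => ⟨M + k + 1, fun N h => by omega⟩))).mul
      ((ce.comp (f := fun N => 2 * (N + k) + 1) (fun M => ⟨M, fun N h => by omega⟩)).mul
       (ce.comp (f := fun N => 4 * N - 2 * (N + k) - 1)
        (fun M => ⟨M + k + 1, fun N h => by omega⟩))))
      (fun N => const_D2S N _) (by simp [k4, ke])
  have q4 : ∀ k, Conv (fun N => (D2S N (N - 1 - k))⁻¹)
      (Pinf 1 4 4 * Pinf 1 4 4 * (Pinf (-1) 1 2 * Pinf (-1) 1 2))⁻¹ := fun k =>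
    Conv.inv (((c4.comp (f := fun N => N - 1 - k)
        (fun M => ⟨M + k + 1, fun N h => by omega⟩)).mul
      (c4.comp (f := fun N => 2 * N - 1 - (N - 1 - k))
        (fun M => ⟨M + k + 1, fun N h => by omega⟩))).mul
      ((ce.comp (f := fun N => 2 * (N - 1 - k) + 1)
        (fun M => ⟨M + k + 1, fun N h => by omega⟩)).mul
       (ce.comp (f := fun N => 4 * N - 2 * (N - 1 - k) - 1)
        (fun M => ⟨M + k + 1, fun N h => by omega⟩))))
      (fun N => const_D2S N _) (by simp [k4, ke])
  have r2 : ∀ M : ℕ, ∃ N0 : ℕ, ∀ N : ℕ, N0 ≤ N → M ≤ 2 * N := fun M => ⟨M, fun N h => by omega⟩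
  have r1 : ∀ M : ℕ, ∃ N0 : ℕ, ∀ N : ℕ, N0 ≤ N → M ≤ N := fun M => ⟨M, fun N h => by omega⟩
  have lim1 := ((tannery (sm_S1a w) q1 r2).add (tannery (sm_S1b w) q2 r2)).add
    ((Conv.const X).mul ((tannery (sm_S2a w) q3 (f := fun N => N) r1).sub
      (tannery (sm_S2b w) q4 (f := fun N => N) r1)))
  rw [← mul_add, ← mul_sub] at lim1
  exact lim1.congr 1 fun N hN => (finite_D_S w hw4 hw N hN).symm

/-- Jacobi triple product -/
theorem jtp (u : ℂ) (hu : u ≠ 0) (e s : ℕ) (hs : 0 < s) (hes : e ≤ s)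
    (hk : ∀ k, k + e * k ≤ s * tri k) :
    Pinf 1 s s * (Pinf u e s * Pinf u⁻¹ (s - e) s) =
      psum (fun k => (-1) ^ k * (C (u⁻¹ ^ k) * X ^ (s * tri k - e * k))) -
      psum (fun k => (-1) ^ k * (C (u ^ (k + 1)) * X ^ (s * tri k + e * (k + 1)))) := by
  have cs := Pn_conv 1 s s hs
  have ks := const_Pinf 1 s s hs hs
  have hne := const_Pinf_ne 1 s s hs hs
  have sm1 : Sm (fun k => (-1) ^ k * (C (u⁻¹ ^ k) * X ^ (s * tri k - e * k)) : ℕ → S) := fun k =>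
    (((pow_dvd_pow X (by have := hk k; omega)).mul_left _).mul_left _)
  have sm2 : Sm (fun k => (-1) ^ k * (C (u ^ (k + 1)) * X ^ (s * tri k + e * (k + 1))) : ℕ → S) :=
    fun k => (((pow_dvd_pow X (by have := hk k; omega)).mul_left _).mul_left _)
  have q1 : ∀ k, Conv (fun N => (Pn 1 s s (N - k) * Pn 1 s s (N + k))⁻¹)
      (Pinf 1 s s * Pinf 1 s s)⁻¹ := fun k =>
    Conv.inv ((cs.comp (f := fun N => N - k) (fun M => ⟨M + k, fun N h => by omega⟩)).mul
      (cs.comp (f := fun N => N + k) (fun M => ⟨M, fun N h => by omega⟩)))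
      (fun N => by simp [const_Pn, hs]) (by simp [ks])
  have q2 : ∀ k, Conv (fun N => (Pn 1 s s (N - 1 - k) * Pn 1 s s (N + k + 1))⁻¹)
      (Pinf 1 s s * Pinf 1 s s)⁻¹ := fun k =>
    Conv.inv ((cs.comp (f := fun N => N - 1 - k) (fun M => ⟨M + k + 1, fun N h => by omega⟩)).mul
      (cs.comp (f := fun N => N + k + 1) (fun M => ⟨M, fun N h => by omega⟩)))
      (fun N => by simp [const_Pn, hs]) (by simp [ks])
  have r1 : ∀ M : ℕ, ∃ N0 : ℕ, ∀ N : ℕ, N0 ≤ N → M ≤ N + 1 := fun M => ⟨M, fun N h => by omega⟩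
  have r0 : ∀ M : ℕ, ∃ N0 : ℕ, ∀ N : ℕ, N0 ≤ N → M ≤ N := fun M => ⟨M, fun N h => by omega⟩
  have lim1 := ((cs.comp (f := fun N => 2 * N) (fun M => ⟨M, fun N h => by omega⟩))).mul
    ((tannery sm1 q1 r1).sub (tannery sm2 q2 (f := fun N => N) r0))
  have lim2 := (Pn_conv u e s hs).mul (Pn_conv u⁻¹ (s - e) s hs)
  have key := lim2.unique (lim1.congr 0 fun N _ => ?_)
  · rw [key, ← mul_sub]
    have := PowerSeries.mul_inv_cancel (Pinf 1 s s * Pinf 1 s s) (by simp [ks])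
    linear_combination (psum (fun k => (-1) ^ k * (C (u⁻¹ ^ k) * X ^ (s * tri k - e * k))) -
      psum (fun k => (-1) ^ k * (C (u ^ (k + 1)) * X ^ (s * tri k + e * (k + 1))))) * this
  · have hQ1 : ∀ n, 0 < n → (ι X ^ s) ^ n ≠ 1 := by
      intro n hn
      rw [← pow_mul]
      exact ι_X_pow _ (Nat.mul_pos hs hn)
    have hz : ι (C u * X ^ e) ≠ 0 := by
      intro h
      have h1 : (C u * X ^ e : S) = 0 := ι_inj (by rw [h, map_zero])
      rcases mul_eq_zero.mp h1 with h2 | h2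
      · exact hu (by simpa using congrArg constantCoeff h2)
      · exact pow_ne_zero _ X_ne_zero h2
    have H := finite_jtp (ι (C u * X ^ e)) (ι X ^ s) hz (pow_ne_zero _ ι_X_ne) hQ1 N
    have h1 := fun n => poch_ι 1 s s n (ι X ^ s) (ι X ^ s) (by simp) rfl
    have h2 := fun n => poch_ι u e s n _ (ι X ^ s) rfl rfl
    have hX := pow_ne_zero e ι_X_ne
    have hCu : ι (C u) ≠ 0 := by
      intro h
      rw [map_mul, h, zero_mul] at hz
      exact hz rfl
    have h3 := fun n => poch_ι u⁻¹ (s - e) s n (ι X ^ s / ι (C u * X ^ e)) (ι X ^ s)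
      (by
        rw [map_mul, map_mul, ι_C_inv, map_pow, map_pow]
        obtain ⟨d, rfl⟩ := Nat.exists_eq_add_of_le hes
        rw [Nat.add_sub_cancel_left, pow_add]
        field_simp) rfl
    rw [h3] at H
    simp only [h1, h2] at H
    apply ι_inj
    rw [map_mul (f := ι) (x := Pn u e s N), H]
    rw [map_mul, map_sub, map_sum, map_sum]
    congr 2
    · apply sum_congr rfl
      intro k _
      rw [map_mul, ι_inv _ (by simp [const_Pn, hs]), map_mul ι (Pn 1 s s (N - k)), mul_comm]
      congr 1
      simp only [map_mul, map_pow, map_neg, map_one, ι_C_inv]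
      congr 1
      obtain ⟨d, hd⟩ := Nat.exists_eq_add_of_le (show e * k ≤ s * tri k by have := hk k; omega)
      rw [← pow_mul, hd, Nat.add_sub_cancel_left, pow_add, mul_pow, ← pow_mul, inv_pow]
      have := pow_ne_zero (e * k) ι_X_ne
      field_simp
    · apply sum_congr rfl
      intro k _
      rw [map_mul, ι_inv _ (by simp [const_Pn, hs]), map_mul ι (Pn 1 s s (N - 1 - k)), mul_comm]
      congr 1
      simp only [map_mul, map_pow, map_neg, map_one]
      congr 1
      rw [pow_add, ← pow_mul, mul_pow, ← pow_mul]
      ring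

end RC
end

section
namespace RC
open PowerSeries Finset

/-! ### generating functions of partitions as infinite products -/

open scoped PowerSeries.WithPiTopology in
theorem Conv.tendsto {a : ℕ → S} {A : S} (h : Conv a A) :
    Filter.Tendsto a Filter.atTop (nhds A) := by
  rw [PowerSeries.WithPiTopology.tendsto_iff_coeff_tendsto]
  intro d
  obtain ⟨N0, h0⟩ := h.coeff d
  exact tendsto_atTop_of_eventually_const (i₀ := N0) fun N hN => h0 N hN

theorem sm_term (h : ℕ → ℂ) (i : ℕ) :
    Sm (fun j => C (h (j + 1)) * (X : S) ^ ((i + 1) * (j + 1))) := fun j =>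
  (pow_dvd_pow X (by nlinarith)).mul_left _

open scoped PowerSeries.WithPiTopology in
theorem genFun_conv (f : ℕ → ℕ → ℂ) :
    Conv (fun N => ∏ i ∈ range N,
      (1 + psum (fun j => C (f (i + 1) (j + 1)) * (X : S) ^ ((i + 1) * (j + 1)))))
      (Nat.Partition.genFun f) := by
  have e1 : ∀ i : ℕ, ∑' j, f (i + 1) (j + 1) • (X : S) ^ ((i + 1) * (j + 1)) =
      psum (fun j => C (f (i + 1) (j + 1)) * (X : S) ^ ((i + 1) * (j + 1))) := by
    intro i
    have h1 := (Nat.Partition.summable_genFun_term f i).hasSum.tendsto_sum_nat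
    have h2 := (psum_conv (sm_term (f (i + 1)) i)).tendsto
    refine tendsto_nhds_unique h1 ?_
    simpa only [PowerSeries.smul_eq_C_mul] using h2
  have h1 := (Nat.Partition.hasProd_genFun f).tendsto_prod_nat
  simp only [e1] at h1
  have h2 : Conv (fun N => ∏ i ∈ range N,
      (1 + psum (fun j => C (f (i + 1) (j + 1)) * (X : S) ^ ((i + 1) * (j + 1))))) _ := lim_conv (by
    intro N
    rw [prod_range_succ, mul_add, mul_one, add_sub_cancel_left]
    apply Dvd.dvd.mul_left
    have := psum_dvd (sm_term (f (N + 1)) N) N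
    rw [dvd_sub_right] at this
    · exact this
    · apply dvd_sum
      intro j _
      exact (pow_dvd_pow X (by nlinarith)).mul_left _)
  rw [tendsto_nhds_unique h1 h2.tendsto]
  exact h2

theorem geom_term (u : ℂ) (i : ℕ) :
    1 + psum (fun j => C (u ^ (j + 1)) * (X : S) ^ ((i + 1) * (j + 1))) =
      (1 - C u * X ^ (i + 1))⁻¹ := by
  have hs : Sm (fun j => C (u ^ j) * (X : S) ^ ((i + 1) * j)) := fun j =>
    (pow_dvd_pow X (by nlinarith)).mul_left _
  have h1 := psum_shift hs 1
  have h2 := psum_mul_left hs (C u * X ^ (i + 1))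
  have h3 : (fun j => C u * X ^ (i + 1) * (C (u ^ j) * (X : S) ^ ((i + 1) * j))) =
      (fun j => C (u ^ (j + 1)) * (X : S) ^ ((i + 1) * (j + 1))) := by
    funext j
    simp only [map_pow]
    ring
  rw [h3] at h2
  simp only [range_one, sum_singleton, pow_zero, mul_zero, map_one, mul_one] at h1
  rw [← h1, PowerSeries.eq_inv_iff_mul_eq_one (by simp)]
  linear_combination h1 + h2

theorem genFun_gen (h : ℕ → ℂ) (u : ℕ → ℂ) {A : S}
    (hA : Conv (fun N => ∏ i ∈ range N, (1 - C (u (i + 2)) * (X : S) ^ (i + 2))⁻¹) A) :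
    Nat.Partition.genFun (fun i c => if i = 1 then h c else u i ^ c) =
      (1 + psum (fun j => C (h (j + 1)) * (X : S) ^ (j + 1))) * A := by
  have h1 := (genFun_conv (fun i c => if i = 1 then h c else u i ^ c)).comp
    (f := fun N => N + 1) (fun M => ⟨M, fun N h => by omega⟩)
  refine h1.unique (((Conv.const _).mul hA).congr 0 fun N _ => ?_)
  rw [prod_range_succ']
  simp only [zero_add, if_true, one_mul]
  rw [mul_comm]
  congr 1
  apply prod_congr rfl
  intro i _
  have : ¬ (i + 1 + 1 = 1) := by omega
  simp only [this, if_false]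
  rw [← geom_term]

theorem prod_inv (g : ℕ → S) (N : ℕ) : ∏ i ∈ range N, (g i)⁻¹ = (∏ i ∈ range N, g i)⁻¹ := by
  induction N with
  | zero => simp
  | succ n ih => rw [prod_range_succ, prod_range_succ, ih, PowerSeries.mul_inv_rev, mul_comm]

/-- partition generating function -/
noncomputable def P : S := PowerSeries.mk fun n => (Fintype.card (n.Partition) : ℂ)

theorem P_eq : P = (Pinf 1 1 1)⁻¹ := by
  have hA : Conv (fun N => ∏ i ∈ range N, (1 - C 1 * (X : S) ^ (i + 2))⁻¹) (Pinf 1 2 1)⁻¹ := by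
    have := (Pn_conv 1 2 1 one_pos).inv (fun N => by rw [const_Pn _ _ _ _ (by omega)]; simp)
      (const_Pinf_ne _ _ _ (by omega) (by omega))
    refine this.congr 0 fun N _ => ?_
    rw [prod_inv, Pn]
    simp [add_comm]
  have := genFun_gen (fun _ => 1) (fun _ => 1) hA
  have h2 := geom_term 1 0
  simp only [one_pow, zero_add, one_mul, pow_one] at h2
  rw [h2] at this
  rw [Pinf_step _ _ _ one_pos, PowerSeries.mul_inv_rev, pow_one, mul_comm]
  refine Eq.trans ?_ this
  ext n
  simp [P, Nat.Partition.coeff_genFun, Finsupp.prod]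

/-- Cauchy's q-binomial theorem -/
theorem cauchy (α β : ℂ) (e f : ℕ) (hf : 0 < f) :
    psum (fun j => Pn α e 1 j * (Pn 1 1 1 j)⁻¹ * (C β * X ^ f) ^ j) =
      Pinf (α * β) (e + f) 1 * (Pinf β f 1)⁻¹ := by
  set F : ℕ → S := fun f => psum (fun j => Pn α e 1 j * (Pn 1 1 1 j)⁻¹ * (C β * X ^ f) ^ j) with hF
  have sm : ∀ f, 0 < f → Sm (fun j => Pn α e 1 j * (Pn 1 1 1 j)⁻¹ * (C β * X ^ f) ^ j) := by
    intro f hf j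
    apply Dvd.dvd.mul_left
    rw [mul_pow, ← pow_mul]
    exact (pow_dvd_pow X (by nlinarith)).mul_left _
  have step : ∀ f, 0 < f → (1 - C β * X ^ f) * F f = (1 - C (α * β) * X ^ (e + f)) * F (f + 1) := by
    intro f hf
    have h1 := psum_sub (sm f hf) (sm (f + 1) (by omega))
    rw [psum_shift ((sm f hf).sub (sm (f + 1) (by omega))) 1] at h1
    have h2 := psum_mul_left (((sm f hf)).sub ((sm (f + 1) (by omega)).mul_left (fun _ => C α * X ^ e)))
      (C β * X ^ f)
    rw [psum_sub (sm f hf) ((sm (f + 1) (by omega)).mul_left (fun _ => C α * X ^ e)),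
      psum_mul_left (sm (f + 1) (by omega))] at h2
    have h3 : (fun j => Pn α e 1 (j + 1) * (Pn 1 1 1 (j + 1))⁻¹ * (C β * X ^ f) ^ (j + 1) -
        Pn α e 1 (j + 1) * (Pn 1 1 1 (j + 1))⁻¹ * (C β * X ^ (f + 1)) ^ (j + 1)) =
        fun j => C β * X ^ f * (Pn α e 1 j * (Pn 1 1 1 j)⁻¹ * (C β * X ^ f) ^ j -
          C α * X ^ e * (Pn α e 1 j * (Pn 1 1 1 j)⁻¹ * (C β * X ^ (f + 1)) ^ j)) := by
      funext j
      have a1 : Pn α e 1 (j + 1) = Pn α e 1 j * (1 - C α * X ^ (e + j)) := by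
        rw [Pn, prod_range_succ, Pn, one_mul]
      have a2 : (Pn 1 1 1 (j + 1))⁻¹ * (1 - X ^ (j + 1)) = (Pn 1 1 1 j)⁻¹ := by
        rw [Pn, prod_range_succ, PowerSeries.mul_inv_rev, ← Pn, map_one, one_mul, one_mul,
          add_comm 1 j, mul_comm, ← mul_assoc,
          PowerSeries.mul_inv_cancel _ (by simp), one_mul]
      rw [← a2, a1]
      ring
    rw [h3, h2] at h1
    simp only [range_one, sum_singleton, pow_zero, sub_self, zero_add] at h1
    rw [map_mul]
    simp only [hF]
    linear_combination -h1
  have iter : ∀ N, Pn β f 1 N * F f = Pn (α * β) (e + f) 1 N * F (f + N) := by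
    intro N
    induction N with
    | zero => simp [Pn]
    | succ n ih =>
      rw [Pn, prod_range_succ, Pn, prod_range_succ, ← Pn, ← Pn]
      have := step (f + n) (by omega)
      rw [one_mul, mul_right_comm, ih, ← add_assoc f n 1, mul_assoc _ _ (F (f + n + 1)),
        add_assoc e f n, ← this]
      ring
  have lim1 : Conv (fun N => F (f + N)) 1 := by
    intro M
    refine ⟨M, fun N hN => ?_⟩
    simp only [hF]
    rw [psum_shift (sm (f + N) (by omega)) 1]
    simp only [range_one, sum_singleton, pow_zero, Pn, range_zero, prod_empty, mul_one, one_mul]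
    rw [show (1 : S)⁻¹ = 1 by simp, add_sub_cancel_left]
    rw [X_pow_dvd_iff]
    intro m hm
    have hs := (sm (f + N) (by omega)).shift 1
    simp only [Pn, one_mul] at hs
    rw [coeff_psum hs (Nat.lt_succ_self m)]
    apply sum_eq_zero
    intro j _
    refine X_pow_dvd_iff.mp ?_ m hm
    apply Dvd.dvd.mul_left
    rw [mul_pow, ← pow_mul]
    exact (pow_dvd_pow X (by nlinarith)).mul_left _
  have l1 := (Pn_conv β f 1 one_pos).mul (Conv.const (F f))
  have l2 := (Pn_conv (α * β) (e + f) 1 one_pos).mul lim1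
  have key := l1.unique (l2.congr 0 fun N _ => (iter N).symm)
  rw [mul_one] at key
  rw [← key, mul_right_comm, PowerSeries.mul_inv_cancel _ (const_Pinf_ne _ _ _ hf one_pos), one_mul]
end RC
end

section
namespace RC
open PowerSeries Finset

/-! ### crank generating function -/

/-- weight function -/
def wf (h u : ℕ → ℂ) : ℕ → ℕ → ℂ := fun i c => if i = 1 then h c else u i ^ c

theorem wt_prod (s : Multiset ℕ) (h u : ℕ → ℂ) :
    (Multiset.toFinsupp s).prod (wf h u) =
      (if s.count 1 = 0 then 1 else h (s.count 1)) * ((s.filter (· ≠ 1)).map u).prod := by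
  rw [Finset.prod_multiset_map_count, Finsupp.prod, Multiset.toFinsupp_support]
  have e1 : (s.filter (· ≠ 1)).toFinset = s.toFinset.erase 1 := by
    ext i; simp [and_comm]
  rw [e1]
  have e2 : ∏ i ∈ s.toFinset.erase 1, u i ^ (s.filter (· ≠ 1)).count i =
      ∏ i ∈ s.toFinset.erase 1, (if i = 1 then h (s.count i) else u i ^ s.count i) := by
    apply prod_congr rfl
    intro i hi
    have hi1 := (mem_erase.mp hi).1
    rw [if_neg hi1, Multiset.count_filter_of_pos (p := (· ≠ 1)) hi1]
  rw [e2]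
  simp only [Multiset.toFinsupp_apply, wf]
  by_cases hc : s.count 1 = 0
  · rw [if_pos hc, one_mul, erase_eq_of_notMem]
    simpa [Multiset.count_eq_zero] using hc
  · rw [if_neg hc, ← mul_prod_erase s.toFinset _ (a := 1)]
    · simp
    · rw [Multiset.mem_toFinset, ← Multiset.count_ne_zero]; exact hc

theorem prod_ite_z (z : ℂ) (j : ℕ) (s : Multiset ℕ) :
    (s.map (fun i => if i ≤ j then 1 else z)).prod = z ^ (s.filter (j < ·)).card := by
  induction s using Multiset.induction_on with
  | empty => simp
  | cons a s ih =>
    by_cases h : a ≤ j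
    · rw [Multiset.map_cons, Multiset.prod_cons, ih, if_pos h, one_mul,
        Multiset.filter_cons_of_neg _ (by omega)]
    · rw [Multiset.map_cons, Multiset.prod_cons, ih, if_neg h,
        Multiset.filter_cons_of_pos _ (by omega), Multiset.card_cons, pow_succ, mul_comm]

theorem zero_pow_card (l : ℕ) (s : Multiset ℕ) :
    (0 : ℂ) ^ (s.filter (l < ·)).card = if s.sup ≤ l then 1 else 0 := by
  rw [zero_pow_eq]
  simp only [Multiset.card_eq_zero, Multiset.filter_eq_nil, Multiset.sup_le, not_lt]

theorem sum_tel (z : ℂ) (s N : ℕ) (h : s ≤ N) :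
    (if s ≤ 0 then 1 else 0) + ∑ l ∈ range N, z ^ (l + 1) *
      ((if s ≤ l + 1 then 1 else 0) - (if s ≤ l then 1 else 0)) = z ^ s := by
  rcases Nat.eq_zero_or_pos s with h0 | h0
  · subst h0; simp
  · rw [sum_eq_single (s - 1)]
    · rw [if_neg (by omega), if_pos (by omega), if_neg (by omega), Nat.sub_add_cancel h0]; ring
    · intro b _ hb
      by_cases hc : s ≤ b
      · rw [if_pos hc, if_pos (by omega)]; ring
      · rw [if_neg hc, if_neg (by omega)]; ring
    · intro hn
      simp at hn; omega

theorem crank_pointwise (z : ℂ) (hz : z ≠ 0) {n : ℕ} (p : n.Partition) (N : ℕ) (hN : n ≤ N) :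
    z ^ partitionCrank p =
      (Multiset.toFinsupp p.parts).prod (wf 0 (fun i => if i ≤ 0 then 1 else 0)) +
      ∑ l ∈ range N, z ^ (l + 1) *
        ((Multiset.toFinsupp p.parts).prod (wf 0 (fun i => if i ≤ l + 1 then 1 else 0)) -
         (Multiset.toFinsupp p.parts).prod (wf 0 (fun i => if i ≤ l then 1 else 0))) +
      ∑ j ∈ range N, z⁻¹ ^ (j + 1) *
        ((Multiset.toFinsupp p.parts).prod
            (wf (fun c => if c = j + 1 then 1 else 0) (fun i => if i ≤ j + 1 then 1 else z)) -
         (Multiset.toFinsupp p.parts).prod (wf 0 (fun i => if i ≤ j + 1 then 1 else z))) := by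
  simp only [wt_prod, prod_ite_z]
  rw [partitionCrank]
  have hmem : ∀ a ∈ p.parts, a ≤ n := fun a ha => by
    have := Multiset.single_le_sum (fun x _ => Nat.zero_le x) a ha
    rw [p.parts_sum] at this; exact this
  by_cases hc : p.parts.count 1 = 0
  · simp only [hc, if_true, one_mul, sub_self, mul_zero, sum_const_zero, add_zero]
    have hf : p.parts.filter (· ≠ 1) = p.parts := by
      rw [Multiset.filter_eq_self]
      intro a ha h1
      subst h1
      exact (Multiset.count_ne_zero.mpr ha) hc
    simp only [hf, zero_pow_card]
    rw [sum_tel _ _ _ (le_trans (Multiset.sup_le.mpr hmem) hN), zpow_natCast]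
  · simp only [hc, if_false, Pi.zero_apply, zero_mul, sub_self, mul_zero, sum_const_zero, sub_zero,
      zero_add]
    have hcn : p.parts.count 1 ≤ n := by
      have h1 : p.parts.count 1 ≤ p.parts.card := Multiset.count_le_card _ _
      have h2 : p.parts.card ≤ p.parts.sum := by
        have := Multiset.card_nsmul_le_sum (s := p.parts) (a := 1) (fun x hx => p.parts_pos hx)
        simpa using this
      rw [p.parts_sum] at h2
      omega
    rw [sum_eq_single (p.parts.count 1 - 1)]
    · rw [Nat.sub_add_cancel (by omega), if_pos rfl, one_mul, Multiset.filter_filter,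
        zpow_sub₀ hz, zpow_natCast, zpow_natCast, inv_pow, div_eq_mul_inv, mul_comm]
      congr 3
      apply Multiset.filter_congr
      intro a _
      constructor
      · intro h; exact ⟨h, by omega⟩
      · intro h; exact h.1
    · intro b _ hb
      rw [if_neg (by omega)]; ring
    · intro h
      simp at h; omega

/-- crank generating function -/
noncomputable def crankGF (z : ℂ) : S :=
  PowerSeries.mk fun n => ∑ p : n.Partition, z ^ partitionCrank p

theorem const_inv_mul (a : S) (h : constantCoeff a = 1) : a⁻¹ * a = 1 :=
  PowerSeries.inv_mul_cancel a (by rw [h]; exact one_ne_zero)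

theorem GL_eq (l : ℕ) : Nat.Partition.genFun (wf 0 (fun i => if i ≤ l then 1 else 0)) =
    (Pn 1 2 1 (l - 1))⁻¹ := by
  have hA : Conv (fun N => ∏ i ∈ range N, (1 - C (if i + 2 ≤ l then (1 : ℂ) else 0) *
      (X : S) ^ (i + 2))⁻¹) (Pn 1 2 1 (l - 1))⁻¹ := by
    refine (Conv.const _).congr (l - 1) fun N hN => ?_
    obtain ⟨t, rfl⟩ := Nat.exists_eq_add_of_le hN
    rw [prod_range_add, prod_inv, Pn]
    rw [prod_eq_one (s := range t), mul_one]
    · congr 1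
      apply prod_congr rfl
      intro i hi
      rw [mem_range] at hi
      rw [if_pos (by omega), one_mul, add_comm]
    · intro i _
      rw [if_neg (by omega)]
      simp
  have := genFun_gen 0 (fun i => if i ≤ l then 1 else 0) hA
  have e0 : psum (fun j => C ((0 : ℕ → ℂ) (j + 1)) * (X : S) ^ (j + 1)) = 0 :=
    psum_eq (fun k => by simp) ((Conv.const 0).congr 0 fun N _ => by simp)
  rw [e0, add_zero, one_mul] at this
  exact this

theorem conv_G (z : ℂ) (j : ℕ) :
    Conv (fun N => ∏ i ∈ range N, (1 - C (if i + 2 ≤ j + 1 then (1 : ℂ) else z) *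
      (X : S) ^ (i + 2))⁻¹) ((Pn 1 2 1 j)⁻¹ * (Pinf z (j + 2) 1)⁻¹) := by
  have h1 := (Conv.const (Pn 1 2 1 j)⁻¹).mul
    (((Pn_conv z (j + 2) 1 one_pos).inv (fun N => by rw [const_Pn _ _ _ _ (by omega)]; simp)
      (const_Pinf_ne _ _ _ (by omega) (by omega))).comp (f := fun N => N - j)
      (fun M => ⟨M + j, fun N h => by omega⟩))
  refine h1.congr j fun N hN => ?_
  obtain ⟨t, rfl⟩ := Nat.exists_eq_add_of_le hN
  rw [prod_range_add, prod_inv, prod_inv, Nat.add_sub_cancel_left, Pn, Pn]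
  congr 2
  · apply prod_congr rfl
    intro i hi
    rw [mem_range] at hi
    rw [if_pos (by omega), one_mul, add_comm]
  · apply prod_congr rfl
    intro i hi
    rw [if_neg (by omega), one_mul]
    congr 3
    omega

theorem G0_eq (z : ℂ) (j : ℕ) :
    Nat.Partition.genFun (wf 0 (fun i => if i ≤ j + 1 then 1 else z)) =
    (Pn 1 2 1 j)⁻¹ * (Pinf z (j + 2) 1)⁻¹ := by
  have := genFun_gen 0 (fun i => if i ≤ j + 1 then 1 else z) (conv_G z j)
  have e0 : psum (fun j => C ((0 : ℕ → ℂ) (j + 1)) * (X : S) ^ (j + 1)) = 0 :=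
    psum_eq (fun k => by simp) ((Conv.const 0).congr 0 fun N _ => by simp)
  rw [e0, add_zero, one_mul] at this
  exact this

theorem G1_eq (z : ℂ) (j : ℕ) :
    Nat.Partition.genFun
      (wf (fun c => if c = j + 1 then 1 else 0) (fun i => if i ≤ j + 1 then 1 else z)) =
    (1 + X ^ (j + 1)) * ((Pn 1 2 1 j)⁻¹ * (Pinf z (j + 2) 1)⁻¹) := by
  have := genFun_gen (fun c => if c = j + 1 then 1 else 0) (fun i => if i ≤ j + 1 then 1 else z)
    (conv_G z j)
  have e0 : psum (fun k => C (if k + 1 = j + 1 then (1 : ℂ) else 0) * (X : S) ^ (k + 1)) =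
      X ^ (j + 1) := by
    refine psum_eq (fun k => (pow_dvd_pow X (by omega)).mul_left _)
      ((Conv.const _).congr (j + 1) fun N hN => ?_)
    rw [sum_eq_single j]
    · simp
    · intro b _ hb
      rw [if_neg (by omega)]; simp
    · intro h; simp at h; omega
  rw [e0] at this
  exact this

theorem Pn_12 (j : ℕ) : (Pn 1 2 1 j)⁻¹ = (1 - X) * (Pn 1 1 1 (j + 1))⁻¹ := by
  have h : Pn 1 1 1 (j + 1) = (1 - X) * Pn 1 2 1 j := by
    rw [Pn, prod_range_succ', mul_comm, Pn]
    congr 1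
    · simp
    · apply prod_congr rfl
      intro i _
      congr 3
      omega
  rw [h, PowerSeries.mul_inv_rev, mul_comm, mul_assoc, const_inv_mul _ (by simp), mul_one]

theorem Pinf_split_at (z : ℂ) (j : ℕ) : (Pinf z (j + 2) 1)⁻¹ = Pn z 1 1 (j + 1) * (Pinf z 1 1)⁻¹ := by
  have h : Pinf z 1 1 = Pn z 1 1 (j + 1) * Pinf z (j + 2) 1 := by
    have h1 := (Conv.const (Pn z 1 1 (j + 1))).mul (Pn_conv z (j + 2) 1 one_pos)
    have h2 := (Pn_conv z 1 1 one_pos).comp (f := fun N => j + 1 + N)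
      (fun M => ⟨M, fun N h => by omega⟩)
    refine h2.unique (h1.congr 0 fun N _ => ?_)
    unfold Pn
    rw [prod_range_add _ (j + 1) N]
    congr 1
    apply prod_congr rfl
    intro i _
    congr 3
    omega
  rw [h, PowerSeries.mul_inv_rev, mul_comm, mul_assoc,
    const_inv_mul _ (const_Pn _ _ _ _ one_pos), mul_one]

theorem crank_gf (z : ℂ) (hz : z ≠ 0) :
    crankGF z = X - C z * X + Pinf 1 1 1 * ((Pinf z 1 1)⁻¹ * (Pinf z⁻¹ 1 1)⁻¹) := by
  have smL : Sm (fun l => C (z ^ (l + 1)) *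
      ((Pn 1 2 1 (l + 1 - 1))⁻¹ - (Pn 1 2 1 (l - 1))⁻¹)) := by
    intro l
    apply Dvd.dvd.mul_left
    rcases l with _ | l
    · simp
    · have : (Pn 1 2 1 (l + 1))⁻¹ * (1 - X ^ (l + 2)) = (Pn 1 2 1 l)⁻¹ := by
        rw [Pn, prod_range_succ, PowerSeries.mul_inv_rev, ← Pn, map_one, one_mul, one_mul,
          add_comm 2 l, mul_comm, ← mul_assoc, PowerSeries.mul_inv_cancel _ (by simp), one_mul]
      simp only [Nat.add_sub_cancel]
      rw [← this, mul_sub, mul_one, sub_sub_cancel]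
      exact (pow_dvd_pow X (by omega)).mul_left _
  have smJ : Sm (fun j => C (z⁻¹ ^ (j + 1)) *
      ((1 + X ^ (j + 1)) * ((Pn 1 2 1 j)⁻¹ * (Pinf z (j + 2) 1)⁻¹) -
        (Pn 1 2 1 j)⁻¹ * (Pinf z (j + 2) 1)⁻¹)) := by
    intro j
    apply Dvd.dvd.mul_left
    rw [add_mul, one_mul, add_sub_cancel_left]
    exact (pow_dvd_pow X (by omega)).mul_right _
  have h1 : crankGF z = 1 + psum (fun l => C (z ^ (l + 1)) *
      ((Pn 1 2 1 (l + 1 - 1))⁻¹ - (Pn 1 2 1 (l - 1))⁻¹)) + psum (fun j => C (z⁻¹ ^ (j + 1)) *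
      ((1 + X ^ (j + 1)) * ((Pn 1 2 1 j)⁻¹ * (Pinf z (j + 2) 1)⁻¹) -
        (Pn 1 2 1 j)⁻¹ * (Pinf z (j + 2) 1)⁻¹)) := by
    ext n
    rw [map_add, map_add, coeff_psum smL (Nat.lt_succ_self n), coeff_psum smJ (Nat.lt_succ_self n)]
    have e0 : (1 : S) = (Pn 1 2 1 (0 - 1))⁻¹ := by simp [Pn]
    nth_rw 1 [e0]
    rw [← GL_eq 0]
    simp only [← G1_eq]
    simp only [← G0_eq, ← GL_eq, coeff_C_mul, map_sub, Nat.Partition.coeff_genFun]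
    rw [crankGF, coeff_mk, sum_congr rfl fun p _ => crank_pointwise z hz p (n + 1) (by omega)]
    rw [sum_add_distrib, sum_add_distrib]
    congr 1
    · congr 1
      rw [sum_comm]
      simp only [← mul_sum, sum_sub_distrib]
    · rw [sum_comm]
      simp only [← mul_sum, sum_sub_distrib]
  have eu := cauchy 0 z 1 1 one_pos
  have ca := cauchy z z⁻¹ 1 1 one_pos
  have smc : ∀ α β : ℂ, Sm (fun j => Pn α 1 1 j * (Pn 1 1 1 j)⁻¹ * (C β * X ^ 1) ^ j) := by
    intro α β j
    apply Dvd.dvd.mul_left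
    rw [mul_pow, ← pow_mul]
    exact (pow_dvd_pow X (by nlinarith)).mul_left _
  have P0 : ∀ j, Pn 0 1 1 j = 1 := fun j => by simp [Pn]
  have P0i : Pinf 0 2 1 = 1 := Pinf_eq one_pos ((Conv.const 1).congr 0 fun N _ => by simp [Pn])
  rw [psum_shift (smc _ _) 2] at eu
  rw [psum_shift (smc _ _) 1] at ca
  have t1 : psum (fun l => C (z ^ (l + 1)) *
      ((Pn 1 2 1 (l + 1 - 1))⁻¹ - (Pn 1 2 1 (l - 1))⁻¹)) =
      (1 - X) * psum (fun k => Pn 0 1 1 (k + 2) * (Pn 1 1 1 (k + 2))⁻¹ * (C z * X ^ 1) ^ (k + 2)) := by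
    rw [psum_shift smL 1, ← psum_mul_left ((smc _ _).shift 2)]
    simp only [range_one, sum_singleton]
    rw [show (0 + 1 - 1 : ℕ) = 0 - 1 from rfl, sub_self, mul_zero, zero_add]
    congr 1
    funext l
    simp only [Nat.add_sub_cancel, P0, one_mul]
    have : (Pn 1 2 1 (l + 1))⁻¹ * (1 - X ^ (l + 2)) = (Pn 1 2 1 l)⁻¹ := by
      rw [Pn, prod_range_succ, PowerSeries.mul_inv_rev, ← Pn, map_one, one_mul, one_mul,
        add_comm 2 l, mul_comm, ← mul_assoc, PowerSeries.mul_inv_cancel _ (by simp), one_mul]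
    rw [← this, Pn_12, map_pow]
    ring
  have t2 : psum (fun j => C (z⁻¹ ^ (j + 1)) *
      ((1 + X ^ (j + 1)) * ((Pn 1 2 1 j)⁻¹ * (Pinf z (j + 2) 1)⁻¹) -
        (Pn 1 2 1 j)⁻¹ * (Pinf z (j + 2) 1)⁻¹)) =
      ((1 - X) * (Pinf z 1 1)⁻¹) * psum (fun k => Pn z 1 1 (k + 1) * (Pn 1 1 1 (k + 1))⁻¹ *
        (C z⁻¹ * X ^ 1) ^ (k + 1)) := by
    rw [← psum_mul_left ((smc _ _).shift 1)]
    congr 1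
    funext j
    rw [Pinf_split_at, Pn_12, map_pow]
    ring
  have s1 := Pinf_step 1 1 1 one_pos
  have p1 : (1 - X) * (Pn 1 1 1 1)⁻¹ = 1 := by
    have := Pn_12 0
    rw [← this]; simp [Pn]
  have p0 : (Pn 1 1 1 0)⁻¹ = 1 := by simp [Pn]
  have pz0 : Pn z 1 1 0 = 1 := by simp [Pn]
  simp only [sum_range_succ, range_zero, sum_empty, P0, zero_mul, P0i, p0, pz0, mul_inv_cancel₀ hz,
    pow_zero, pow_one, zero_add, one_mul, mul_one, Nat.reduceAdd] at eu ca
  simp only [map_one, one_mul, pow_one, Nat.reduceAdd] at s1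
  rw [h1, t1, t2, s1]
  simp only [P0, one_mul, pow_one]
  linear_combination (1 - X) * eu + ((1 - X) * (Pinf z 1 1)⁻¹) * ca - C z * X * p1
end RC
end

section
namespace RC
open PowerSeries Finset

/-! ### Dyson's adjoint -/

/-- decrease all parts by one -/
def dn (s : Multiset ℕ) : Multiset ℕ := (s.map (· - 1)).filter (· ≠ 0)

/-- increase all parts by one and add ones -/
def up (s : Multiset ℕ) (k : ℕ) : Multiset ℕ := s.map (· + 1) + Multiset.replicate k 1

theorem dn_up (s : Multiset ℕ) (hs : ∀ a ∈ s, 0 < a) (k : ℕ) : dn (up s k) = s := by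
  rw [dn, up, Multiset.map_add, Multiset.filter_add, Multiset.map_map, Multiset.map_replicate]
  have h1 : ((Multiset.replicate k (1 - 1)).filter (· ≠ 0)) = 0 := by
    rw [Multiset.filter_eq_nil]
    intro a ha
    have := Multiset.eq_of_mem_replicate ha
    simp [this]
  rw [h1, add_zero]
  have h2 : s.map ((· - 1) ∘ (· + 1)) = s := by
    conv_rhs => rw [← Multiset.map_id s]
    apply Multiset.map_congr rfl
    intro a _
    simp
  rw [h2, Multiset.filter_eq_self]
  intro a ha
  have := hs a ha
  omega

theorem dn_cons_one (s : Multiset ℕ) : dn (1 ::ₘ s) = dn s := by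
  rw [dn, Multiset.map_cons, Multiset.filter_cons_of_neg _ (by simp), dn]

theorem dn_cons (s : Multiset ℕ) (a : ℕ) (ha : 1 < a) : dn (a ::ₘ s) = (a - 1) ::ₘ dn s := by
  rw [dn, Multiset.map_cons, Multiset.filter_cons_of_pos _ (by omega), dn]

theorem dn_props (s : Multiset ℕ) : (∀ a ∈ s, 0 < a) →
    (dn s).card ≤ s.card ∧ (dn s).sum + s.card = s.sum ∧ up (dn s) (s.card - (dn s).card) = s := by
  induction s using Multiset.induction_on with
  | empty => intro _; simp [dn, up]
  | cons a s ih =>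
    intro h
    obtain ⟨h1, h2, h3⟩ := ih fun b hb => h b (Multiset.mem_cons_of_mem hb)
    have ha := h a (Multiset.mem_cons_self a s)
    by_cases h' : a = 1
    · subst h'
      rw [dn_cons_one, Multiset.card_cons, Multiset.sum_cons]
      refine ⟨by omega, by omega, ?_⟩
      rw [show s.card + 1 - (dn s).card = (s.card - (dn s).card) + 1 by omega, up,
        Multiset.replicate_succ, Multiset.add_cons, ← up, h3]
    · rw [dn_cons s a (by omega), Multiset.card_cons, Multiset.card_cons, Multiset.sum_cons,
        Multiset.sum_cons]
      refine ⟨by omega, by omega, ?_⟩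
      rw [Nat.add_sub_add_right, up, Multiset.map_cons, Multiset.cons_add, ← up, h3,
        Nat.sub_add_cancel ha]

theorem up_card (s : Multiset ℕ) (k : ℕ) : (up s k).card = s.card + k := by simp [up]

theorem up_sum (s : Multiset ℕ) (k : ℕ) : (up s k).sum = s.sum + s.card + k := by
  simp [up, Multiset.sum_map_add]

theorem up_pos (s : Multiset ℕ) (k : ℕ) : ∀ a ∈ up s k, 0 < a := by
  intro a ha
  rw [up, Multiset.mem_add] at ha
  rcases ha with ha | ha
  · obtain ⟨b, _, rfl⟩ := Multiset.mem_map.mp ha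
    omega
  · rw [Multiset.eq_of_mem_replicate ha]; exact one_pos

theorem dn_pos (s : Multiset ℕ) : ∀ a ∈ dn s, 0 < a := by
  intro a ha
  have := (Multiset.mem_filter.mp ha).2
  omega

theorem sup_mem (s : Multiset ℕ) (hs : s ≠ 0) : s.sup ∈ s := by
  induction s using Multiset.induction_on with
  | empty => exact absurd rfl hs
  | cons a s ih =>
    rw [Multiset.sup_cons]
    by_cases h : s = 0
    · subst h; simp
    · rcases le_total a s.sup with h' | h'
      · rw [sup_eq_right.mpr h']; exact Multiset.mem_cons_of_mem (ih h)
      · rw [sup_eq_left.mpr h']; exact Multiset.mem_cons_self _ _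

theorem le_sup' (s : Multiset ℕ) (a : ℕ) (h : a ∈ s) : a ≤ s.sup := Multiset.le_sup h

theorem parts_ne {n : ℕ} (hn : 1 ≤ n) (p : n.Partition) : p.parts ≠ 0 := by
  intro h
  have := p.parts_sum
  rw [h] at this
  simp at this
  omega

theorem dyson (n n' : ℕ) (r : ℤ) (hn : 1 ≤ n) (h : (n' : ℤ) = n - r - 1) :
    (univ.filter (fun p : n.Partition => r ≤ partitionRank p)).card =
    (univ.filter (fun p : n'.Partition => partitionRank p ≤ r + 2)).card := by
  have key1 : ∀ p : n.Partition, r ≤ partitionRank p →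
      (up (p.parts.erase p.parts.sup) (partitionRank p - r).toNat).sum = n' := by
    intro p hp
    rw [partitionRank] at *
    have hm := sup_mem p.parts (parts_ne hn p)
    have h1 := Multiset.card_erase_add_one hm
    have h2 := Multiset.sum_erase hm
    rw [p.parts_sum] at h2
    rw [up_sum]
    omega
  have key2 : ∀ p : n'.Partition, partitionRank p ≤ r + 2 →
      0 < ((p.parts.card : ℤ) + r + 1) ∧ (∀ a ∈ dn p.parts, (a : ℤ) ≤ p.parts.card + r + 1) := by
    intro p hp
    rw [partitionRank] at hp
    obtain ⟨d1, d2, d3⟩ := dn_props p.parts (fun a ha => p.parts_pos ha)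
    rw [p.parts_sum] at d2
    have hle : ∀ a ∈ dn p.parts, (a : ℤ) ≤ p.parts.card + r + 1 := by
      intro a ha
      obtain ⟨b, hb, rfl⟩ := Multiset.mem_map.mp (Multiset.mem_filter.mp ha).1
      have h0 := (Multiset.mem_filter.mp ha).2
      have := le_sup' _ _ hb
      omega
    refine ⟨?_, hle⟩
    by_cases he : dn p.parts = 0
    · rw [he] at d2
      simp at d2
      omega
    · obtain ⟨a, ha⟩ := Multiset.exists_mem_of_ne_zero he
      have h1 := hle a ha
      have h2 := dn_pos _ a ha
      omega
  have key3 : ∀ p : n'.Partition, partitionRank p ≤ r + 2 →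
      (((p.parts.card : ℤ) + r + 1).toNat ::ₘ dn p.parts).sum = n := by
    intro p hp
    obtain ⟨k1, _⟩ := key2 p hp
    obtain ⟨d1, d2, d3⟩ := dn_props p.parts (fun a ha => p.parts_pos ha)
    rw [p.parts_sum] at d2
    rw [Multiset.sum_cons]
    omega
  have key4 : ∀ p : n'.Partition, partitionRank p ≤ r + 2 →
      (((p.parts.card : ℤ) + r + 1).toNat ::ₘ dn p.parts).sup =
        ((p.parts.card : ℤ) + r + 1).toNat := by
    intro p hp
    obtain ⟨k1, k2⟩ := key2 p hp
    rw [Multiset.sup_cons]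
    apply sup_eq_left.mpr
    rw [Multiset.sup_le]
    intro a ha
    have := k2 a ha
    omega
  refine card_bij'
    (fun p hp => ⟨up (p.parts.erase p.parts.sup) (partitionRank p - r).toNat,
      fun {i} hi => up_pos _ _ i hi, key1 p (mem_filter.mp hp).2⟩)
    (fun p hp => ⟨((p.parts.card : ℤ) + r + 1).toNat ::ₘ dn p.parts, fun {i} hi => by
      rcases Multiset.mem_cons.mp hi with h | h
      · have := (key2 p (mem_filter.mp hp).2).1
        omega
      · exact dn_pos _ i h, key3 p (mem_filter.mp hp).2⟩) ?_ ?_ ?_ ?_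
  · intro p hp
    have hp := (mem_filter.mp hp).2
    rw [mem_filter]
    refine ⟨mem_univ _, ?_⟩
    simp only [partitionRank]
    rw [up_card]
    have hm := sup_mem p.parts (parts_ne hn p)
    have h1 := Multiset.card_erase_add_one hm
    have h2 : (up (p.parts.erase p.parts.sup) ((p.parts.sup : ℤ) - p.parts.card - r).toNat).sup ≤
        p.parts.sup + 1 := by
      rw [Multiset.sup_le]
      intro a ha
      rw [up, Multiset.mem_add] at ha
      rcases ha with ha | ha
      · obtain ⟨b, hb, rfl⟩ := Multiset.mem_map.mp ha
        have := le_sup' _ _ (Multiset.mem_of_mem_erase hb)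
        omega
      · rw [Multiset.eq_of_mem_replicate ha]; omega
    rw [partitionRank] at hp
    omega
  · intro p hp
    have hp := (mem_filter.mp hp).2
    rw [mem_filter]
    refine ⟨mem_univ _, ?_⟩
    simp only [partitionRank]
    rw [key4 p hp, Multiset.card_cons]
    obtain ⟨k1, k2⟩ := key2 p hp
    obtain ⟨d1, d2, d3⟩ := dn_props p.parts (fun a ha => p.parts_pos ha)
    omega
  · intro p hp
    have hp := (mem_filter.mp hp).2
    apply Nat.Partition.ext
    simp only
    have hm := sup_mem p.parts (parts_ne hn p)
    have h1 := Multiset.card_erase_add_one hm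
    rw [dn_up _ (fun a ha => p.parts_pos (Multiset.mem_of_mem_erase ha)), up_card]
    rw [partitionRank] at *
    have : (((p.parts.erase p.parts.sup).card + ((p.parts.sup : ℤ) - p.parts.card - r).toNat : ℕ) +
        r + 1 : ℤ).toNat = p.parts.sup := by omega
    rw [this, Multiset.cons_erase hm]
  · intro p hp
    have hp := (mem_filter.mp hp).2
    apply Nat.Partition.ext
    simp only [partitionRank]
    rw [key4 p hp, Multiset.erase_cons_head, Multiset.card_cons]
    obtain ⟨k1, k2⟩ := key2 p hp
    obtain ⟨d1, d2, d3⟩ := dn_props p.parts (fun a ha => p.parts_pos ha)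
    have : ((((p.parts.card : ℤ) + r + 1).toNat : ℤ) - ((dn p.parts).card + 1 : ℕ) - r).toNat =
        p.parts.card - (dn p.parts).card := by omega
    rw [this, d3]

/-- gf of partitions with rank at least `r` -/
noncomputable def Ar (r : ℕ) : S := PowerSeries.mk fun n =>
  ((univ.filter (fun p : n.Partition => (r : ℤ) ≤ partitionRank p)).card : ℂ)

/-- gf of partitions with rank at most `-r` -/
noncomputable def Br (r : ℕ) : S := PowerSeries.mk fun n =>
  ((univ.filter (fun p : n.Partition => partitionRank p ≤ -(r : ℤ))).card : ℂ)

theorem card_le_sum {n : ℕ} (p : n.Partition) : p.parts.card ≤ n := by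
  have := Multiset.card_nsmul_le_sum (s := p.parts) (a := 1) (fun x hx => p.parts_pos hx)
  rw [p.parts_sum] at this
  simpa using this

theorem rank_bounds {n : ℕ} (hn : 1 ≤ n) (p : n.Partition) :
    partitionRank p ≤ n - 1 ∧ 1 - (n : ℤ) ≤ partitionRank p := by
  have hm := sup_mem p.parts (parts_ne hn p)
  have h1 := Multiset.single_le_sum (fun x _ => Nat.zero_le x) _ hm
  rw [p.parts_sum] at h1
  have h2 := card_le_sum p
  have h3 := p.parts_pos hm
  have h4 : 0 < p.parts.card := Multiset.card_pos.mpr (parts_ne hn p)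
  rw [partitionRank]
  omega

theorem rank_zero (p : Nat.Partition 0) : partitionRank p = 0 := by
  have := card_le_sum p
  have h0 : p.parts = 0 := Multiset.card_eq_zero.mp (by omega)
  rw [partitionRank, h0]
  simp

theorem compl_card {n : ℕ} (q : n.Partition → Prop) [DecidablePred q]
    (q' : n.Partition → Prop) [DecidablePred q'] (h : ∀ p, q' p ↔ ¬ q p) :
    ((univ.filter q).card : ℂ) = Fintype.card n.Partition - ((univ.filter q').card : ℂ) := by
  have h1 := card_filter_add_card_filter_not (s := (univ : Finset n.Partition)) q
  have h2 : univ.filter q' = univ.filter (fun p => ¬ q p) := by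
    apply filter_congr
    intro p _
    exact h p
  rw [h2, eq_sub_iff_add_eq, Fintype.card, ← h1]
  push_cast
  rfl

theorem Ar_rec (r : ℕ) (hr : 1 ≤ r) : Ar r = X ^ (r + 1) * (P - Ar (r + 3)) := by
  ext n
  rw [coeff_X_pow_mul']
  split_ifs with hn
  · obtain ⟨m, rfl⟩ := Nat.exists_eq_add_of_le hn
    rw [Nat.add_sub_cancel_left, map_sub]
    simp only [Ar, P, coeff_mk]
    rw [dyson (r + 1 + m) m r (by omega) (by push_cast; ring)]
    apply compl_card
    intro p
    push_cast
    omega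
  · simp only [Ar, coeff_mk]
    rw [filter_eq_empty_iff.mpr]
    · simp
    · intro p _
      rcases Nat.eq_zero_or_pos n with h0 | h0
      · subst h0; rw [rank_zero]; omega
      · have := rank_bounds h0 p
        omega

theorem Br_one (r : ℕ) :
    (univ.filter (fun p : (r + 1).Partition => partitionRank p ≤ -(r : ℤ))).card = 1 := by
  have key : ∀ p : (r + 1).Partition, partitionRank p ≤ -(r : ℤ) →
      p.parts = Multiset.replicate (r + 1) 1 := by
    intro p hp
    have hm := sup_mem p.parts (parts_ne (by omega) p)
    have h2 := card_le_sum p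
    have h3 := p.parts_pos hm
    rw [partitionRank] at hp
    have h5 : p.parts.sup = 1 := by omega
    rw [Multiset.eq_replicate]
    refine ⟨by omega, fun b hb => ?_⟩
    have h6 := le_sup' _ _ hb
    have h7 := p.parts_pos hb
    omega
  rw [card_eq_one]
  refine ⟨⟨Multiset.replicate (r + 1) 1, fun {i} hi => by
    rw [Multiset.eq_of_mem_replicate hi]; exact one_pos, by simp [add_comm]⟩, ?_⟩
  ext p
  rw [mem_filter, mem_singleton]
  constructor
  · rintro ⟨_, h⟩
    exact Nat.Partition.ext (key p h)
  · rintro rfl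
    refine ⟨mem_univ _, ?_⟩
    simp only [partitionRank]
    have : (Multiset.replicate (r + 1) 1).sup ≤ 1 := by
      rw [Multiset.sup_le]
      intro b hb
      rw [Multiset.eq_of_mem_replicate hb]
    rw [Multiset.card_replicate]
    push_cast
    omega

theorem Br_rec (r : ℕ) (hr : 1 ≤ r) : Br r = X ^ (r + 1) * (P - Br (r + 3)) := by
  ext n
  rw [coeff_X_pow_mul']
  split_ifs with hn
  · obtain ⟨m, rfl⟩ := Nat.exists_eq_add_of_le hn
    rw [Nat.add_sub_cancel_left, map_sub]
    simp only [Br, P, coeff_mk]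
    rcases Nat.eq_zero_or_pos m with h0 | h0
    · subst h0
      have e1 : (univ.filter (fun p : (r + 1 + 0).Partition => partitionRank p ≤ -(r : ℤ))).card = 1 :=
        Br_one r
      have e2 : (univ.filter (fun p : (0 : ℕ).Partition =>
          partitionRank p ≤ -((r + 3 : ℕ) : ℤ))) = ∅ := by
        rw [filter_eq_empty_iff]
        intro p _
        rw [rank_zero]; omega
      rw [e2, card_empty]
      rw [e1]
      simp
    · have := dyson m (r + 1 + m) (-(r : ℤ) - 2) h0 (by push_cast; ring)
      rw [show (-(r : ℤ) - 2 + 2) = -(r : ℤ) by ring] at this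
      rw [← this]
      apply compl_card
      intro p
      push_cast
      omega
  · simp only [Br, coeff_mk]
    rw [filter_eq_empty_iff.mpr]
    · simp
    · intro p _
      rcases Nat.eq_zero_or_pos n with h0 | h0
      · subst h0; rw [rank_zero]; omega
      · have := rank_bounds h0 p
        omega

theorem rec_unique (F G : ℕ → S) (hF : ∀ r, 1 ≤ r → F r = X ^ (r + 1) * (P - F (r + 3)))
    (hG : ∀ r, 1 ≤ r → G r = X ^ (r + 1) * (P - G (r + 3))) (r : ℕ) (hr : 1 ≤ r) : F r = G r := by
  have key : ∀ M r : ℕ, 1 ≤ r → (X : S) ^ M ∣ F r - G r := by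
    intro M
    induction M with
    | zero => intro r _; simp
    | succ M ih =>
      intro r hr
      rw [hF r hr, hG r hr]
      have : X ^ (r + 1) * (P - F (r + 3)) - X ^ (r + 1) * (P - G (r + 3)) =
          - (X ^ r * (X * (F (r + 3) - G (r + 3)))) := by ring
      rw [this, dvd_neg, pow_succ']
      exact (mul_dvd_mul_left X (ih (r + 3) (by omega))).mul_left _
  exact eq_of_forall_dvd fun M => key M r hr

/-- the partial theta type sums -/
noncomputable def Lam (r : ℕ) : S :=
  psum fun j => (-1) ^ j * X ^ (3 * tri j + j + 1 + r * (j + 1))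

theorem tri_succ (j : ℕ) : tri (j + 1) = tri j + j + 1 := by
  have h1 := two_tri (j + 1)
  have h2 := two_tri j
  nlinarith

theorem sm_Lam (r : ℕ) : Sm (fun j => (-1) ^ j * (X : S) ^ (3 * tri j + j + 1 + r * (j + 1))) :=
  fun j => (pow_dvd_pow X (by omega)).mul_left _

theorem Lam_rec (r : ℕ) : P * Lam r = X ^ (r + 1) * (P - P * Lam (r + 3)) := by
  have h1 : Lam r = X ^ (r + 1) - X ^ (r + 1) * Lam (r + 3) := by
    rw [Lam, psum_shift (sm_Lam r) 1, Lam, sub_eq_add_neg, ← neg_mul, ← psum_mul_left (sm_Lam _)]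
    congr 1
    · simp [tri, add_comm]
    · congr 1
      funext j
      rw [tri_succ, pow_succ]
      have : 3 * (tri j + j + 1) + (j + 1) + 1 + r * (j + 1 + 1) =
          (r + 1) + (3 * tri j + j + 1 + (r + 3) * (j + 1)) := by ring
      rw [this, pow_add X (r + 1)]
      ring
  linear_combination P * h1

theorem Ar_eq (r : ℕ) (hr : 1 ≤ r) : Ar r = P * Lam r :=
  rec_unique Ar (fun r => P * Lam r) Ar_rec (fun r _ => Lam_rec r) r hr

theorem Br_eq (r : ℕ) (hr : 1 ≤ r) : Br r = P * Lam r :=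
  rec_unique Br (fun r => P * Lam r) Br_rec (fun r _ => Lam_rec r) r hr
end RC
end

section
namespace RC
open PowerSeries Finset

/-! ### weighted rank generating functions -/

/-- weighted rank generating function -/
noncomputable def rankGF (c : ℤ → ℂ) : S :=
  PowerSeries.mk fun n => ∑ p : n.Partition, c (partitionRank p)

theorem tel_ind (d : ℕ → ℂ) (t N : ℕ) (h : t ≤ N) :
    ∑ m ∈ range N, (d (m + 1) - d m) * (if m + 1 ≤ t then 1 else 0) = d t - d 0 := by
  obtain ⟨k, rfl⟩ := Nat.exists_eq_add_of_le h
  rw [sum_range_add, sum_eq_zero (s := range k), add_zero, ← sum_range_sub]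
  · apply sum_congr rfl
    intro m hm
    rw [mem_range] at hm
    rw [if_pos (by omega), mul_one]
  · intro m _
    rw [if_neg (by omega), mul_zero]

theorem rank_pointwise (c : ℤ → ℂ) (ρ : ℤ) (N : ℕ) (h1 : ρ ≤ N) (h2 : -(N : ℤ) ≤ ρ) :
    c ρ = c 0 + ∑ m ∈ range N, (c (m + 1 : ℕ) - c (m : ℕ)) * (if ((m + 1 : ℕ) : ℤ) ≤ ρ then 1 else 0) +
      ∑ m ∈ range N, (c (-(m + 1 : ℕ)) - c (-(m : ℕ))) * (if ρ ≤ -((m + 1 : ℕ) : ℤ) then 1 else 0) := by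
  have e1 := tel_ind (fun m => c (m : ℕ)) ρ.toNat N (by omega)
  have e2 := tel_ind (fun m => c (-(m : ℕ))) (-ρ).toNat N (by omega)
  have f1 : ∀ m : ℕ, ((((m + 1 : ℕ) : ℤ) ≤ ρ) ↔ m + 1 ≤ ρ.toNat) := fun m => by omega
  have f2 : ∀ m : ℕ, ((ρ ≤ -((m + 1 : ℕ) : ℤ)) ↔ m + 1 ≤ (-ρ).toNat) := fun m => by omega
  simp only [f1, f2]
  rw [e1, e2]
  rcases le_total 0 ρ with h | h
  · have a1 : ((ρ.toNat : ℕ) : ℤ) = ρ := by omega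
    have a2 : (-ρ).toNat = 0 := by omega
    rw [a1, a2]; simp
  · have a1 : (-(((-ρ).toNat : ℕ) : ℤ)) = ρ := by omega
    have a2 : ρ.toNat = 0 := by omega
    rw [a1, a2]; simp

theorem rankGF_eq (c : ℤ → ℂ) : rankGF c = C (c 0) * P +
    psum (fun m => C (c (m + 1 : ℕ) - c (m : ℕ)) * Ar (m + 1)) +
    psum (fun m => C (c (-(m + 1 : ℕ)) - c (-(m : ℕ))) * Br (m + 1)) := by
  have smA : Sm (fun m => C (c (m + 1 : ℕ) - c (m : ℕ)) * Ar (m + 1)) := fun m => by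
    beta_reduce
    rw [Ar_rec _ (by omega)]
    exact ((pow_dvd_pow X (by omega)).mul_right _).mul_left _
  have smB : Sm (fun m => C (c (-(m + 1 : ℕ)) - c (-(m : ℕ))) * Br (m + 1)) := fun m => by
    beta_reduce
    rw [Br_rec _ (by omega)]
    exact ((pow_dvd_pow X (by omega)).mul_right _).mul_left _
  ext n
  rw [map_add, map_add, coeff_psum smA (Nat.lt_succ_self n), coeff_psum smB (Nat.lt_succ_self n)]
  simp only [coeff_C_mul, rankGF, P, Ar, Br, coeff_mk]
  have hb : ∀ p : n.Partition, partitionRank p ≤ ((n + 1 : ℕ) : ℤ) ∧ -((n + 1 : ℕ) : ℤ) ≤ partitionRank p := by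
    intro p
    rcases Nat.eq_zero_or_pos n with h0 | h0
    · subst h0; rw [rank_zero]; omega
    · have := rank_bounds h0 p
      omega
  rw [sum_congr rfl fun p _ => rank_pointwise c (partitionRank p) (n + 1) (hb p).1 (hb p).2]
  rw [sum_add_distrib, sum_add_distrib]
  congr 1
  · congr 1
    · simp [mul_comm]
    · rw [sum_comm]
      apply sum_congr rfl
      intro m _
      rw [← mul_sum, sum_boole]
  · rw [sum_comm]
    apply sum_congr rfl
    intro m _
    rw [← mul_sum, sum_boole]

theorem rankGF_eq2 (c : ℤ → ℂ) (e : ℕ → ℂ)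
    (he : ∀ m : ℕ, e m = (c (m + 1 : ℕ) - c (m : ℕ)) + (c (-(m + 1 : ℕ)) - c (-(m : ℕ)))) :
    rankGF c = P * (C (c 0) + psum (fun j => ((-1) ^ j * X ^ (3 * tri j + j + 1)) *
      psum (fun m => C (e m) * (X ^ (j + 1)) ^ (m + 1)))) := by
  have smA : ∀ f : ℕ → ℂ, Sm (fun m => C (f m) * Lam (m + 1)) := fun f m => by
    apply Dvd.dvd.mul_left
    rw [Lam, X_pow_dvd_iff]
    intro k hk
    rw [coeff_psum (sm_Lam _) (Nat.lt_succ_self k)]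
    apply sum_eq_zero
    intro j _
    refine X_pow_dvd_iff.mp ?_ k hk
    exact (pow_dvd_pow X (by nlinarith)).mul_left _
  rw [rankGF_eq]
  have e1 : (fun m : ℕ => C (c (m + 1 : ℕ) - c (m : ℕ)) * Ar (m + 1)) =
      fun m => P * (C (c (m + 1 : ℕ) - c (m : ℕ)) * Lam (m + 1)) := by
    funext m; rw [Ar_eq _ (by omega)]; ring
  have e2 : (fun m : ℕ => C (c (-(m + 1 : ℕ)) - c (-(m : ℕ))) * Br (m + 1)) =
      fun m => P * (C (c (-(m + 1 : ℕ)) - c (-(m : ℕ))) * Lam (m + 1)) := by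
    funext m; rw [Br_eq _ (by omega)]; ring
  rw [e1, e2, psum_mul_left (smA fun m => c (m + 1 : ℕ) - c (m : ℕ)),
    psum_mul_left (smA fun m => c (-(m + 1 : ℕ)) - c (-(m : ℕ))), mul_comm (C (c 0)), ← mul_add,
    ← mul_add, add_assoc, ← psum_add (smA fun m => c (m + 1 : ℕ) - c (m : ℕ))
    (smA fun m => c (-(m + 1 : ℕ)) - c (-(m : ℕ)))]
  congr 2
  have e3 : (fun k : ℕ => C (c (k + 1 : ℕ) - c (k : ℕ)) * Lam (k + 1) +
      C (c (-(k + 1 : ℕ)) - c (-(k : ℕ))) * Lam (k + 1)) =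
      fun k => psum (fun j => C (e k) * ((-1) ^ j * X ^ (3 * tri j + j + 1 + (k + 1) * (j + 1)))) := by
    funext k
    rw [psum_mul_left (sm_Lam _), he k, map_add, add_mul, Lam]
  rw [e3, psum_comm]
  · congr 1
    funext j
    rw [← psum_mul_left]
    · congr 1
      funext m
      rw [← pow_mul, pow_add X _ ((m + 1) * (j + 1)), mul_comm (j + 1) (m + 1)]
      ring
    · intro m
      beta_reduce
      rw [← pow_mul]
      exact (pow_dvd_pow X (by nlinarith)).mul_left _
  · intro k m
    exact ((pow_dvd_pow X (by nlinarith)).mul_left _).mul_left _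
  · intro k m
    exact ((pow_dvd_pow X (by nlinarith)).mul_left _).mul_left _

theorem sm_x (e : ℕ → ℂ) (j : ℕ) : Sm (fun m => C (e m) * ((X : S) ^ (j + 1)) ^ (m + 1)) := by
  intro m
  beta_reduce
  rw [← pow_mul]
  exact (pow_dvd_pow X (by nlinarith)).mul_left _

theorem periodic_sum (e : ℕ → ℂ) (he : ∀ m, e (m + 8) = e m) (j : ℕ) :
    (1 - (X ^ (j + 1)) ^ 8) * psum (fun m => C (e m) * ((X : S) ^ (j + 1)) ^ (m + 1)) =
      ∑ m ∈ range 8, C (e m) * ((X : S) ^ (j + 1)) ^ (m + 1) := by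
  have h1 := psum_shift (sm_x e j) 8
  have h2 : (fun k => C (e (k + 8)) * ((X : S) ^ (j + 1)) ^ (k + 8 + 1)) =
      fun k => (X ^ (j + 1)) ^ 8 * (C (e k) * ((X : S) ^ (j + 1)) ^ (k + 1)) := by
    funext k
    rw [he]; ring
  rw [h2, psum_mul_left (sm_x e j)] at h1
  linear_combination h1

/-- Lambert term of `S1` -/
noncomputable def LL (w : ℂ) (j : ℕ) : S :=
  C w⁻¹ * X ^ (j + 1) * (1 - C w⁻¹ * X ^ (2 * j + 2))⁻¹ -
    X ^ (2 * j + 2) * (1 - C w * X ^ (2 * j + 2))⁻¹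

theorem S1_eq (w : ℂ) : S1 w = C (1 - w)⁻¹ +
    psum (fun j => ((-1) ^ j * X ^ (3 * tri j + j + 1)) * LL w j) := by
  rw [S1, psum_shift (sm_S1a w) 1, add_assoc, ← psum_add ((sm_S1a w).shift 1) (sm_S1b w)]
  congr 1
  · have : (1 - C w : S) = C (1 - w) := by simp
    simp only [range_one, sum_singleton, S1a, tri, mul_zero, pow_zero, mul_one]
    rw [this, C_inv]
  · congr 1
    funext j
    simp only [S1a, S1b, LL]
    rw [tri_succ, pow_succ (-1), show 2 * (j + 1) = 2 * j + 2 by ring]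
    rw [show 3 * (tri j + j + 1) = (3 * tri j + j + 1) + (2 * j + 2) by ring]
    rw [pow_add X (3 * tri j + j + 1)]
    rw [show (X : S) ^ (3 * tri j + j + 1) = X ^ (3 * tri j) * X ^ (j + 1) by rw [← pow_add]; ring_nf]
    ring

theorem rankGF_per (c : ℤ → ℂ) (hc : ∀ r, c (r + 8) = c r) (E : ℕ → S)
    (hE : ∀ j : ℕ, (1 - (X ^ (j + 1)) ^ 8) * E j = ∑ m ∈ range 8,
      C ((c (m + 1 : ℕ) - c (m : ℕ)) + (c (-(m + 1 : ℕ)) - c (-(m : ℕ)))) *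
        ((X : S) ^ (j + 1)) ^ (m + 1)) :
    rankGF c = P * (C (c 0) + psum (fun j => ((-1) ^ j * X ^ (3 * tri j + j + 1)) * E j)) := by
  rw [rankGF_eq2 c _ fun m => rfl]
  congr 3
  congr 1
  funext j
  congr 1
  have hne : (1 - (X ^ (j + 1)) ^ 8 : S) ≠ 0 := by
    intro h
    have := congrArg constantCoeff h
    simp at this
  apply mul_left_cancel₀ hne
  rw [hE j]
  apply periodic_sum
  intro m
  have h1 : c ((m + 8 + 1 : ℕ)) = c (m + 1 : ℕ) := by
    rw [← hc (m + 1 : ℕ)]; congr 1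
  have h2 : c ((m + 8 : ℕ)) = c (m : ℕ) := by
    rw [← hc (m : ℕ)]; rfl
  have h3 : c (-(m + 8 + 1 : ℕ)) = c (-(m + 1 : ℕ)) := by
    have : (-(m + 8 + 1 : ℕ) : ℤ) + 8 = -(m + 1 : ℕ) := by push_cast; ring
    rw [← hc (-(m + 8 + 1 : ℕ)), this]
  have h4 : c (-(m + 8 : ℕ)) = c (-(m : ℕ)) := by
    have : (-(m + 8 : ℕ) : ℤ) + 8 = -(m : ℕ) := by push_cast; ring
    rw [← hc (-(m + 8 : ℕ)), this]
  rw [h1, h2, h3, h4]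

/-- weight for the rank difference `N0+N1-N2-N3` -/
noncomputable def cC (r : ℤ) : ℂ :=
  if r % 8 = 0 ∨ r % 8 = 1 then 1 else if r % 8 = 2 ∨ r % 8 = 3 then -1 else 0

/-- weight for the rank difference `N0-N4` -/
noncomputable def cI (r : ℤ) : ℂ := if r % 8 = 0 then 1 else if r % 8 = 4 then -1 else 0

theorem sm_LL (w : ℂ) : Sm (fun j => ((-1) ^ j * X ^ (3 * tri j + j + 1)) * LL w j) := fun j =>
  ((pow_dvd_pow X (by omega)).mul_left _).mul_right _

theorem LL_inv (w : ℂ) (j : ℕ) : (1 - C w * X ^ (2 * j + 2) : S)⁻¹ *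
    (1 - C w * (X ^ (j + 1)) ^ 2) = 1 := by
  rw [← pow_mul, show (j + 1) * 2 = 2 * j + 2 by ring]
  exact PowerSeries.inv_mul_cancel _ (const_one_sub _ _ (by omega))

theorem CI_sq : (C Complex.I : S) ^ 2 = -1 := by
  rw [← map_pow, Complex.I_sq]; simp

theorem invI1 : (1 - Complex.I)⁻¹ = (1 + Complex.I) / 2 := by
  apply inv_eq_of_mul_eq_one_right
  linear_combination (-1 / 2) * Complex.I_sq

theorem invI2 : (1 - -Complex.I)⁻¹ = (1 - Complex.I) / 2 := by
  apply inv_eq_of_mul_eq_one_right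
  linear_combination (-1 / 2) * Complex.I_sq

theorem gfC_eq : rankGF cC =
    P * (S1 (-1) + C (1 / 2) * (S1 Complex.I + S1 (-Complex.I))) := by
  rw [rankGF_per cC (fun r => by simp [cC]) (fun j => LL (-1) j + C (1 / 2) * (LL Complex.I j + LL (-Complex.I) j))]
  · rw [S1_eq, S1_eq, S1_eq]
    congr 1
    have s := sm_LL
    have h := psum_add (s (-1)) (((s Complex.I).add (s (-Complex.I))).mul_left (fun _ => C (1 / 2)))
    rw [psum_mul_left ((s Complex.I).add (s (-Complex.I))), psum_add (s Complex.I) (s (-Complex.I))] at h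
    have e : (fun j => ((-1) ^ j * X ^ (3 * tri j + j + 1)) *
        (LL (-1) j + C (1 / 2) * (LL Complex.I j + LL (-Complex.I) j))) =
        fun k => (-1) ^ k * X ^ (3 * tri k + k + 1) * LL (-1) k +
          C (1 / 2) * ((-1) ^ k * X ^ (3 * tri k + k + 1) * LL Complex.I k +
            (-1) ^ k * X ^ (3 * tri k + k + 1) * LL (-Complex.I) k) := by
      funext k; ring
    rw [e, h]
    have k0 : (C (cC 0) : S) = C (1 - -1)⁻¹ + C (1 / 2) * (C (1 - Complex.I)⁻¹ + C (1 - -Complex.I)⁻¹) := by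
      rw [← map_add, ← map_mul, ← map_add]
      congr 1
      rw [invI1, invI2]
      norm_num [cC]
      ring
    rw [k0]
    ring
  · intro j
    have q1 := LL_inv (-1) j
    have q2 := LL_inv Complex.I j
    have q3 := LL_inv (-Complex.I) j
    have q4 := CI_sq
    simp only [LL, sum_range_succ, range_zero, sum_empty]
    have hx : (X : S) ^ (2 * j + 2) = (X ^ (j + 1)) ^ 2 := by rw [← pow_mul]; ring_nf
    have m1 : (-1 : ℂ)⁻¹ = -1 := by norm_num
    have m2 : Complex.I⁻¹ = -Complex.I := Complex.inv_I
    have m3 : (-Complex.I)⁻¹ = Complex.I := by rw [inv_neg, Complex.inv_I, neg_neg]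
    rw [m1, m2, m3]
    rw [hx] at q1 q2 q3 ⊢
    have half : (C (1 / 2) : S) * 2 = 1 := by
      rw [show (2 : S) = C 2 from (map_ofNat C 2).symm, ← map_mul]; norm_num
    generalize (X : S) ^ (j + 1) = x at *
    generalize (1 - C (-1) * x ^ 2 : S)⁻¹ = a at *
    generalize (1 - C Complex.I * x ^ 2 : S)⁻¹ = b at *
    generalize (1 - C (-Complex.I) * x ^ 2 : S)⁻¹ = d at *
    generalize (C (1 / 2) : S) = h at *
    simp only [map_neg, map_one] at *
    norm_num [cC]
    generalize (C Complex.I : S) = I at *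
    rw [show (C 2 : S) = 2 from map_ofNat C 2]
    have A : (1 - x ^ 8) * a = (1 - x ^ 2) * (1 + x ^ 4) := by
      linear_combination (1 - x ^ 2) * (1 + x ^ 4) * q1
    have B : (1 - x ^ 8) * b = (1 - x ^ 4) * (1 + I * x ^ 2) := by
      linear_combination (1 - x ^ 4) * (1 + I * x ^ 2) * q2 + (1 - x ^ 4) * b * x ^ 4 * q4
    have D : (1 - x ^ 8) * d = (1 - x ^ 4) * (1 - I * x ^ 2) := by
      linear_combination (1 - x ^ 4) * (1 - I * x ^ 2) * q3 + (1 - x ^ 4) * d * x ^ 4 * q4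
    linear_combination -(x + x ^ 2) * A + h * (I * x - x ^ 2) * B + h * (- I * x - x ^ 2) * D +
      2 * h * (1 - x ^ 4) * x ^ 3 * q4 + (1 - x ^ 4) * (- x ^ 3 - x ^ 2) * half

theorem gfI_eq : rankGF cI = P * (C (-Complex.I) * (S1 Complex.I - S1 (-Complex.I))) := by
  rw [rankGF_per cI (fun r => by simp [cI]) (fun j => C (-Complex.I) * (LL Complex.I j - LL (-Complex.I) j))]
  · rw [S1_eq, S1_eq]
    congr 1
    have s := sm_LL
    have h := psum_mul_left ((s Complex.I).sub (s (-Complex.I))) (C (-Complex.I))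
    rw [psum_sub (s Complex.I) (s (-Complex.I))] at h
    have e : (fun j => ((-1) ^ j * X ^ (3 * tri j + j + 1)) *
        (C (-Complex.I) * (LL Complex.I j - LL (-Complex.I) j))) =
        fun k => C (-Complex.I) * ((-1) ^ k * X ^ (3 * tri k + k + 1) * LL Complex.I k -
            (-1) ^ k * X ^ (3 * tri k + k + 1) * LL (-Complex.I) k) := by
      funext k; ring
    rw [e, h]
    have k0 : (C (cI 0) : S) = C (-Complex.I) * (C (1 - Complex.I)⁻¹ - C (1 - -Complex.I)⁻¹) := by
      rw [← map_sub, ← map_mul]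
      congr 1
      rw [invI1, invI2]
      norm_num [cI]
      linear_combination Complex.I_sq
    rw [k0]
    ring
  · intro j
    have q2 := LL_inv Complex.I j
    have q3 := LL_inv (-Complex.I) j
    have q4 := CI_sq
    simp only [LL, sum_range_succ, range_zero, sum_empty]
    have hx : (X : S) ^ (2 * j + 2) = (X ^ (j + 1)) ^ 2 := by rw [← pow_mul]; ring_nf
    have m2 : Complex.I⁻¹ = -Complex.I := Complex.inv_I
    have m3 : (-Complex.I)⁻¹ = Complex.I := by rw [inv_neg, Complex.inv_I, neg_neg]
    rw [m2, m3]
    rw [hx] at q2 q3 ⊢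
    generalize (X : S) ^ (j + 1) = x at *
    generalize (1 - C Complex.I * x ^ 2 : S)⁻¹ = b at *
    generalize (1 - C (-Complex.I) * x ^ 2 : S)⁻¹ = d at *
    simp only [map_neg] at *
    norm_num [cI]
    generalize (C Complex.I : S) = I at *
    try rw [show (C 2 : S) = 2 from map_ofNat C 2]
    have B : (1 - x ^ 8) * b = (1 - x ^ 4) * (1 + I * x ^ 2) := by
      linear_combination (1 - x ^ 4) * (1 + I * x ^ 2) * q2 + (1 - x ^ 4) * b * x ^ 4 * q4
    have D : (1 - x ^ 8) * d = (1 - x ^ 4) * (1 - I * x ^ 2) := by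
      linear_combination (1 - x ^ 4) * (1 - I * x ^ 2) * q3 + (1 - x ^ 4) * d * x ^ 4 * q4
    linear_combination (I ^ 2 * x + I * x ^ 2) * B + (I ^ 2 * x - I * x ^ 2) * D +
      2 * (1 - x ^ 4) * (x + x ^ 4) * q4
end RC
end

section
namespace RC
open PowerSeries Finset

/-! ### product identities -/

theorem jid : Pinf 1 1 1 * Pinf (-1) 1 2 * Pinf 1 4 4 = Pinf 1 2 2 * Pinf 1 2 2 := by
  have a1 := Pinf_split 1 1 1 (by norm_num)
  have a2 := Pinf_sq 1 1 2 (by norm_num)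
  have a3 := Pinf_split 1 2 2 (by norm_num)
  norm_num at a1 a2 a3
  rw [a1]
  linear_combination Pinf 1 2 2 * Pinf 1 4 4 * a2 - Pinf 1 2 2 * a3

theorem aeb : Pinf 1 1 2 * Pinf (-1) 1 2 * Pinf (-1) 2 2 = 1 := by
  have a2 := Pinf_sq 1 1 2 (by norm_num)
  have a3 := Pinf_split 1 2 2 (by norm_num)
  have a4 := Pinf_sq 1 2 2 (by norm_num)
  norm_num at a2 a3 a4
  apply mul_left_cancel₀ (Pinf_ne 1 4 4 (by norm_num) (by norm_num))
  linear_combination Pinf 1 4 4 * Pinf (-1) 2 2 * a2 - Pinf (-1) 2 2 * a3 + a4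

theorem j1split : Pinf 1 1 1 = Pinf 1 1 2 * Pinf 1 2 2 := by
  have a1 := Pinf_split 1 1 1 (by norm_num)
  norm_num at a1
  exact a1

/-- the main product term -/
noncomputable def Th (w : ℂ) : S :=
  P * (Pinf 1 2 2 * Pinf 1 2 2 * Pinf (-1) 1 2) * (T w)⁻¹

theorem PS1 (w : ℂ) (hw4 : w ^ 4 = 1) (hw : w ≠ 1) :
    P * S1 w = Th w - X * ((Pinf 1 4 4)⁻¹ * S2 w) := by
  have h := ident_D w hw4 hw
  unfold Th
  rw [h]
  have i1 := PowerSeries.mul_inv_cancel (Pinf 1 2 2 * Pinf 1 2 2 * Pinf (-1) 1 2) (by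
    simp [const_Pinf])
  have i2 : P * (Pinf 1 2 2 * Pinf 1 2 2 * Pinf (-1) 1 2) *
      (Pinf 1 4 4 * Pinf 1 4 4 * (Pinf (-1) 1 2 * Pinf (-1) 1 2))⁻¹ = (Pinf 1 4 4)⁻¹ := by
    have i3 := PowerSeries.mul_inv_cancel (Pinf 1 4 4 * Pinf 1 4 4 * (Pinf (-1) 1 2 * Pinf (-1) 1 2))
      (by simp [const_Pinf])
    have i4 : Pinf 1 1 1 * P = 1 := by
      rw [P_eq]; exact PowerSeries.mul_inv_cancel _ (by simp [const_Pinf])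
    have i5 := PowerSeries.mul_inv_cancel (Pinf 1 4 4) (by simp [const_Pinf])
    have j := jid
    apply mul_left_cancel₀ (Pinf_ne 1 4 4 (by norm_num) (by norm_num))
    rw [i5, ← j]
    linear_combination (Pinf 1 4 4 * Pinf (-1) 1 2 * Pinf 1 4 4 * Pinf (-1) 1 2 *
      (Pinf 1 4 4 * Pinf 1 4 4 * (Pinf (-1) 1 2 * Pinf (-1) 1 2))⁻¹) * i4 + i3
  linear_combination (-P * S1 w) * i1 - (X * S2 w) * i2

/-- theta three -/
noncomputable def th3 : S := Pinf 1 2 2 * (Pinf (-1) 1 2 * Pinf (-1) 1 2)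

theorem Th_m1 : Th (-1) = C (1 / 2) * th3 * Pinf (-1) 1 2 := by
  have hT : T (-1) = C 2 * (Pinf (-1) 2 2 * Pinf (-1) 2 2 * Pinf 1 1 2) := by
    have a1 := Pinf_step (-1) 0 2 (by norm_num)
    have a2 := Pinf_split 1 1 2 (by norm_num)
    norm_num at a1 a2
    unfold T
    norm_num
    rw [a1, a2]
    have : (C (2:ℂ) : S) = 1 + 1 := by rw [← map_one C, ← map_add]; norm_num
    try rw [this]
    ring
  have i := PowerSeries.mul_inv_cancel (T (-1)) (const_T _ (by norm_num))
  have i4 : Pinf 1 1 1 * P = 1 := by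
    rw [P_eq]; exact PowerSeries.mul_inv_cancel _ (by simp [const_Pinf])
  have hc : (C 2 : S) * C (1 / 2) = 1 := by rw [← map_mul]; norm_num
  have h := aeb
  rw [j1split] at i4
  unfold Th th3
  set t := (T (-1))⁻¹
  rw [hT] at i
  set A := Pinf 1 1 2
  set B := Pinf (-1) 2 2
  set J := Pinf 1 2 2
  set e := Pinf (-1) 1 2
  have i' : B * B * A * t = C (1/2) := by linear_combination C (1/2) * i - B*B*A*t * hc
  have h2 : (A * e * B) * (A*e*B) = 1 := by rw [h, one_mul]
  linear_combination (-(P * J * J * e * t)) * h2 + P*J*J*e*e*e*A * i' + J*e*e*e*C (1/2) * i4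

theorem Th_i (i : ℂ) (hi : i ^ 2 = -1) :
    Th i = C ((1 + i) / 2) * th3 * rescale (-i) (Pinf (-1) 1 2) := by
  have hii : i * i = -1 := by rw [← sq, hi]
  have hi0 : i ≠ 0 := by rintro rfl; norm_num at hi
  have hinv : i⁻¹ = -i := by
    apply inv_eq_of_mul_eq_one_right; linear_combination -hii
  have hi1 : i ≠ 1 := by rintro rfl; norm_num at hi
  have r : ∀ a : ℂ, a ^ 2 = -1 → rescale a (Pinf (-1) 1 2) = Pinf (-a) 1 4 * Pinf a 3 4 := by
    intro a ha
    have a1 := Pinf_split (-1) 1 2 (by norm_num)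
    norm_num at a1
    have h4 : a ^ 4 = 1 := by linear_combination (a^2 - 1) * ha
    have h3 : a ^ 3 = -a := by linear_combination a * ha
    rw [a1, map_mul, rescale_Pinf _ _ _ _ (by norm_num) h4, rescale_Pinf _ _ _ _ (by norm_num) h4, h3]
    norm_num
  have r1 := r (-i) (by linear_combination hi)
  rw [neg_neg] at r1
  have hT : T i = C (1 - i) * (Pinf (-1) 4 4 * (Pinf (-i) 1 4 * Pinf i 3 4)) := by
    have a1 := Pinf_step i 0 2 (by norm_num)
    have a2 := Pinf_sq i 2 2 (by norm_num)
    norm_num [hi] at a1 a2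
    unfold T
    rw [hinv, neg_neg, a1, ← a2]
    simp only [map_sub, map_one]
    ring
  have hp : Pinf (-1) 4 4 * ((Pinf (-i) 1 4 * Pinf i 3 4) * (Pinf i 1 4 * Pinf (-i) 3 4)) = Pinf (-1) 2 2 := by
    have a1 := Pinf_sq i 1 4 (by norm_num)
    have a2 := Pinf_sq i 3 4 (by norm_num)
    have a3 := Pinf_split (-1) 2 4 (by norm_num)
    have a4 := Pinf_split (-1) 2 2 (by norm_num)
    norm_num [hi] at a1 a2 a3 a4
    rw [a4, a3, ← a1, ← a2]
    ring
  have it := PowerSeries.mul_inv_cancel (T i) (const_T _ hi1)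
  have i4 : Pinf 1 1 1 * P = 1 := by
    rw [P_eq]; exact PowerSeries.mul_inv_cancel _ (by simp [const_Pinf])
  have hc : (C (1 - i) : S) * C ((1 + i) / 2) = 1 := by
    rw [← map_mul, ← map_one C]; congr 1; linear_combination (-1/2) * hi
  have h := aeb
  rw [j1split] at i4
  rw [r1]
  unfold Th th3
  set t := (T i)⁻¹
  rw [hT] at it
  rw [← hp] at h
  set A := Pinf 1 1 2
  set J := Pinf 1 2 2
  set e := Pinf (-1) 1 2
  set D := Pinf (-1) 4 4
  set U := Pinf (-i) 1 4 * Pinf i 3 4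
  set V := Pinf i 1 4 * Pinf (-i) 3 4
  have i' : D * U * t = C ((1+i)/2) := by linear_combination C ((1+i)/2) * it - D*U*t * hc
  linear_combination (-(P * J * J * e * t)) * h + P*J*J*e*e*A*V * i' + J*e*e*V*C ((1+i)/2) * i4

end RC
end

section
namespace RC
open PowerSeries Finset

/-! ### supports modulo four -/

theorem I_pow_mod (n : ℕ) : Complex.I ^ n = Complex.I ^ (n % 4) := by
  conv_lhs => rw [← Nat.div_add_mod n 4, pow_add, pow_mul, Complex.I_pow_four, one_pow, one_mul]

theorem negI_pow_mod (n : ℕ) : (-Complex.I) ^ n = (-Complex.I) ^ (n % 4) := by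
  have h : (-Complex.I) ^ 4 = 1 := by
    rw [neg_pow, Complex.I_pow_four]; norm_num
  conv_lhs => rw [← Nat.div_add_mod n 4, pow_add, pow_mul, h, one_pow, one_mul]

theorem neg_one_pow_mod (n : ℕ) : (-1 : ℂ) ^ n = (-1) ^ (n % 4) := by
  have h : (-1 : ℂ) ^ 4 = 1 := by norm_num
  conv_lhs => rw [← Nat.div_add_mod n 4, pow_add, pow_mul, h, one_pow, one_mul]

theorem I_cube : Complex.I ^ 3 = -Complex.I := by
  linear_combination Complex.I * Complex.I_sq

theorem sup4 {f : S} (h : rescale Complex.I f = f) (n : ℕ) (hn : n % 4 ≠ 0) : coeff n f = 0 := by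
  have h1 := congrArg (coeff n) h
  rw [coeff_rescale] at h1
  have h2 : (Complex.I ^ n - 1) * coeff n f = 0 := by linear_combination h1
  rcases mul_eq_zero.mp h2 with h3 | h3
  · exfalso
    rw [I_pow_mod] at h3
    have : n % 4 < 4 := Nat.mod_lt _ (by norm_num)
    interval_cases n % 4
    · exact hn rfl
    · have := congrArg Complex.re h3; norm_num at this
    · rw [Complex.I_sq] at h3; norm_num at h3
    · rw [I_cube] at h3
      have := congrArg Complex.re h3; norm_num at this
  · exact h3

theorem coeff_mul_sup4 {f : S} (h : rescale Complex.I f = f) (g : S) (n : ℕ)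
    (hg : ∀ m, m % 4 = n % 4 → coeff m g = 0) : coeff n (f * g) = 0 := by
  rw [coeff_mul]
  apply sum_eq_zero
  rintro ⟨a, b⟩ hab
  rw [HasAntidiagonal.mem_antidiagonal] at hab
  dsimp only at hab ⊢
  by_cases ha : a % 4 = 0
  · rw [hg b (by omega), mul_zero]
  · rw [sup4 h a ha, zero_mul]

theorem rescale_inv (a : ℂ) (f : S) (hf : constantCoeff f ≠ 0) : rescale a f⁻¹ = (rescale a f)⁻¹ := by
  have h : constantCoeff (rescale a f) ≠ 0 := by
    rw [← coeff_zero_eq_constantCoeff_apply, coeff_rescale]; simpa using hf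
  rw [PowerSeries.eq_inv_iff_mul_eq_one h, ← map_mul, PowerSeries.inv_mul_cancel _ hf, map_one]

theorem rescale_inv44 (c : ℂ) : rescale Complex.I (Pinf c 4 4)⁻¹ = (Pinf c 4 4)⁻¹ := by
  rw [rescale_inv _ _ (const_Pinf_ne _ _ _ (by norm_num) (by norm_num)),
    rescale_Pinf _ _ _ _ (by norm_num) Complex.I_pow_four, Complex.I_pow_four, mul_one]

theorem rescale_psum (a : ℂ) {g : ℕ → S} (hg : Sm g) :
    rescale a (psum g) = psum (fun k => rescale a (g k)) := by
  have h : Sm (fun k => rescale a (g k)) := fun k => by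
    have := hg k
    rw [X_pow_dvd_iff] at this ⊢
    intro m hm
    rw [coeff_rescale, this m hm, mul_zero]
  symm
  apply psum_eq h
  have := (psum_conv hg).rescale a
  simpa only [map_sum] using this

theorem S2_rescale (w : ℂ) (hw : w ^ 4 = 1) : S2 w = rescale (-w) (S2 (-1)) := by
  have hw0 : w ≠ 0 := by rintro rfl; norm_num at hw
  have hinv : w⁻¹ = w ^ 3 := by
    apply inv_eq_of_mul_eq_one_right; linear_combination hw
  have h4 : (-w) ^ 4 = 1 := by linear_combination hw
  have rx : ∀ n : ℕ, rescale (-w) ((-1) ^ n * X ^ (12 * tri n) : S) = (-1) ^ n * X ^ (12 * tri n) := by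
    intro n
    have := rescale_CX (-w) ((-1) ^ n) (12 * tri n)
    rw [show 12 * tri n = 4 * (3 * tri n) by ring, pow_mul (-w), h4, one_pow, mul_one] at this
    rw [show 12 * tri n = 4 * (3 * tri n) by ring]
    simpa using this
  have r1 : ∀ n : ℕ, rescale (-w) (C (-1) * X ^ (4 * n + 1) : S) = C w * X ^ (4 * n + 1) := by
    intro n
    rw [rescale_CX, pow_succ, pow_mul, h4, one_pow]; congr 2; ring
  have r3 : ∀ n : ℕ, rescale (-w) (C (-1) * X ^ (4 * n + 3) : S) = C (w⁻¹) * X ^ (4 * n + 3) := by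
    intro n
    rw [rescale_CX, pow_add, pow_mul, h4, one_pow, hinv]; congr 2; ring
  unfold S2
  rw [map_sub, rescale_psum _ (sm_S2a _), rescale_psum _ (sm_S2b _)]
  congr 2
  · funext n
    unfold S2a
    rw [map_mul, rx, rescale_inv _ _ (const_one_add _ _ (by omega)), map_add, map_one, r1]
  · funext n
    unfold S2b
    rw [show ((-1 : ℂ))⁻¹ = -1 by norm_num]
    rw [map_mul, rx, map_mul, rescale_inv _ _ (const_one_add _ _ (by omega)), map_add, map_one, r3]

theorem th3_sup (n : ℕ) (hn : 2 ≤ n % 4) : coeff n th3 = 0 := by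
  have hk : ∀ k, k + 1 * k ≤ 2 * tri k := fun k => by have := le_tri k; omega
  have h := jtp (-1) (by norm_num) 1 2 (by norm_num) (by norm_num) hk
  rw [show ((-1 : ℂ))⁻¹ = -1 by norm_num] at h
  norm_num only at h
  have sq4 : ∀ k : ℕ, k * k % 4 < 2 := by
    intro k
    have : k % 4 < 4 := Nat.mod_lt _ (by norm_num)
    rw [Nat.mul_mod]
    interval_cases k % 4 <;> norm_num
  unfold th3
  rw [h, map_sub, coeff_psum _ (Nat.lt_succ_self n), coeff_psum _ (Nat.lt_succ_self n),
    sum_eq_zero, sum_eq_zero, sub_zero]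
  · intro k _
    rw [← map_one C, ← map_neg, ← map_pow, ← mul_assoc, ← map_mul, coeff_C_mul, coeff_X_pow, if_neg, mul_zero]
    intro e
    have a := two_tri k
    have b := sq4 (k + 1)
    have : n = (k + 1) * (k + 1) := by rw [e, a]; ring
    omega
  · intro k _
    rw [← map_one C, ← map_neg, ← map_pow, ← mul_assoc, ← map_mul, coeff_C_mul, coeff_X_pow, if_neg, mul_zero]
    intro e
    have a := two_tri k
    have b := sq4 k
    have : n = k * k := by rw [e, a, mul_add]; omega
    omega
  · intro k
    exact ((pow_dvd_pow X (by have := le_tri k; omega)).mul_left _).mul_left _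
  · intro k
    exact ((pow_dvd_pow X (by have := le_tri k; omega)).mul_left _).mul_left _

theorem S2_vanish (f : S) (hf : ∀ m, m % 4 = 2 → coeff m f = 0) (n : ℕ) :
    coeff (4 * n + 3) (X * ((Pinf 1 4 4)⁻¹ * f)) = 0 := by
  rw [show 4 * n + 3 = (4 * n + 2) + 1 by ring, coeff_succ_X_mul]
  apply coeff_mul_sup4 (rescale_inv44 1)
  intro m hm
  apply hf
  omega

theorem hI4 : Complex.I ^ 4 = 1 := Complex.I_pow_four
theorem hnI4 : (-Complex.I) ^ 4 = 1 := by rw [neg_pow, Complex.I_pow_four]; norm_num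
theorem hnI2 : (-Complex.I) ^ 2 = -1 := by rw [neg_pow, Complex.I_sq]; norm_num
theorem hI1 : Complex.I ≠ 1 := by intro h; have := congrArg Complex.re h; norm_num at this
theorem hnI1 : -Complex.I ≠ 1 := by intro h; have := congrArg Complex.re h; norm_num at this

theorem rankC (n : ℕ) : coeff (4 * n + 3) (rankGF cC) = 0 := by
  have e : rankGF cC = th3 * (C (1 / 2) * (Pinf (-1) 1 2 +
      C ((1 + Complex.I) / 2) * rescale (-Complex.I) (Pinf (-1) 1 2) +
      C ((1 - Complex.I) / 2) * rescale Complex.I (Pinf (-1) 1 2))) -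
      X * ((Pinf 1 4 4)⁻¹ * (S2 (-1) + C (1 / 2) * (S2 Complex.I + S2 (-Complex.I)))) := by
    have h1 := PS1 (-1) (by norm_num) (by norm_num)
    have h2 := PS1 _ hI4 hI1
    have h3 := PS1 _ hnI4 hnI1
    rw [Th_m1] at h1
    rw [Th_i _ Complex.I_sq] at h2
    rw [Th_i _ hnI2, neg_neg, ← sub_eq_add_neg] at h3
    rw [gfC_eq]
    linear_combination h1 + C (1 / 2) * h2 + C (1 / 2) * h3
  rw [e, map_sub, S2_vanish, sub_zero, coeff_mul]
  · apply sum_eq_zero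
    rintro ⟨a, b⟩ hab
    rw [HasAntidiagonal.mem_antidiagonal] at hab
    dsimp only at hab ⊢
    by_cases ha : 2 ≤ a % 4
    · rw [th3_sup a ha, zero_mul]
    · have hb : b % 4 = 2 ∨ b % 4 = 3 := by omega
      simp only [coeff_C_mul, map_add, coeff_rescale]
      rw [I_pow_mod, negI_pow_mod]
      rcases hb with hb | hb <;> rw [hb]
      · rw [hnI2, Complex.I_sq]; ring
      · rw [neg_pow, I_cube]
        linear_combination (coeff a th3 * coeff b (Pinf (-1) 1 2)) / 2 * Complex.I_sq
  · intro m hm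
    rw [S2_rescale _ hI4, S2_rescale _ hnI4]
    simp only [coeff_C_mul, map_add, coeff_rescale]
    rw [neg_neg, I_pow_mod, negI_pow_mod, hm, hnI2, Complex.I_sq]
    ring

theorem crank_I (n : ℕ) (hn : 2 ≤ n) : coeff n (crankGF Complex.I) =
    coeff n (rescale (-1) th3 * Pinf (-1) 1 2) := by
  rw [crank_gf _ Complex.I_ne_zero, Complex.inv_I]
  have h : Pinf 1 1 1 * ((Pinf Complex.I 1 1)⁻¹ * (Pinf (-Complex.I) 1 1)⁻¹) =
      rescale (-1) th3 * Pinf (-1) 1 2 := by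
    have a1 := Pinf_sq Complex.I 1 1 (by norm_num)
    rw [Complex.I_sq] at a1
    norm_num only at a1
    have i1 := PowerSeries.mul_inv_cancel (Pinf Complex.I 1 1) (const_Pinf_ne _ _ _ (by norm_num) (by norm_num))
    have i2 := PowerSeries.mul_inv_cancel (Pinf (-Complex.I) 1 1) (const_Pinf_ne _ _ _ (by norm_num) (by norm_num))
    have h := aeb
    unfold th3
    simp only [map_mul]
    rw [rescale_Pinf _ _ _ _ (by norm_num) (by norm_num), rescale_Pinf _ _ _ _ (by norm_num) (by norm_num), j1split]
    norm_num only
    set a := (Pinf Complex.I 1 1)⁻¹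
    set b := (Pinf (-Complex.I) 1 1)⁻¹
    rw [← a1] at h
    set A := Pinf 1 1 2
    set J := Pinf 1 2 2
    set e := Pinf (-1) 1 2
    linear_combination (- A * J * a * b) * h + A*J*A*e*(i1 * Pinf (-Complex.I) 1 1 * b + i2)
  rw [h]
  have e : (X - C Complex.I * X : S) = C (1 - Complex.I) * X := by rw [map_sub, map_one]; ring
  rw [e, map_add, coeff_C_mul, coeff_X, if_neg (by omega), mul_zero, zero_add]

theorem rankI (n : ℕ) : coeff (4 * n + 3) (rankGF cI) = coeff (4 * n + 3) (crankGF Complex.I) := by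
  have e : rankGF cI = th3 * (C (-Complex.I) * (
      C ((1 + Complex.I) / 2) * rescale (-Complex.I) (Pinf (-1) 1 2) -
      C ((1 - Complex.I) / 2) * rescale Complex.I (Pinf (-1) 1 2))) -
      X * ((Pinf 1 4 4)⁻¹ * (C (-Complex.I) * (S2 Complex.I - S2 (-Complex.I)))) := by
    have h2 := PS1 _ hI4 hI1
    have h3 := PS1 _ hnI4 hnI1
    rw [Th_i _ Complex.I_sq] at h2
    rw [Th_i _ hnI2, neg_neg, ← sub_eq_add_neg] at h3
    rw [gfI_eq]
    linear_combination C (-Complex.I) * h2 - C (-Complex.I) * h3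
  rw [crank_I _ (by omega), e, map_sub, S2_vanish, sub_zero, coeff_mul, coeff_mul]
  · apply sum_congr rfl
    rintro ⟨a, b⟩ hab
    rw [HasAntidiagonal.mem_antidiagonal] at hab
    dsimp only at hab ⊢
    rw [coeff_rescale]
    by_cases ha : 2 ≤ a % 4
    · rw [th3_sup a ha, zero_mul, mul_zero, zero_mul]
    · have hb : (a % 4 = 1 ∧ b % 4 = 2) ∨ (a % 4 = 0 ∧ b % 4 = 3) := by omega
      simp only [coeff_C_mul, map_sub, coeff_rescale]
      rw [I_pow_mod, negI_pow_mod, neg_one_pow_mod]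
      rcases hb with ⟨ha, hb⟩ | ⟨ha, hb⟩ <;> rw [ha, hb]
      · rw [hnI2, Complex.I_sq]
        linear_combination (coeff a th3 * coeff b (Pinf (-1) 1 2)) * Complex.I_sq
      · rw [neg_pow, I_cube]
        linear_combination (-coeff a th3 * coeff b (Pinf (-1) 1 2)) * Complex.I_sq
  · intro m hm
    rw [S2_rescale _ hI4, S2_rescale _ hnI4]
    simp only [coeff_C_mul, map_sub, coeff_rescale]
    rw [neg_neg, I_pow_mod, negI_pow_mod, hm, hnI2, Complex.I_sq]
    ring

end RC
end

section
namespace RC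
open PowerSeries Finset

/-! ### cranks at primitive eighth roots of unity -/

/-- the universal series for the crank -/
noncomputable def Kc : S := psum (fun k => C ((-1) ^ k *
  (if k % 8 = 2 then 1 else if k % 8 = 5 then -1 else 0)) * X ^ tri k)

theorem tri_mod (k : ℕ) : tri k % 4 = 3 → k % 8 = 2 ∨ k % 8 = 5 := by
  intro h
  have a := two_tri k
  have b : 2 * tri k % 8 = 6 := by omega
  rw [a, Nat.mul_mod, Nat.add_mod] at b
  have : k % 8 < 8 := Nat.mod_lt _ (by norm_num)
  interval_cases k % 8 <;> simp_all

theorem crank_G (v : ℂ) (hv : v ^ 4 = -1) (n : ℕ) (hn : n % 4 = 3) :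
    coeff n (Pinf 1 1 1 * (Pinf v 1 1 * Pinf v⁻¹ 1 1)) = (1 + v + v⁻¹) * coeff n Kc := by
  have v0 : v ≠ 0 := by rintro rfl; norm_num at hv
  have v1 : 1 - v ≠ 0 := by
    intro h; have : v = 1 := by linear_combination -h
    rw [this] at hv; norm_num at hv
  have v8 : v ^ 8 = 1 := by linear_combination (v ^ 4 - 1) * hv
  have hinv : v⁻¹ = -v ^ 3 := by
    apply inv_eq_of_mul_eq_one_right; linear_combination -hv
  have h := jtp v v0 0 1 (by norm_num) (by norm_num) (fun k => by have := le_tri k; omega)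
  rw [Pinf_step v 0 1 (by norm_num)] at h
  norm_num only [Nat.zero_mul, Nat.one_mul, Nat.sub_zero, Nat.add_zero, pow_zero, mul_one, zero_add, one_mul, zero_mul] at h
  have h' := congrArg (coeff n) h
  have e : (Pinf 1 1 1 * ((1 - C v) * Pinf v 1 1 * Pinf v⁻¹ 1 1) : S) =
      C (1 - v) * (Pinf 1 1 1 * (Pinf v 1 1 * Pinf v⁻¹ 1 1)) := by
    rw [map_sub, map_one]; ring
  rw [e, coeff_C_mul, map_sub, coeff_psum _ (Nat.lt_succ_self n), coeff_psum _ (Nat.lt_succ_self n),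
    ← sum_sub_distrib] at h'
  · apply mul_left_cancel₀ v1
    rw [h', Kc, coeff_psum _ (Nat.lt_succ_self n), mul_sum, mul_sum]
    · apply sum_congr rfl
      intro k _
      have c1 : ∀ z : ℂ, coeff n ((-1) ^ k * (C z * X ^ tri k) : S) = (-1) ^ k * z * (if n = tri k then 1 else 0) := by
        intro z
        rw [← map_one C, ← map_neg, ← map_pow, ← mul_assoc, ← map_mul, coeff_C_mul, coeff_X_pow]
      rw [c1, c1, coeff_C_mul, coeff_X_pow]
      by_cases hk : n = tri k
      · rw [if_pos hk]
        have hm : ∀ x : ℂ, x ^ 8 = 1 → x ^ k = x ^ (k % 8) := fun x hx => by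
          conv_lhs => rw [← Nat.div_add_mod k 8, pow_add, pow_mul, hx, one_pow, one_mul]
        rw [pow_succ, hm v v8, hm v⁻¹ (by rw [inv_pow, v8, inv_one])]
        rcases tri_mod k (by omega) with h2 | h2 <;> rw [h2, hinv] <;> norm_num only [if_true, if_false]
        · have : (-v ^ 3) ^ 2 = - v ^ 2 := by linear_combination v ^ 2 * hv
          rw [this]
          generalize (-1 : ℂ) ^ k = s
          simp
          linear_combination s * (-1 : ℂ) * hv
        · have : (-v ^ 3) ^ 5 = v ^ 3 := by
            linear_combination (-v ^ 11 + v ^ 7 - v ^ 3) * hv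
          rw [this]
          generalize (-1 : ℂ) ^ k = s
          simp
          linear_combination s * (1 - v ^ 2) * hv
      · rw [if_neg hk]; ring
    · intro k
      exact (pow_dvd_pow X (le_tri k)).mul_left _
  · intro k
    exact ((pow_dvd_pow X (le_tri k)).mul_left _).mul_left _
  · intro k
    exact ((pow_dvd_pow X (le_tri k)).mul_left _).mul_left _

theorem crank_big (z : ℂ) (hz : z ≠ 0) (n : ℕ) (hn : 2 ≤ n) : coeff n (crankGF z) =
    coeff n (Pinf 1 1 1 * ((Pinf z 1 1)⁻¹ * (Pinf z⁻¹ 1 1)⁻¹)) := by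
  rw [crank_gf z hz]
  have e : (X - C z * X : S) = C (1 - z) * X := by rw [map_sub, map_one]; ring
  rw [e, map_add, coeff_C_mul, coeff_X, if_neg (by omega), mul_zero, zero_add]

theorem crank_symm (z : ℂ) (hz : z ≠ 0) (n : ℕ) (hn : 2 ≤ n) :
    coeff n (crankGF z⁻¹) = coeff n (crankGF z) := by
  rw [crank_big z hz n hn, crank_big _ (inv_ne_zero hz) n hn, inv_inv, mul_comm (Pinf z⁻¹ 1 1)⁻¹]

theorem crank_eight (u : ℂ) (hu : u ^ 4 = -1) (n : ℕ) (hn : n % 4 = 3) :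
    coeff n (crankGF u) = (1 - u - u⁻¹) * coeff n ((Pinf (-1) 4 4)⁻¹ * Kc) := by
  have u0 : u ≠ 0 := by rintro rfl; norm_num at hu
  rw [crank_big u u0 n (by omega)]
  have e : Pinf 1 1 1 * ((Pinf u 1 1)⁻¹ * (Pinf u⁻¹ 1 1)⁻¹) =
      (Pinf (-1) 4 4)⁻¹ * (Pinf 1 1 1 * (Pinf (-u) 1 1 * Pinf (-u)⁻¹ 1 1)) := by
    have a1 := Pinf_sq u 1 1 (by norm_num)
    have a2 := Pinf_sq u⁻¹ 1 1 (by norm_num)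
    have a3 := Pinf_sq (u ^ 2) 2 2 (by norm_num)
    have q : u⁻¹ ^ 2 = - u ^ 2 := by
      rw [inv_pow]; apply inv_eq_of_mul_eq_one_right; linear_combination -hu
    rw [q] at a2
    rw [← pow_mul, hu] at a3
    norm_num only at a1 a2 a3
    rw [inv_neg]
    have i1 := PowerSeries.mul_inv_cancel (Pinf u 1 1) (const_Pinf_ne _ _ _ (by norm_num) (by norm_num))
    have i2 := PowerSeries.mul_inv_cancel (Pinf u⁻¹ 1 1) (const_Pinf_ne _ _ _ (by norm_num) (by norm_num))
    have i3 := PowerSeries.mul_inv_cancel (Pinf (-1) 4 4) (const_Pinf_ne _ _ _ (by norm_num) (by norm_num))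
    have k : (Pinf u 1 1 * Pinf u⁻¹ 1 1) * (Pinf (-u) 1 1 * Pinf (-u⁻¹) 1 1) = Pinf (-1) 4 4 := by
      rw [← a3, ← a1, ← a2]; ring
    set d := (Pinf (-1) 4 4)⁻¹
    set x := Pinf u 1 1
    set y := Pinf u⁻¹ 1 1
    rw [← k] at i3
    set w := Pinf (-u) 1 1 * Pinf (-u⁻¹) 1 1
    linear_combination (-Pinf 1 1 1 * x⁻¹ * y⁻¹) * i3 + (Pinf 1 1 1 * w * d) * (i1 * y * y⁻¹ + i2)
  rw [e]
  have z : coeff n ((Pinf (-1) 4 4)⁻¹ * (Pinf 1 1 1 * (Pinf (-u) 1 1 * Pinf (-u)⁻¹ 1 1) -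
      C (1 - u - u⁻¹) * Kc)) = 0 := by
    apply coeff_mul_sup4 (rescale_inv44 _)
    intro m hm
    rw [map_sub, crank_G (-u) (by linear_combination hu) m (by omega), coeff_C_mul, inv_neg]
    ring
  rw [mul_sub, map_sub, mul_left_comm _ (C _) Kc, coeff_C_mul] at z
  linear_combination z

/-! ### counting -/

theorem sum_weights {ι : Type*} [Fintype ι] (r : ι → ℤ) (f : ℤ → ℂ) (hf : ∀ m, f m = f (m % 8)) :
    ∑ p, f (r p) = ∑ a ∈ range 8, f a * ((univ.filter (fun p => r p % 8 = a)).card : ℂ) := by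
  simp_rw [card_filter, Nat.cast_sum, mul_sum]
  rw [sum_comm]
  apply sum_congr rfl
  intro p _
  rw [hf]
  have h1 : 0 ≤ r p % 8 := by omega
  have h2 : r p % 8 < 8 := by omega
  generalize r p % 8 = t at *
  simp only [sum_range_succ, range_zero, sum_empty]
  interval_cases t <;> norm_num

theorem rank_weights (n : ℕ) (f : ℤ → ℂ) (hf : ∀ m, f m = f (m % 8)) :
    coeff n (rankGF f) = ∑ a ∈ range 8, f a * (rankCount a 8 n : ℂ) := by
  rw [rankGF, coeff_mk, sum_weights _ f hf]
  apply sum_congr rfl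
  intro a ha
  rw [mem_range] at ha
  rw [rankCount]
  have : (a : ℤ) % (8 : ℕ) = a := by omega
  rw [this]
  rfl

theorem crank_weights (n : ℕ) (f : ℤ → ℂ) (hf : ∀ m, f m = f (m % 8)) :
    ∑ p : n.Partition, f (partitionCrank p) = ∑ a ∈ range 8, f a * (crankCount a 8 n : ℂ) := by
  rw [sum_weights _ f hf]
  apply sum_congr rfl
  intro a ha
  rw [mem_range] at ha
  rw [crankCount]
  have : (a : ℤ) % (8 : ℕ) = a := by omega
  rw [this]
  rfl

theorem rankGF_odd (c : ℤ → ℂ) (hc : ∀ m, c (-m) = - c m) : rankGF c = 0 := by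
  have c0 : c 0 = 0 := by
    have := hc 0; simp only [neg_zero] at this
    linear_combination (1 / 2) * this
  rw [rankGF_eq2 c (fun _ => 0)]
  · rw [c0]
    have : psum (fun _ => (0 : S)) = 0 := psum_eq (fun k => dvd_zero _) (by simpa using Conv.const 0)
    simp [this]
  · intro m
    rw [hc, hc]; ring

theorem rank_count_symm (n a : ℕ) (ha : 1 ≤ a) (h : a ≤ 3) :
    (rankCount a 8 n : ℂ) = rankCount (8 - a : ℕ) 8 n := by
  have h1 := rank_weights n (fun m => if m % 8 = a then 1 else if m % 8 = (8 - a : ℕ) then -1 else 0)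
    (fun m => by simp)
  rw [rankGF_odd] at h1
  · simp only [sum_range_succ, range_zero, sum_empty] at h1
    interval_cases a <;> norm_num at h1 ⊢ <;> apply Nat.cast_injective (R := ℂ) <;>
      linear_combination -h1
  · intro m
    have e : (-m) % 8 = (8 - m % 8) % 8 := by omega
    rw [e]
    have h1 : 0 ≤ m % 8 := by omega
    have h2 : m % 8 < 8 := by omega
    generalize m % 8 = t at *
    interval_cases a <;> interval_cases t <;> norm_num

theorem root_sum (ω : ℂ) (hω : IsPrimitiveRoot ω 8) (t : ℤ) :
    ∑ j ∈ range 8, (ω ^ j) ^ t = if t % 8 = 0 then 8 else 0 := by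
  have e : ∀ j : ℕ, (ω ^ j) ^ t = (ω ^ t) ^ j := fun j => by
    rw [← zpow_natCast, ← zpow_natCast, ← zpow_mul, ← zpow_mul, mul_comm]
  simp_rw [e]
  have x8 : (ω ^ t) ^ 8 = 1 := by rw [← e, hω.pow_eq_one, one_zpow]
  split_ifs with h
  · have : ω ^ t = 1 := (hω.zpow_eq_one_iff_dvd t).mpr (by push_cast; omega)
    simp [this]
  · have : ω ^ t - 1 ≠ 0 := by
      rw [sub_ne_zero, Ne, hω.zpow_eq_one_iff_dvd t]; push_cast; omega
    apply mul_left_cancel₀ this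
    rw [mul_comm, geom_sum_mul, x8]; ring

theorem crank_count_symm (ω : ℂ) (hω : IsPrimitiveRoot ω 8) (n : ℕ) (hn : 2 ≤ n) (a : ℕ) (ha : 1 ≤ a) (h : a ≤ 3) :
    (crankCount a 8 n : ℂ) = crankCount (8 - a : ℕ) 8 n := by
  have ω0 : ω ≠ 0 := hω.ne_zero (by norm_num)
  have s : ∑ j ∈ range 8, (ω ^ j) ^ (a : ℤ) * coeff n (crankGF (ω ^ j)) =
      ∑ j ∈ range 8, (ω ^ j) ^ (a : ℤ) * coeff n (crankGF (ω ^ j)⁻¹) := by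
    apply sum_congr rfl
    intro j _
    rw [crank_symm _ (pow_ne_zero _ ω0) n hn]
  simp only [crankGF, coeff_mk, mul_sum] at s
  rw [sum_comm, sum_comm (s := range 8)] at s
  have e1 : ∀ p : n.Partition, ∑ j ∈ range 8, (ω ^ j) ^ (a : ℤ) * (ω ^ j) ^ partitionCrank p =
      (fun m : ℤ => if (a + m) % 8 = 0 then (8 : ℂ) else 0) (partitionCrank p) := fun p => by
    beta_reduce
    rw [← root_sum ω hω]
    apply sum_congr rfl
    intro j _
    rw [zpow_add₀ (pow_ne_zero _ ω0)]
  have e2 : ∀ p : n.Partition, ∑ j ∈ range 8, (ω ^ j) ^ (a : ℤ) * (ω ^ j)⁻¹ ^ partitionCrank p =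
      (fun m : ℤ => if (a - m) % 8 = 0 then (8 : ℂ) else 0) (partitionCrank p) := fun p => by
    beta_reduce
    rw [← root_sum ω hω]
    apply sum_congr rfl
    intro j _
    rw [sub_eq_add_neg, zpow_add₀ (pow_ne_zero _ ω0), inv_zpow, zpow_neg]
  simp_rw [e1, e2] at s
  rw [crank_weights n (fun m : ℤ => if (a + m) % 8 = 0 then (8 : ℂ) else 0) (fun m => by simp),
    crank_weights n (fun m : ℤ => if (a - m) % 8 = 0 then (8 : ℂ) else 0)
      (fun m => by simp)] at s
  simp only [sum_range_succ, range_zero, sum_empty] at s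
  interval_cases a <;> norm_num at s ⊢ <;> exact s.symm

theorem crank_coeff (u : ℂ) (hu : u ^ 8 = 1) (n : ℕ) :
    coeff n (crankGF u) = ∑ a ∈ range 8, u ^ a * (crankCount a 8 n : ℂ) := by
  have u0 : u ≠ 0 := by rintro rfl; norm_num at hu
  rw [crankGF, coeff_mk, crank_weights n (fun m => u ^ m)]
  · simp
  · intro m
    conv_lhs => rw [← Int.mul_ediv_add_emod m 8, zpow_add₀ u0, zpow_mul]
    have : u ^ (8 : ℤ) = 1 := by exact_mod_cast hu
    rw [this, one_zpow, one_mul]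

theorem alg (ω κ c0 c1 c2 c3 c4 n0 n1 n2 n3 n4 : ℂ) (ω4 : ω ^ 4 = -1)
    (E1 : c0 + ω * c1 + ω ^ 2 * c2 + ω ^ 3 * c3 + ω ^ 4 * c4 + ω ^ 5 * c3 + ω ^ 6 * c2 + ω ^ 7 * c1 =
      (1 - ω - -ω ^ 3) * κ)
    (E2 : c0 + (-ω) * c1 + (-ω) ^ 2 * c2 + (-ω) ^ 3 * c3 + (-ω) ^ 4 * c4 + (-ω) ^ 5 * c3 +
      (-ω) ^ 6 * c2 + (-ω) ^ 7 * c1 = (1 - -ω - -(-ω ^ 3)) * κ)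
    (RC : n0 + n1 - n2 - n3 = 0) (RI : n0 - n4 = c0 - 2 * c2 + c4)
    (p : c0 + 2 * c1 + 2 * c2 + 2 * c3 + c4 = n0 + 2 * n1 + 2 * n2 + 2 * n3 + n4) :
    c0 + c1 = c3 + c4 ∧ c3 + c4 = n0 + n1 ∧ n0 + n1 = n2 + n3 := by
  have G1 : (c0 - c4) + (ω - ω ^ 3) * (c1 - c3) = (1 - (ω - ω ^ 3)) * κ := by
    linear_combination E1 - (c4 + ω * c3 + ω ^ 2 * c2 + ω ^ 3 * c1) * ω4
  have G2 : (c0 - c4) - (ω - ω ^ 3) * (c1 - c3) = (1 + (ω - ω ^ 3)) * κ := by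
    linear_combination E2 - (c4 - ω * c3 + ω ^ 2 * c2 - ω ^ 3 * c1) * ω4
  have hs : (ω - ω ^ 3) ^ 2 = 2 := by linear_combination (ω ^ 2 - 2) * ω4
  have F1 : c0 - c4 = κ := by linear_combination (G1 + G2) / 2
  have F2 : c1 - c3 = -κ := by
    linear_combination (ω - ω ^ 3) * (G1 - G2) / 4 - (c1 - c3 + κ) / 2 * hs
  have A : c0 + c1 = c3 + c4 := by linear_combination F1 + F2
  exact ⟨A, by linear_combination (-1 / 2) * A + p / 4 - RI / 4 - RC / 2, by linear_combination RC⟩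

set_option maxHeartbeats 1000000 in
theorem final (n : ℕ) :
    (crankCount 0 8 (4 * n + 3) + crankCount 1 8 (4 * n + 3) : ℂ) =
      crankCount 3 8 (4 * n + 3) + crankCount 4 8 (4 * n + 3) ∧
    (crankCount 3 8 (4 * n + 3) + crankCount 4 8 (4 * n + 3) : ℂ) =
      rankCount 0 8 (4 * n + 3) + rankCount 1 8 (4 * n + 3) ∧
    (rankCount 0 8 (4 * n + 3) + rankCount 1 8 (4 * n + 3) : ℂ) =
      rankCount 2 8 (4 * n + 3) + rankCount 3 8 (4 * n + 3) := by
  have hω := Complex.isPrimitiveRoot_exp 8 (by norm_num)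
  set ω := Complex.exp (2 * Real.pi * Complex.I / (8 : ℕ))
  have ω8 : ω ^ 8 = 1 := hω.pow_eq_one
  have ω4 : ω ^ 4 = -1 := by
    have h1 : (ω ^ 4 - 1) * (ω ^ 4 + 1) = 0 := by linear_combination ω8
    rcases mul_eq_zero.mp h1 with h | h
    · exfalso
      exact hω.pow_ne_one_of_pos_of_lt (by norm_num) (by norm_num : 4 < 8) (by linear_combination h)
    · linear_combination h
  have hinv : ω⁻¹ = -ω ^ 3 := by
    apply inv_eq_of_mul_eq_one_right; linear_combination -ω4
  have rs := rank_count_symm (4 * n + 3)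
  have cs := crank_count_symm ω hω (4 * n + 3) (by omega)
  have rs1 := rs 1 (by norm_num) (by norm_num)
  have rs2 := rs 2 (by norm_num) (by norm_num)
  have rs3 := rs 3 (by norm_num) (by norm_num)
  have cs1 := cs 1 (by norm_num) (by norm_num)
  have cs2 := cs 2 (by norm_num) (by norm_num)
  have cs3 := cs 3 (by norm_num) (by norm_num)
  have E1 := crank_eight ω ω4 (4 * n + 3) (by omega)
  have E2 := crank_eight (-ω) (by linear_combination ω4) (4 * n + 3) (by omega)
  rw [crank_coeff _ ω8] at E1
  rw [crank_coeff _ (by linear_combination ω8), inv_neg] at E2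
  rw [hinv] at E1 E2
  have RC := rankC n
  have RI := rankI n
  rw [rank_weights _ cC (fun m => by simp [cC])] at RC
  rw [rank_weights _ cI (fun m => by simp [cI]), crank_coeff _ (by
    linear_combination (Complex.I ^ 4 + 1) * Complex.I_pow_four)] at RI
  have p1 := rank_weights (4 * n + 3) (fun _ => 1) (fun _ => rfl)
  have p2 := crank_weights (4 * n + 3) (fun _ => 1) (fun _ => rfl)
  rw [rankGF, coeff_mk, p2] at p1
  clear p2 rs cs
  simp only [sum_range_succ, range_zero, sum_empty] at E1 E2 RC RI p1
  rw [I_pow_mod 4, I_pow_mod 5, I_pow_mod 6, I_pow_mod 7] at RI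
  norm_num [cC, cI, I_cube] at RC RI p1
  norm_num at rs1 rs2 rs3 cs1 cs2 cs3
  simp only [Nat.cast_ofNat, Nat.cast_one, Nat.cast_zero, pow_zero, pow_one, zero_add, one_mul] at E1 E2
  rw [← rs1, ← rs2, ← rs3, ← cs1, ← cs2, ← cs3] at p1
  rw [← cs1, ← cs2, ← cs3] at E1 E2 RI
  refine alg ω _ _ _ _ _ _ _ _ _ _ (rankCount 4 8 (4 * n + 3) : ℂ) ω4 E1 E2 ?_ ?_ ?_
  · linear_combination RC
  · linear_combination RI
  · linear_combination p1

end RC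
end

theorem stmt_17 : ∀ n : ℕ,
    crankCount 0 8 (4 * n + 3) + crankCount 1 8 (4 * n + 3) =
      crankCount 3 8 (4 * n + 3) + crankCount 4 8 (4 * n + 3) ∧
    crankCount 3 8 (4 * n + 3) + crankCount 4 8 (4 * n + 3) =
      rankCount 0 8 (4 * n + 3) + rankCount 1 8 (4 * n + 3) ∧
    rankCount 0 8 (4 * n + 3) + rankCount 1 8 (4 * n + 3) =
      rankCount 2 8 (4 * n + 3) + rankCount 3 8 (4 * n + 3) := by
  intro n
  have h := RC.final n
  exact_mod_cast h
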